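/- Let Θ = Θ(n_1,…,n_k) and Θ' = Θ(n'_1,…,n'_{k'}) be generalized Θ-graphs (k, k' ≥ 3) whose linear degrees ℓ and ℓ' both satisfy ℓ ≥ 2 and ℓ' ≥ 2, and let h = k − ℓ and h' = k' − ℓ' be their hyperbolic degrees. Then the right-angled Coxeter groups W_Θ and W_{Θ'} are quasi-isometric if and only if one of the following holds: (1) ℓ = ℓ' = 2 and h ≥ 1 and h' ≥ 1; (2) ℓ ≥ 3, ℓ' ≥ 3, h ≥ 1, and h' ≥ 1; (3) ℓ ≥ 3, ℓ' ≥ 3, and h = h' = 0. -/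

import Mathlib

open scoped Classical

/-- Vertices of the generalized Θ-graph `Θ(n 0, …, n (k-1))`: two essential vertices
(`Sum.inl true` and `Sum.inl false`) together with `n i` interior vertices on the `i`-th
path. -/
abbrev ThetaVertex {k : ℕ} (n : Fin k → ℕ) : Type :=
  Bool ⊕ (Σ i : Fin k, Fin (n i))

/-- Adjacency in the generalized Θ-graph: the essential vertex `true` is adjacent to the
first interior vertex of each path, the essential vertex `false` to the last, and
consecutive interior vertices of a common path are adjacent. -/
def ThetaAdj {k : ℕ} (n : Fin k → ℕ) : ThetaVertex n → ThetaVertex n → Prop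
  | Sum.inl _, Sum.inl _ => False
  | Sum.inl e, Sum.inr ⟨i, j⟩ => (e = true ∧ (j : ℕ) = 0) ∨ (e = false ∧ (j : ℕ) = n i - 1)
  | Sum.inr ⟨i, j⟩, Sum.inl e => (e = true ∧ (j : ℕ) = 0) ∨ (e = false ∧ (j : ℕ) = n i - 1)
  | Sum.inr ⟨i, j⟩, Sum.inr ⟨i', j'⟩ =>
      (i : ℕ) = (i' : ℕ) ∧ ((j' : ℕ) = (j : ℕ) + 1 ∨ (j : ℕ) = (j' : ℕ) + 1)

/-- The right-angled Coxeter relators of a graph: `v²` for each vertex `v` and `(uv)²` for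
each pair of adjacent vertices. -/
def racgRelators {V : Type} (adj : V → V → Prop) : Set (FreeGroup V) :=
  {w | (∃ v, w = FreeGroup.of v ^ 2) ∨
    ∃ u v, adj u v ∧ w = (FreeGroup.of u * FreeGroup.of v) ^ 2}

/-- The right-angled Coxeter group of a graph given by its adjacency relation. -/
abbrev RACG {V : Type} (adj : V → V → Prop) : Type :=
  PresentedGroup (racgRelators adj)

/-- The right-angled Coxeter group `W_{Θ(n 0, …, n (k-1))}` with nerve the generalized
Θ-graph. -/
abbrev ThetaRACG {k : ℕ} (n : Fin k → ℕ) : Type :=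
  RACG (ThetaAdj n)

/-- The linear degree of `Θ(n 0, …, n (k-1))`: the number of paths with one interior
vertex. -/
noncomputable def linearDegree {k : ℕ} (n : Fin k → ℕ) : ℕ :=
  (Finset.univ.filter fun i => n i = 1).card
/-- The word metric on a group with respect to a generating set `S`: the least length of a
word in `S ∪ S⁻¹` expressing `x⁻¹ * y`. -/
noncomputable def wordDist {G : Type} [Group G] (S : Set G) (x y : G) : ℕ :=
  sInf {c | ∃ l : List G, l.length = c ∧ (∀ s ∈ l, s ∈ S ∨ s⁻¹ ∈ S) ∧ y = x * l.prod}

/-- Finitely generated groups `G` and `G'` are quasi-isometric: there are finite generating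
sets, constants `L ≥ 1` and `C ≥ 0`, and a quasi-surjective `(L,C)`-quasi-isometric
embedding `f : G → G'` for the corresponding word metrics. -/
def QuasiIsometricGroups (G G' : Type) [Group G] [Group G'] : Prop :=
  ∃ (S : Finset G) (S' : Finset G'),
    Subgroup.closure (S : Set G) = ⊤ ∧ Subgroup.closure (S' : Set G') = ⊤ ∧
    ∃ (L C : ℝ) (f : G → G'), 1 ≤ L ∧ 0 ≤ C ∧
      (∀ x y : G,
        (1 / L) * (wordDist (S : Set G) x y : ℝ) - C ≤
            (wordDist (S' : Set G') (f x) (f y) : ℝ) ∧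
          (wordDist (S' : Set G') (f x) (f y) : ℝ) ≤
            L * (wordDist (S : Set G) x y : ℝ) + C) ∧
      ∀ y : G', ∃ x : G, (wordDist (S' : Set G') (f x) y : ℝ) ≤ C

namespace ThetaQI

section WordMetric

variable {G : Type} [Group G] {S : Set G}

theorem wordDist_mul_prod_le (x : G) (l : List G) (hl : ∀ s ∈ l, s ∈ S ∨ s⁻¹ ∈ S) :
    wordDist S x (x * l.prod) ≤ l.length :=
  Nat.sInf_le ⟨l, rfl, hl, rfl⟩

theorem exists_list_wordDist (hS : Subgroup.closure S = ⊤) (x y : G) :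
    ∃ l : List G, l.length = wordDist S x y ∧ (∀ s ∈ l, s ∈ S ∨ s⁻¹ ∈ S) ∧ y = x * l.prod := by
  have h : x⁻¹ * y ∈ Subgroup.closure S := hS ▸ Subgroup.mem_top _
  rw [← Subgroup.mem_toSubmonoid, Subgroup.closure_toSubmonoid] at h
  obtain ⟨l, hl, hp⟩ := Submonoid.exists_list_of_mem_closure h
  exact Nat.sInf_mem (s := {c | ∃ l : List G, l.length = c ∧ (∀ s ∈ l, s ∈ S ∨ s⁻¹ ∈ S) ∧
    y = x * l.prod}) ⟨l.length, l, rfl, hl, by simp [hp]⟩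

theorem wordDist_mul_left (z x y : G) : wordDist S (z * x) (z * y) = wordDist S x y := by
  simp [wordDist, mul_assoc]

theorem wordDist_triangle (hS : Subgroup.closure S = ⊤) (x y z : G) :
    wordDist S x z ≤ wordDist S x y + wordDist S y z := by
  obtain ⟨l, h1, h2, rfl⟩ := exists_list_wordDist hS x y
  obtain ⟨l', h1', h2', rfl⟩ := exists_list_wordDist hS (x * l.prod) z
  rw [← h1, ← h1', ← List.length_append, mul_assoc, ← List.prod_append]
  refine wordDist_mul_prod_le _ _ fun s hs => ?_
  rcases List.mem_append.1 hs with h | h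
  exacts [h2 s h, h2' s h]

theorem wordDist_comm (hS : Subgroup.closure S = ⊤) (x y : G) :
    wordDist S x y = wordDist S y x := by
  have key : ∀ x y : G, wordDist S y x ≤ wordDist S x y := by
    intro x y
    obtain ⟨l, h1, h2, rfl⟩ := exists_list_wordDist hS x y
    rw [← h1]
    have := wordDist_mul_prod_le (S := S) (x * l.prod) (l.map (·⁻¹)).reverse (by
      simp only [List.mem_reverse, List.mem_map]
      rintro _ ⟨s, hs, rfl⟩
      rw [inv_inv]; exact (h2 s hs).symm)
    simpa [← List.prod_inv_reverse] using this
  exact le_antisymm (key y x) (key x y)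

theorem finite_wordDist_ball (hfin : S.Finite) (hS : Subgroup.closure S = ⊤) (n : ℕ) :
    {g : G | wordDist S 1 g ≤ n}.Finite := by
  have key : {g : G | ∃ l : List G, l.length ≤ n ∧ (∀ s ∈ l, s ∈ S ∨ s⁻¹ ∈ S) ∧
      g = l.prod}.Finite := by
    induction n with
    | zero => exact (Set.finite_singleton (1 : G)).subset (by
        rintro g ⟨l, hl, -, rfl⟩
        simp [List.eq_nil_of_length_eq_zero (Nat.le_zero.1 hl)])
    | succ n ih =>
      refine ((Set.finite_singleton (1 : G)).union
        (Set.Finite.image2 (· * ·) (hfin.union hfin.inv) ih)).subset ?_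
      rintro g ⟨l, hl, h, rfl⟩
      cases l with
      | nil => left; simp
      | cons s l =>
        right
        refine ⟨s, ?_, l.prod, ⟨l, by simpa using hl, fun t ht => h t (by simp [ht]), rfl⟩, by simp⟩
        simpa using h s (by simp)
  refine key.subset fun g hg => ?_
  obtain ⟨l, h1, h2, h3⟩ := exists_list_wordDist hS 1 g
  exact ⟨l, h1 ▸ hg, h2, by simpa using h3⟩

theorem wordDist_one_inv_mul (x y : G) : wordDist S 1 (x⁻¹ * y) = wordDist S x y := by
  simpa using wordDist_mul_left (S := S) x⁻¹ x y

theorem wordDist_lipschitz {H : Type} [Group H] {T : Set H} (hS : Subgroup.closure S = ⊤)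
    (hT : Subgroup.closure T = ⊤) {f : G → H} {K : ℕ}
    (hf : ∀ x, ∀ s ∈ S, wordDist T (f x) (f (x * s)) ≤ K) (x y : G) :
    wordDist T (f x) (f y) ≤ K * wordDist S x y := by
  obtain ⟨l, h1, h2, rfl⟩ := exists_list_wordDist hS x y
  rw [← h1]
  clear h1
  induction l generalizing x with
  | nil => simpa using wordDist_mul_prod_le (S := T) (f x) [] (by simp)
  | cons s l ih =>
    have hs : wordDist T (f x) (f (x * s)) ≤ K := by
      rcases h2 s (by simp) with h | h
      · exact hf x s h
      · rw [wordDist_comm hT]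
        simpa using hf (x * s) _ h
    have := ih (x * s) fun t ht => h2 t (by simp [ht])
    have h3 := wordDist_triangle hT (f x) (f (x * s)) (f (x * s * l.prod))
    rw [List.prod_cons, ← mul_assoc, List.length_cons, mul_add]
    omega

end WordMetric

section Coarse

variable {G H M : Type*} [Group G] [Group H] [Group M]

/-- A map of groups is coarsely controlled if left translations move its values, measured on the
right, by finitely many amounts. -/
def Ctl (f : G → H) : Prop := ∀ a, (Set.range fun x => f (a * x) * (f x)⁻¹).Finite

/-- A self-map at bounded distance from the identity. -/
def Close (k : G → G) : Prop := (Set.range fun x => k x * x⁻¹).Finite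

/-- `G` is a coarse retract of `H`. -/
def CoarseRetract (G H : Type*) [Group G] [Group H] : Prop :=
  ∃ (f : G → H) (g : H → G), Ctl f ∧ Ctl g ∧ Close (g ∘ f)

/-- Coarse equivalence of groups. -/
def CoarseEquiv (G H : Type*) [Group G] [Group H] : Prop :=
  ∃ (f : G → H) (g : H → G), Ctl f ∧ Ctl g ∧ Close (g ∘ f) ∧ Close (f ∘ g)

theorem ctl_of_hom (f : G →* H) : Ctl f := fun a => by
  simp only [map_mul, mul_assoc, mul_inv_cancel, mul_one]
  exact (Set.finite_singleton (f a)).subset (by rintro _ ⟨x, rfl⟩; rfl)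

theorem ctl_of_closure {f : G → H} {S : Set G} (hS : Subgroup.closure S = ⊤)
    (h : ∀ a ∈ S, (Set.range fun x => f (a * x) * (f x)⁻¹).Finite) : Ctl f := by
  intro a
  have ha : a ∈ Subgroup.closure S := hS ▸ Subgroup.mem_top a
  induction ha using Subgroup.closure_induction with
  | mem x hx => exact h x hx
  | one => exact (Set.finite_singleton (1 : H)).subset (by rintro _ ⟨x, rfl⟩; simp)
  | mul a b _ _ ha hb =>
    refine (Set.Finite.image2 (· * ·) ha hb).subset ?_
    rintro _ ⟨x, rfl⟩
    exact ⟨_, ⟨b * x, rfl⟩, _, ⟨x, rfl⟩, by simp [mul_assoc]⟩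
  | inv a _ ha =>
    refine (ha.inv).subset ?_
    rintro _ ⟨x, rfl⟩
    exact ⟨a⁻¹ * x, by simp⟩

theorem Ctl.finite_of_finite {f : G → H} (hf : Ctl f) {D : Set G} (hD : D.Finite) :
    {z | ∃ a ∈ D, ∃ x, z = f (a * x) * (f x)⁻¹}.Finite := by
  refine (hD.biUnion fun a _ => hf a).subset ?_
  rintro _ ⟨a, ha, x, rfl⟩
  exact Set.mem_biUnion ha ⟨x, rfl⟩

theorem Ctl.comp {f : G → H} {g : H → M} (hg : Ctl g) (hf : Ctl f) : Ctl (g ∘ f) := by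
  intro a
  refine (hg.finite_of_finite (hf a)).subset ?_
  rintro _ ⟨x, rfl⟩
  exact ⟨_, ⟨x, rfl⟩, f x, by simp⟩

theorem Close.comp {M : Type*} {f : G → H} {g : H → G} {f' : H → M} {g' : M → H} (hg : Ctl g)
    (h : Close (g ∘ f)) (h' : Close (g' ∘ f')) : Close ((g ∘ g') ∘ (f' ∘ f)) := by
  refine (Set.Finite.image2 (· * ·) (hg.finite_of_finite h') h).subset ?_
  rintro _ ⟨x, rfl⟩
  exact ⟨_, ⟨_, ⟨f x, rfl⟩, f x, rfl⟩, _, ⟨x, rfl⟩, by simp⟩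

theorem CoarseEquiv.symm (h : CoarseEquiv G H) : CoarseEquiv H G := by
  obtain ⟨f, g, h1, h2, h3, h4⟩ := h
  exact ⟨g, f, h2, h1, h4, h3⟩

theorem CoarseEquiv.trans (h : CoarseEquiv G H) (h' : CoarseEquiv H M) : CoarseEquiv G M := by
  obtain ⟨f, g, h1, h2, h3, h4⟩ := h
  obtain ⟨f', g', h1', h2', h3', h4'⟩ := h'
  exact ⟨f' ∘ f, g ∘ g', h1'.comp h1, h2.comp h2', Close.comp h2 h3 h3', Close.comp h1' h4' h4⟩

theorem CoarseEquiv.retract (h : CoarseEquiv G H) : CoarseRetract G H := by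
  obtain ⟨f, g, h1, h2, h3, -⟩ := h
  exact ⟨f, g, h1, h2, h3⟩

theorem CoarseRetract.trans (h : CoarseRetract G H) (h' : CoarseRetract H M) :
    CoarseRetract G M := by
  obtain ⟨f, g, h1, h2, h3⟩ := h
  obtain ⟨f', g', h1', h2', h3'⟩ := h'
  exact ⟨f' ∘ f, g ∘ g', h1'.comp h1, h2.comp h2', Close.comp h2 h3 h3'⟩

theorem close_of_eq {k : G → G} (h : ∀ x, k x = x) : Close k :=
  (Set.finite_singleton (1 : G)).subset (by rintro _ ⟨x, rfl⟩; simp [h])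

theorem coarseEquiv_of_equiv (e : G ≃ H) (h : Ctl e) (h' : Ctl e.symm) : CoarseEquiv G H :=
  ⟨e, e.symm, h, h', close_of_eq (by simp), close_of_eq (by simp)⟩

theorem coarseEquiv_of_mulEquiv (e : G ≃* H) : CoarseEquiv G H :=
  coarseEquiv_of_equiv e.toEquiv (ctl_of_hom e.toMonoidHom) (ctl_of_hom e.symm.toMonoidHom)

theorem coarseRetract_of_homs (f : G →* H) (g : H →* G) (h : ∀ x, g (f x) = x) :
    CoarseRetract G H :=
  ⟨f, g, ctl_of_hom f, ctl_of_hom g, close_of_eq h⟩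

end Coarse

section WordMetricCoarse

variable {G H : Type} [Group G] [Group H]

theorem finite_range_of_wordDist {α : Type*} {S : Set G} (hfin : S.Finite)
    (hS : Subgroup.closure S = ⊤) {k : α → G} {R : ℕ} (h : ∀ x, wordDist S 1 (k x) ≤ R) :
    (Set.range k).Finite :=
  (finite_wordDist_ball hfin hS R).subset (by rintro _ ⟨x, rfl⟩; exact h x)

theorem exists_wordDist_bound_of_finite {S D : Set G} (hD : D.Finite) :
    ∃ R, ∀ g ∈ D, wordDist S 1 g ≤ R := by
  obtain ⟨R, hR⟩ := (hD.image (wordDist S 1)).bddAbove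
  exact ⟨R, fun g hg => hR ⟨g, hg, rfl⟩⟩

theorem ctl_inv_conj_of_lipschitz {S : Set G} {T : Set H} (hT : T.Finite)
    (hT' : Subgroup.closure T = ⊤) {f : G → H} {b : ℕ → ℕ}
    (hf : ∀ x y, wordDist T (f x) (f y) ≤ b (wordDist S x y)) : Ctl fun x => (f x⁻¹)⁻¹ := by
  intro a
  refine finite_range_of_wordDist hT hT' (R := b (wordDist S a⁻¹ 1)) fun x => ?_
  have := hf (x⁻¹ * a⁻¹) x⁻¹
  rw [← wordDist_one_inv_mul] at this
  have h2 : wordDist S (x⁻¹ * a⁻¹) x⁻¹ = wordDist S a⁻¹ 1 := by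
    simpa using wordDist_mul_left (S := S) x⁻¹ a⁻¹ 1
  rw [h2] at this
  simpa using this

theorem Ctl.exists_lipschitz {S : Set G} {T : Set H} (hSf : S.Finite)
    (hS : Subgroup.closure S = ⊤) (hT : Subgroup.closure T = ⊤) {f : G → H} (hf : Ctl f) :
    ∃ K : ℕ, ∀ x y, wordDist T ((f x⁻¹)⁻¹) ((f y⁻¹)⁻¹) ≤ K * wordDist S x y := by
  obtain ⟨K, hK⟩ := exists_wordDist_bound_of_finite (S := T) (hf.finite_of_finite hSf.inv).inv
  refine ⟨K, wordDist_lipschitz hS hT (f := fun x => (f x⁻¹)⁻¹) fun x s hs => ?_⟩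
  rw [← wordDist_one_inv_mul]
  refine hK _ ?_
  simp only [Set.mem_inv]
  exact ⟨s⁻¹, by simpa using hs, x⁻¹, by simp⟩

theorem Close.exists_bound {S : Set G} {k : G → G} (h : Close k) :
    ∃ R : ℕ, ∀ x, wordDist S ((k x⁻¹)⁻¹) x ≤ R := by
  obtain ⟨R, hR⟩ := exists_wordDist_bound_of_finite (S := S) h
  refine ⟨R, fun x => ?_⟩
  rw [← wordDist_one_inv_mul]
  exact hR _ ⟨x⁻¹, by simp⟩

theorem quasiIsometricGroups_of_coarseEquiv {S : Finset G} {T : Finset H}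
    (hS : Subgroup.closure (S : Set G) = ⊤) (hT : Subgroup.closure (T : Set H) = ⊤)
    (h : CoarseEquiv G H) : QuasiIsometricGroups G H := by
  obtain ⟨f, g, hf, hg, hgf, hfg⟩ := h
  obtain ⟨K, hK⟩ := hf.exists_lipschitz S.finite_toSet hS hT
  obtain ⟨K', hK'⟩ := hg.exists_lipschitz T.finite_toSet hT hS
  obtain ⟨R, hR⟩ := hgf.exists_bound (S := (S : Set G))
  obtain ⟨R', hR'⟩ := hfg.exists_bound (S := (T : Set H))
  refine ⟨S, T, hS, hT, (K + K' + 1 : ℕ), (2 * R + R' : ℕ), fun x => (f x⁻¹)⁻¹, by simp; positivity,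
    by positivity, fun x y => ⟨?_, ?_⟩, fun y => ⟨(g y⁻¹)⁻¹, ?_⟩⟩
  · have h1 := hK' ((f x⁻¹)⁻¹) ((f y⁻¹)⁻¹)
    have h2 := hR x
    have h3 := hR y
    have h4 := wordDist_triangle hS x ((g (f x⁻¹))⁻¹) y
    have h5 := wordDist_triangle hS ((g (f x⁻¹))⁻¹) ((g (f y⁻¹))⁻¹) y
    rw [wordDist_comm hS] at h2
    simp only [Function.comp_apply, inv_inv] at h1 h2 h3
    have h6 : wordDist (S : Set G) x y ≤
        (K + K' + 1) * (wordDist (T : Set H) ((f x⁻¹)⁻¹) ((f y⁻¹)⁻¹) + (2 * R + R')) := by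
      nlinarith [Nat.zero_le (wordDist (T : Set H) ((f x⁻¹)⁻¹) ((f y⁻¹)⁻¹))]
    have h7 : (wordDist (S : Set G) x y : ℝ) ≤
        ((K + K' + 1 : ℕ) : ℝ) *
          ((wordDist (T : Set H) ((f x⁻¹)⁻¹) ((f y⁻¹)⁻¹) : ℝ) + (2 * R + R' : ℕ)) := by
      exact_mod_cast h6
    have hpos : (0 : ℝ) < (K + K' + 1 : ℕ) := by positivity
    rw [sub_le_iff_le_add, one_div, inv_mul_le_iff₀ hpos]
    exact h7
  · have h1 := hK x y
    have : wordDist (T : Set H) ((f x⁻¹)⁻¹) ((f y⁻¹)⁻¹) ≤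
        (K + K' + 1) * wordDist (S : Set G) x y + (2 * R + R') := by nlinarith
    exact_mod_cast this
  · have h1 := hR' y
    have : wordDist (T : Set H) ((f ((g y⁻¹)⁻¹)⁻¹)⁻¹) y ≤ 2 * R + R' := by
      simp only [Function.comp_apply, inv_inv] at h1 ⊢; omega
    exact_mod_cast this

theorem coarseEquiv_of_quasiIsometricGroups (h : QuasiIsometricGroups G H) :
    CoarseEquiv G H := by
  obtain ⟨S, T, hS, hT, L, C, f, hL, hC, hf, hsurj⟩ := h
  choose g hg using hsurj
  have hL0 : 0 < L := by linarith
  have hlow : ∀ x y : G, (wordDist (S : Set G) x y : ℝ) ≤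
      L * ((wordDist (T : Set H) (f x) (f y) : ℝ) + C) := fun x y => by
    have := (hf x y).1
    rwa [sub_le_iff_le_add, one_div, inv_mul_le_iff₀ hL0] at this
  have hgg : ∀ x y : H, (wordDist (S : Set G) (g x) (g y) : ℝ) ≤
      L * ((wordDist (T : Set H) x y : ℝ) + 3 * C) := fun x y => by
    refine (hlow _ _).trans ?_
    have h1 := wordDist_triangle hT (f (g x)) x (f (g y))
    have h2 := wordDist_triangle hT x y (f (g y))
    have h3 := hg y
    rw [wordDist_comm hT] at h3
    have h4 : (wordDist (T : Set H) (f (g x)) (f (g y)) : ℝ) ≤ C + wordDist (T : Set H) x y + C := by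
      have : (wordDist (T : Set H) (f (g x)) (f (g y)) : ℝ) ≤
        wordDist (T : Set H) (f (g x)) x + (wordDist (T : Set H) x y +
          wordDist (T : Set H) y (f (g y))) := by exact_mod_cast h1.trans (by omega)
      linarith [hg x]
    exact mul_le_mul_of_nonneg_left (by linarith) hL0.le
  refine ⟨fun x => (f x⁻¹)⁻¹, fun x => (g x⁻¹)⁻¹,
    ctl_inv_conj_of_lipschitz (S := (S : Set G)) (b := fun m => ⌊L * m + C⌋₊) T.finite_toSet hT
      fun x y => Nat.le_floor (hf x y).2,
    ctl_inv_conj_of_lipschitz (S := (T : Set H)) (b := fun m => ⌊L * (m + 3 * C)⌋₊) S.finite_toSet hS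
      fun x y => Nat.le_floor (hgg x y),
    finite_range_of_wordDist S.finite_toSet hS (R := ⌊L * (C + C)⌋₊) fun x => ?_,
    finite_range_of_wordDist T.finite_toSet hT (R := ⌊C⌋₊) fun x => ?_⟩
  · have h1 := hlow (g (f x⁻¹)) x⁻¹
    rw [← wordDist_one_inv_mul] at h1
    refine Nat.le_floor ?_
    simp only [Function.comp_apply, inv_inv]
    exact h1.trans (mul_le_mul_of_nonneg_left (by linarith [hg (f x⁻¹)]) hL0.le)
  · have h1 := hg x⁻¹
    rw [← wordDist_one_inv_mul] at h1
    refine Nat.le_floor ?_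
    simpa using h1

end WordMetricCoarse

open Monoid Monoid.PushoutI Monoid.PushoutI.NormalWord

section Gluing

variable {ι : Type*} {G G' : ι → Type*} {H : Type*} [∀ i, Group (G i)] [∀ i, Group (G' i)]
  [Group H] {φ : ∀ i, H →* G i} {φ' : ∀ i, H →* G' i}

/-- The image of a transversal under a family of equivariant bijections. -/
noncomputable def mapTransversal (d : Transversal φ) (hφ' : ∀ i, Function.Injective (φ' i))
    (F : ∀ i, G i ≃ G' i) (hF : ∀ i h g, F i (φ i h * g) = φ' i h * F i g) (h1 : ∀ i, F i 1 = 1) :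
    Transversal φ' where
  injective := hφ'
  set i := F i '' d.set i
  one_mem i := ⟨1, d.one_mem i, h1 i⟩
  compl i := by
    have hc := d.compl i
    rw [Subgroup.IsComplement, Function.bijective_iff_existsUnique] at hc ⊢
    intro b
    obtain ⟨⟨⟨_, h, rfl⟩, ⟨t, ht⟩⟩, hx, hu⟩ := hc ((F i).symm b)
    refine ⟨⟨⟨φ' i h, h, rfl⟩, ⟨F i t, t, ht, rfl⟩⟩, ?_, ?_⟩
    · simp only at hx ⊢
      rw [← hF, hx, Equiv.apply_symm_apply]
    · rintro ⟨⟨_, h', rfl⟩, ⟨_, t', ht', rfl⟩⟩ hb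
      simp only at hb
      have := hu ⟨⟨φ i h', h', rfl⟩, ⟨t', ht'⟩⟩ (by simp only; rw [← hb, ← hF, Equiv.symm_apply_apply])
      obtain ⟨e1, e2⟩ := Prod.mk.inj this
      obtain rfl := d.injective i (congrArg Subtype.val e1)
      obtain rfl : t' = t := congrArg Subtype.val e2
      rfl

/-- Apply a family of bijections to every letter of a normal word. -/
noncomputable def mapNormalWord {d : Transversal φ} {d' : Transversal φ'} (F : ∀ i, G i ≃ G' i)
    (h1 : ∀ i, F i 1 = 1) (hd : ∀ i, ∀ g ∈ d.set i, F i g ∈ d'.set i) (w : NormalWord d) :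
    NormalWord d' where
  toList := w.toList.map fun x => ⟨x.1, F x.1 x.2⟩
  ne_one := by
    intro l hl
    obtain ⟨x, hx, rfl⟩ := List.mem_map.1 hl
    intro h
    exact w.ne_one x hx ((F x.1).injective (h.trans (h1 _).symm))
  chain_ne := by
    rw [List.isChain_map]
    exact w.chain_ne
  head := w.head
  normalized := by
    intro i g hg
    obtain ⟨⟨j, x⟩, hx, h⟩ := List.mem_map.1 hg
    cases h
    exact hd _ _ (w.normalized _ _ hx)

theorem prod_rcons_eq {d : Transversal φ} (i : ι) (p : Pair d i) :
    (rcons i p).prod = of i p.head * ofCoprodI p.tail.prod := by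
  have := ((d.compl i).equiv_fst_mul_equiv_snd p.head)
  conv_rhs => rw [← this]
  simp only [NormalWord.prod, rcons, CoprodI.Word.equivPair_symm, ← of_apply_eq_base φ i,
    MonoidHom.apply_ofInjective_symm, CoprodI.Word.prod_rcons, map_mul, ofCoprodI_of, mul_assoc]

theorem exists_eq_of_mul_prod (d : Transversal φ) (i : ι) (x : PushoutI φ) :
    ∃ (g : G i) (y : NormalWord d), y.head = 1 ∧ y.fstIdx ≠ some i ∧ x = of i g * y.prod := by
  let p := equivPair i (NormalWord.equiv (d := d) x)
  refine ⟨p.head, ⟨p.tail, 1, p.normalized⟩, rfl, p.fstIdx_ne, ?_⟩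
  have h : (rcons i p).prod = x := by
    have : rcons i p = NormalWord.equiv (d := d) x :=
      (equivPair i).symm_apply_apply (NormalWord.equiv (d := d) x)
    rw [this]
    exact (NormalWord.equiv (d := d)).symm_apply_apply x
  rw [← h, prod_rcons_eq]
  simp [NormalWord.prod]

/-- The bijection of amalgamated products induced by equivariant bijections of the factors. -/
noncomputable def gluedMap {d : Transversal φ} {d' : Transversal φ'} (F : ∀ i, G i ≃ G' i)
    (h1 : ∀ i, F i 1 = 1) (hd : ∀ i, ∀ g ∈ d.set i, F i g ∈ d'.set i) (x : PushoutI φ) :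
    PushoutI φ' :=
  (mapNormalWord (d' := d') F h1 hd (NormalWord.equiv (d := d) x)).prod

variable {d : Transversal φ} {d' : Transversal φ'} (F : ∀ i, G i ≃ G' i)
    (h1 : ∀ i, F i 1 = 1) (hd : ∀ i, ∀ g ∈ d.set i, F i g ∈ d'.set i)

theorem gluedMap_prod (w : NormalWord d) :
    gluedMap (d' := d') F h1 hd w.prod = (mapNormalWord (d' := d') F h1 hd w).prod := by
  have : NormalWord.equiv (d := d) w.prod = w := NormalWord.equiv.apply_symm_apply w
  rw [gluedMap, this]

theorem equiv_gluedMap (x : PushoutI φ) :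
    NormalWord.equiv (d := d') (gluedMap (d' := d') F h1 hd x) =
      mapNormalWord (d' := d') F h1 hd (NormalWord.equiv (d := d) x) :=
  NormalWord.equiv.apply_symm_apply _

theorem gluedMap_of_mul (hF : ∀ i h g, F i (φ i h * g) = φ' i h * F i g) (i : ι) (g : G i)
    (y : NormalWord d) (hy : y.head = 1) (hi : y.fstIdx ≠ some i) :
    gluedMap (d' := d') F h1 hd (of i g * y.prod) =
      of i (F i g) * (mapNormalWord (d' := d') F h1 hd y).prod := by
  obtain ⟨⟨⟨_, h, rfl⟩, ⟨t, ht⟩⟩, rfl⟩ := (d.compl i).2 g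
  simp only
  rw [hF, map_mul, map_mul, of_apply_eq_base, of_apply_eq_base, mul_assoc, mul_assoc]
  obtain ⟨w, e, hw⟩ := y
  simp only at hy hi
  subst hy
  by_cases h0 : t = 1
  · subst h0
    have : base φ h * (of i 1 * NormalWord.prod (d := d) ⟨w, 1, hw⟩) =
        NormalWord.prod (d := d) ⟨w, h, hw⟩ := by simp [NormalWord.prod]
    rw [this, gluedMap_prod, h1]
    simp [NormalWord.prod, mapNormalWord]
  · have : base φ h * (of i t * NormalWord.prod (d := d) ⟨w, 1, hw⟩) =
        NormalWord.prod (d := d) ⟨CoprodI.Word.cons t w hi h0, h, fun j g hg => by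
          rcases List.mem_cons.1 hg with hg | hg
          · cases hg; exact ht
          · exact hw _ _ hg⟩ := by
      simp [NormalWord.prod]
    rw [this, gluedMap_prod]
    simp [NormalWord.prod, mapNormalWord, CoprodI.Word.cons, CoprodI.Word.prod]

theorem closure_range_of_union_base :
    Subgroup.closure ((⋃ i, Set.range (of (φ := φ) i)) ∪ Set.range (base φ)) = ⊤ := by
  rw [Subgroup.eq_top_iff']
  intro x
  induction x using PushoutI.induction_on with
  | of i g => exact Subgroup.subset_closure (Or.inl (Set.mem_iUnion.2 ⟨i, g, rfl⟩))
  | base h => exact Subgroup.subset_closure (Or.inr ⟨h, rfl⟩)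
  | mul x y hx hy => exact mul_mem hx hy

theorem ctl_gluedMap (hF : ∀ i h g, F i (φ i h * g) = φ' i h * F i g) (hC : ∀ i, Ctl (F i)) :
    Ctl (gluedMap (d' := d') F h1 hd) := by
  refine ctl_of_closure closure_range_of_union_base ?_
  rintro _ (ha | ⟨h, rfl⟩)
  · obtain ⟨i, a, rfl⟩ := Set.mem_iUnion.1 ha
    refine ((hC i a).image (of i)).subset ?_
    rintro _ ⟨x, rfl⟩
    obtain ⟨g, y, hy, hi, rfl⟩ := exists_eq_of_mul_prod d i x
    refine ⟨_, ⟨g, rfl⟩, ?_⟩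
    simp only
    rw [← mul_assoc, ← map_mul, gluedMap_of_mul F h1 hd hF i _ y hy hi,
      gluedMap_of_mul F h1 hd hF i _ y hy hi]
    simp
  · refine (Set.finite_singleton (base φ' h)).subset ?_
    rintro _ ⟨x, rfl⟩
    obtain ⟨w, rfl⟩ := (NormalWord.equiv (d := d)).symm.surjective x
    change gluedMap F h1 hd (base φ h * w.prod) * (gluedMap F h1 hd w.prod)⁻¹ = _
    rw [← prod_base_smul, gluedMap_prod, gluedMap_prod, mul_inv_eq_iff_eq_mul]
    simp [NormalWord.prod, mapNormalWord, base_smul_def', mul_assoc]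

end Gluing

theorem coarseEquiv_pushoutI {ι : Type*} {G G' : ι → Type*} {H : Type*} [∀ i, Group (G i)]
    [∀ i, Group (G' i)] [Group H] {φ : ∀ i, H →* G i} {φ' : ∀ i, H →* G' i}
    (hφ : ∀ i, Function.Injective (φ i)) (hφ' : ∀ i, Function.Injective (φ' i))
    (F : ∀ i, G i ≃ G' i) (h1 : ∀ i, F i 1 = 1)
    (hF : ∀ i h g, F i (φ i h * g) = φ' i h * F i g) (hC : ∀ i, Ctl (F i))
    (hC' : ∀ i, Ctl (F i).symm) : CoarseEquiv (PushoutI φ) (PushoutI φ') := by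
  obtain ⟨d⟩ := transversal_nonempty φ hφ
  let d' := mapTransversal d hφ' F hF h1
  have hd : ∀ i, ∀ g ∈ d.set i, F i g ∈ d'.set i := fun i g hg => ⟨g, hg, rfl⟩
  have hd' : ∀ i, ∀ g ∈ d'.set i, (F i).symm g ∈ d.set i := by
    rintro i _ ⟨g, hg, rfl⟩
    simpa using hg
  have h1' : ∀ i, (F i).symm 1 = 1 := fun i => by rw [← h1 i, Equiv.symm_apply_apply]
  have hF' : ∀ i h g, (F i).symm (φ' i h * g) = φ i h * (F i).symm g := fun i h g => by
    rw [Equiv.symm_apply_eq, hF, Equiv.apply_symm_apply]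
  refine ⟨gluedMap F h1 hd, gluedMap (fun i => (F i).symm) h1' hd', ctl_gluedMap F h1 hd hF hC,
    ctl_gluedMap _ h1' hd' hF' hC', close_of_eq fun x => ?_, close_of_eq fun x => ?_⟩
  · simp only [Function.comp_apply]
    refine (NormalWord.equiv (d := d)).injective ?_
    rw [equiv_gluedMap, equiv_gluedMap]
    refine NormalWord.ext rfl ?_
    simp [mapNormalWord, Function.comp_def]
  · simp only [Function.comp_apply]
    refine (NormalWord.equiv (d := d')).injective ?_
    rw [equiv_gluedMap, equiv_gluedMap]
    refine NormalWord.ext rfl ?_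
    simp [mapNormalWord, Function.comp_def]

open Monoid Monoid.PushoutI

section RACG

variable {V : Type} {adj : V → V → Prop}

/-- The standard generators of a right-angled Coxeter group. -/
def gen (adj : V → V → Prop) (v : V) : RACG adj := PresentedGroup.of v

theorem gen_mul_self (v : V) : gen adj v * gen adj v = 1 := by
  have : PresentedGroup.mk (racgRelators adj) (FreeGroup.of v ^ 2) = 1 :=
    PresentedGroup.one_of_mem (Or.inl ⟨v, rfl⟩)
  rw [pow_two, map_mul] at this
  exact this

theorem gen_inv (v : V) : (gen adj v)⁻¹ = gen adj v :=
  inv_eq_of_mul_eq_one_left (gen_mul_self v)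

theorem gen_mul_gen_mul (v : V) (g : RACG adj) : gen adj v * (gen adj v * g) = g := by
  rw [← mul_assoc, gen_mul_self, one_mul]

theorem mul_gen_mul_gen (v : V) (g : RACG adj) : g * gen adj v * gen adj v = g := by
  rw [mul_assoc, gen_mul_self, mul_one]

theorem commute_of_sq_eq_one {M : Type*} [Group M] {x y : M} (hx : x * x = 1) (hy : y * y = 1)
    (h : x * y * (x * y) = 1) : x * y = y * x := by
  have hx' : x⁻¹ = x := inv_eq_of_mul_eq_one_left hx
  have hy' : y⁻¹ = y := inv_eq_of_mul_eq_one_left hy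
  have := eq_inv_of_mul_eq_one_left h
  rwa [mul_inv_rev, hx', hy'] at this

theorem gen_comm {u v : V} (h : adj u v) : gen adj u * gen adj v = gen adj v * gen adj u := by
  have : PresentedGroup.mk (racgRelators adj) ((FreeGroup.of u * FreeGroup.of v) ^ 2) = 1 :=
    PresentedGroup.one_of_mem (Or.inr ⟨u, v, h, rfl⟩)
  rw [pow_two, map_mul, map_mul] at this
  exact commute_of_sq_eq_one (gen_mul_self u) (gen_mul_self v) this

/-- The universal property of a right-angled Coxeter group. -/
def racgLift {M : Type*} [Group M] (f : V → M) (h : ∀ v, f v * f v = 1)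
    (hc : ∀ u v, adj u v → f u * f v = f v * f u) : RACG adj →* M :=
  PresentedGroup.toGroup (f := f) (by
    rintro _ (⟨v, rfl⟩ | ⟨u, v, huv, rfl⟩)
    · simp [pow_two, h]
    · simp only [pow_two, map_mul, FreeGroup.lift_apply_of]
      rw [mul_assoc, hc u v huv, ← mul_assoc (f v), h, one_mul, h])

@[simp]
theorem racgLift_gen {M : Type*} [Group M] (f : V → M) (h : ∀ v, f v * f v = 1)
    (hc : ∀ u v, adj u v → f u * f v = f v * f u) (v : V) :
    racgLift f h hc (gen adj v) = f v :=
  PresentedGroup.toGroup.of _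

theorem closure_gen : Subgroup.closure (Set.range (gen adj)) = ⊤ :=
  PresentedGroup.closure_range_of _

theorem racg_hom_ext {M : Type*} [Monoid M] {f g : RACG adj →* M}
    (h : ∀ v, f (gen adj v) = g (gen adj v)) : f = g :=
  MonoidHom.ext fun x => by
    have hx : x ∈ Subgroup.closure (Set.range (gen adj)) := closure_gen ▸ Subgroup.mem_top x
    induction hx using Subgroup.closure_induction_left with
    | one => simp
    | mul_left x hx y _ ih => obtain ⟨v, rfl⟩ := hx; rw [map_mul, map_mul, h, ih]
    | inv_mul_cancel x hx y _ ih =>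
      obtain ⟨v, rfl⟩ := hx; rw [gen_inv, map_mul, map_mul, h, ih]

theorem racg_induction {p : RACG adj → Prop} (one : p 1)
    (mul : ∀ v g, p g → p (gen adj v * g)) (g : RACG adj) : p g := by
  have hg : g ∈ Subgroup.closure (Set.range (gen adj)) := closure_gen ▸ Subgroup.mem_top g
  induction hg using Subgroup.closure_induction_left with
  | one => exact one
  | mul_left x hx y _ h => obtain ⟨v, rfl⟩ := hx; exact mul v y h
  | inv_mul_cancel x hx y _ h => obtain ⟨v, rfl⟩ := hx; rw [gen_inv]; exact mul v y h

theorem ctl_of_gen {M : Type*} [Group M] {f : RACG adj → M}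
    (h : ∀ v, (Set.range fun x => f (gen adj v * x) * (f x)⁻¹).Finite) : Ctl f :=
  ctl_of_closure closure_gen (by rintro _ ⟨v, rfl⟩; exact h v)

end RACG

/-- The free product of copies of `ℤ/2` indexed by `ι`. -/
abbrev Fr (ι : Type) : Type := RACG (fun _ _ : ι => False)

/-- The infinite dihedral group. -/
abbrev Dih : Type := Fr Bool

/-- Generators of a free product of copies of `ℤ/2`. -/
abbrev fgen {ι : Type} (i : ι) : Fr ι := gen (fun _ _ : ι => False) i

/-- Adjacency in a path on the vertices `0, …, m`. -/
def PathAdj (m : ℕ) (i j : Fin (m + 1)) : Prop := (i : ℕ) + 1 = j ∨ (j : ℕ) + 1 = i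

/-- The right-angled Coxeter group of a path with `m` edges. -/
abbrev PathGroup (m : ℕ) : Type := RACG (PathAdj m)

/-- Generators of the group of a path, indexed by natural numbers. -/
noncomputable def pgen (m j : ℕ) : PathGroup m :=
  if h : j < m + 1 then gen (PathAdj m) ⟨j, h⟩ else 1

theorem pgen_mul_self (m j : ℕ) : pgen m j * pgen m j = 1 := by
  unfold pgen; split_ifs <;> simp [gen_mul_self]

theorem pgen_comm (m j : ℕ) : pgen m j * pgen m (j + 1) = pgen m (j + 1) * pgen m j := by
  unfold pgen
  split_ifs with h1 h2
  · exact gen_comm (Or.inl rfl)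
  all_goals simp

theorem pgen_coe {m : ℕ} (j : Fin (m + 1)) : pgen m j = gen (PathAdj m) j :=
  dif_pos j.is_lt

/-- The inclusion of the infinite dihedral group generated by the ends of a path. -/
noncomputable def dihToPath (m : ℕ) : Dih →* PathGroup m :=
  racgLift (fun e => pgen m (if e then 0 else m)) (fun _ => pgen_mul_self _ _) (by simp)

theorem dihToPath_gen (m : ℕ) (e : Bool) :
    dihToPath m (fgen e) = pgen m (if e then 0 else m) := racgLift_gen _ _ _ _

theorem dihToPath_injective {m : ℕ} (hm : 2 ≤ m) : Function.Injective (dihToPath m) := by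
  let ρ : PathGroup m →* Dih := racgLift (fun j => if (j : ℕ) = 0 then fgen true
      else if (j : ℕ) = m then fgen false else 1)
    (fun j => by split_ifs <;> simp [gen_mul_self])
    (fun i j h => by
      rcases h with h | h <;> split_ifs <;> first | omega | simp)
  refine Function.LeftInverse.injective (g := ρ) fun x => ?_
  have : ρ.comp (dihToPath m) = MonoidHom.id _ := racg_hom_ext fun e => by
    have hm' : m ≠ 0 := by omega
    cases e <;> simp [dihToPath_gen, pgen, ρ, hm']
  exact DFunLike.congr_fun this x

section Amalgam

variable {H A : Type} {κ : Type} [Group H] [Group A] (B : κ → Type) [∀ j, Group (B j)]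

/-- The factors `H × A` and `B j` of an amalgam over `H`. -/
def Fam (H A : Type) {κ : Type} (B : κ → Type) : Option κ → Type
  | none => H × A
  | some j => B j

instance famGroup : ∀ o, Group (Fam H A B o)
  | none => inferInstanceAs (Group (H × A))
  | some j => inferInstanceAs (Group (B j))

/-- The identification of the product factor. -/
def famProd : (H × A) ≃* Fam H A B none := MulEquiv.refl (H × A)

/-- The identification of the other factors. -/
def famSome (A : Type) [Group A] (H : Type) [Group H] (j : κ) : B j ≃* Fam H A B (some j) :=
  MulEquiv.refl (B j)

variable {B}

/-- The inclusions of `H` into the factors of the amalgam. -/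
def famHom (A : Type) [Group A] (β : ∀ j, H →* B j) : ∀ o, H →* Fam H A B o
  | none => (famProd B).toMonoidHom.comp (MonoidHom.inl H A)
  | some j => (famSome B A H j).toMonoidHom.comp (β j)

theorem famHom_injective {β : ∀ j, H →* B j} (hβ : ∀ j, Function.Injective (β j)) (o : Option κ) :
    Function.Injective (famHom A β o) := by
  cases o with
  | none => exact fun x y h => congrArg Prod.fst h
  | some j => exact hβ j

/-- The amalgam of `H × A` and the `B j` over `H`. -/
abbrev Amalg (A : Type) [Group A] (β : ∀ j, H →* B j) : Type := PushoutI (famHom A β)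

/-- The inclusion of the factor `A`. -/
def amA (β : ∀ j, H →* B j) : A →* Amalg A β :=
  (of (φ := famHom A β) none).comp ((famProd B).toMonoidHom.comp (MonoidHom.inr H A))

/-- The inclusion of the factor `B j`. -/
def amB (β : ∀ j, H →* B j) (j : κ) : B j →* Amalg A β :=
  (of (φ := famHom A β) (some j)).comp (famSome B A H j).toMonoidHom

/-- The inclusion of the base group. -/
def amH (β : ∀ j, H →* B j) : H →* Amalg A β := base (famHom A β)

theorem amB_apply (β : ∀ j, H →* B j) (j : κ) (x : H) : amB (A := A) β j (β j x) = amH β x :=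
  of_apply_eq_base (famHom A β) (some j) x

theorem of_none_eq (β : ∀ j, H →* B j) (x : H × A) :
    of (φ := famHom A β) none (famProd B x) = amH β x.1 * amA β x.2 := by
  have : amH (A := A) β x.1 = of (φ := famHom A β) none (famProd B (MonoidHom.inl H A x.1)) :=
    (of_apply_eq_base (famHom A β) none x.1).symm
  rw [this]
  change _ = _ * of (φ := famHom A β) none (famProd B (MonoidHom.inr H A x.2))
  rw [← map_mul, ← map_mul]
  simp

theorem amA_comm (β : ∀ j, H →* B j) (a : A) (x : H) : amA β a * amH β x = amH β x * amA β a := by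
  have : amH (A := A) β x = of (φ := famHom A β) none (famProd B (MonoidHom.inl H A x)) :=
    (of_apply_eq_base (famHom A β) none x).symm
  rw [← of_none_eq β (x, a), this]
  change of (φ := famHom A β) none (famProd B (MonoidHom.inr H A a)) * _ = _
  rw [← map_mul, ← map_mul]
  simp

/-- The homomorphisms from the factors used in the universal property of the amalgam. -/
def famLift {M : Type*} [Group M] (fH : H →* M) (fA : A →* M)
    (fB : ∀ j, B j →* M) (hA : ∀ x a, Commute (fH x) (fA a)) : ∀ o, Fam H A B o →* M
  | none => (MonoidHom.noncommCoprod fH fA hA).comp (famProd B).symm.toMonoidHom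
  | some j => (fB j).comp (famSome B A H j).symm.toMonoidHom

theorem famLift_comp {M : Type*} [Group M] (β : ∀ j, H →* B j) (fH : H →* M) (fA : A →* M)
    (fB : ∀ j, B j →* M) (hA : ∀ x a, Commute (fH x) (fA a)) (hB : ∀ j x, fB j (β j x) = fH x) :
    ∀ o, (famLift fH fA fB hA o).comp (famHom A β o) = fH
  | none => by ext x; simp [famLift, famHom]
  | some j => by ext x; simp [famLift, famHom, hB]

/-- The universal property of the amalgam. -/
def amLift {M : Type*} [Group M] (β : ∀ j, H →* B j) (fH : H →* M) (fA : A →* M)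
    (fB : ∀ j, B j →* M) (hA : ∀ x a, Commute (fH x) (fA a)) (hB : ∀ j x, fB j (β j x) = fH x) :
    Amalg A β →* M :=
  PushoutI.lift (famLift fH fA fB hA) fH (famLift_comp β fH fA fB hA hB)

section

variable {M : Type*} [Group M] (β : ∀ j, H →* B j) (fH : H →* M) (fA : A →* M)
    (fB : ∀ j, B j →* M) (hA : ∀ x a, Commute (fH x) (fA a)) (hB : ∀ j x, fB j (β j x) = fH x)

@[simp]
theorem amLift_amH (x : H) : amLift β fH fA fB hA hB (amH β x) = fH x := lift_base _ _ _ _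

@[simp]
theorem amLift_amA (x : A) : amLift β fH fA fB hA hB (amA β x) = fA x := by
  simp [amLift, amA, famLift]

@[simp]
theorem amLift_amB (j : κ) (x : B j) : amLift β fH fA fB hA hB (amB β j x) = fB j x := by
  simp [amLift, amB, famLift]

end

theorem amalg_induction (β : ∀ j, H →* B j) {p : Amalg A β → Prop} (hH : ∀ x, p (amH β x))
    (hA : ∀ x, p (amA β x)) (hB : ∀ j x, p (amB β j x)) (mul : ∀ x y, p x → p y → p (x * y))
    (x : Amalg A β) : p x := by
  induction x using PushoutI.induction_on with
  | of o g =>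
    cases o with
    | none =>
      obtain ⟨x, rfl⟩ := (famProd B).surjective g
      rw [of_none_eq]; exact mul _ _ (hH _) (hA _)
    | some j => exact hB j g
  | base h => exact hH h
  | mul x y hx hy => exact mul x y hx hy

theorem amalg_hom_ext {M : Type*} [Monoid M] (β : ∀ j, H →* B j) {f g : Amalg A β →* M}
    (hH : ∀ x, f (amH β x) = g (amH β x)) (hA : ∀ x, f (amA β x) = g (amA β x))
    (hB : ∀ j x, f (amB β j x) = g (amB β j x)) : f = g := by
  refine MonoidHom.ext fun x => ?_
  induction x using amalg_induction β with
  | hH x => exact hH x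
  | hA x => exact hA x
  | hB j x => exact hB j x
  | mul x y hx hy => rw [map_mul, map_mul, hx, hy]

end Amalgam

open Monoid Monoid.PushoutI

theorem Ctl.prod_id {H A A' : Type*} [Group H] [Group A] [Group A'] {f : A → A'} (hf : Ctl f) :
    Ctl (Prod.map (id : H → H) f) := by
  rintro ⟨x, a⟩
  refine ((Set.finite_singleton x).prod (hf a)).subset ?_
  rintro _ ⟨⟨y, b⟩, rfl⟩
  refine ⟨by simp, b, by simp⟩

/-- Bijections between the factors of two amalgams. -/
def famEquiv {H A A' κ : Type} {B B' : κ → Type} (FA : A ≃ A') (FB : ∀ j, B j ≃ B' j) :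
    ∀ o, Fam H A B o ≃ Fam H A' B' o
  | none => Equiv.prodCongr (Equiv.refl H) FA
  | some j => FB j

theorem coarseEquiv_amalg {H A A' κ : Type} {B B' : κ → Type} [Group H] [Group A] [Group A']
    [∀ j, Group (B j)] [∀ j, Group (B' j)] (β : ∀ j, H →* B j) (β' : ∀ j, H →* B' j)
    (hβ : ∀ j, Function.Injective (β j)) (hβ' : ∀ j, Function.Injective (β' j))
    (FA : A ≃ A') (hA1 : FA 1 = 1) (hAC : Ctl FA) (hAC' : Ctl FA.symm)
    (FB : ∀ j, B j ≃ B' j) (hB1 : ∀ j, FB j 1 = 1)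
    (hB : ∀ j x g, FB j (β j x * g) = β' j x * FB j g)
    (hBC : ∀ j, Ctl (FB j)) (hBC' : ∀ j, Ctl (FB j).symm) :
    CoarseEquiv (Amalg A β) (Amalg A' β') := by
  refine coarseEquiv_pushoutI (famHom_injective hβ) (famHom_injective hβ') (famEquiv FA FB)
    (fun o => ?_) (fun o => ?_) (fun o => ?_) (fun o => ?_)
  · cases o with
    | none => exact Prod.ext rfl hA1
    | some j => exact hB1 j
  · cases o with
    | none =>
      rintro h ⟨y, a⟩
      refine Prod.ext rfl ?_
      change FA (1 * a) = 1 * FA a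
      rw [one_mul, one_mul]
    | some j => exact hB j
  · cases o with
    | none => exact hAC.prod_id (H := H)
    | some j => exact hBC j
  · cases o with
    | none => exact hAC'.prod_id (H := H)
    | some j => exact hBC' j

section FiniteIndex

variable {H B δ κ : Type} [Group H] [Group B] (β : H →* B) {h : ℕ} (e : κ ≃ Fin h)

/-- The group with one factor `B` and linear part `Fr (Bool ⊕ δ)`. -/
abbrev SmallGroup (δ : Type) (β : H →* B) : Type :=
  Amalg (Fr (Bool ⊕ δ)) (κ := Unit) (B := fun _ => B) (fun _ => β)

/-- The group with `h` factors `B` and linear part `Fr (Bool ⊕ δ × Fin h)`. -/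
abbrev BigGroup (δ κ : Type) (h : ℕ) (β : H →* B) : Type :=
  Amalg (Fr (Bool ⊕ δ × Fin h)) (κ := κ) (B := fun _ => B) (fun _ => β)

/-- The linear generators of `BigGroup`. -/
def bigC (κ : Type) (x : Bool ⊕ δ × Fin h) : BigGroup δ κ h β := amA _ (fgen x)

/-- The linear generators of `SmallGroup`. -/
def smallC (x : Bool ⊕ δ) : SmallGroup δ β := amA _ (fgen x)

theorem bigC_mul_self (x : Bool ⊕ δ × Fin h) : bigC β κ x * bigC β κ x = 1 := by
  rw [bigC, ← map_mul, gen_mul_self, map_one]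

theorem smallC_mul_self (x : Bool ⊕ δ) : smallC β x * smallC β x = 1 := by
  rw [smallC, ← map_mul, gen_mul_self, map_one]

theorem bigC_mul_mul (x : Bool ⊕ δ × Fin h) (g : BigGroup δ κ h β) :
    bigC β κ x * (bigC β κ x * g) = g := by
  rw [← mul_assoc, bigC_mul_self, one_mul]

theorem smallC_mul_mul (x : Bool ⊕ δ) (g : SmallGroup δ β) :
    smallC β x * (smallC β x * g) = g := by
  rw [← mul_assoc, smallC_mul_self, one_mul]

/-- The displacement of a linear generator of `SmallGroup` acting on `BigGroup × Fin h`. -/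
noncomputable def moveC (κ : Type) (x : Bool ⊕ δ) (y : BigGroup δ κ h β × Fin h) :
    BigGroup δ κ h β × Fin h :=
  match x with
  | Sum.inl ε =>
    if Nat.bodd y.2 = ε then
      if ht : (y.2 : ℕ) + 1 < h then (y.1, ⟨y.2 + 1, ht⟩)
      else (bigC β κ (Sum.inl true) * y.1, y.2)
    else if ht : 1 ≤ (y.2 : ℕ) then (y.1, ⟨y.2 - 1, by omega⟩)
      else (bigC β κ (Sum.inl false) * y.1, y.2)
  | Sum.inr d => (bigC β κ (Sum.inr (d, y.2)) * y.1, y.2)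

theorem moveC_moveC (x : Bool ⊕ δ) (y : BigGroup δ κ h β × Fin h) :
    moveC β κ x (moveC β κ x y) = y := by
  obtain ⟨g, t, ht⟩ := y
  cases x with
  | inr d => simp [moveC, bigC_mul_mul]
  | inl ε =>
    by_cases h1 : Nat.bodd t = ε
    · subst h1
      by_cases h2 : t + 1 < h
      · simp [moveC, h2]
      · simp [moveC, h2, bigC_mul_mul]
    · by_cases h2 : 1 ≤ t
      · obtain ⟨t, rfl⟩ := Nat.exists_eq_add_of_le' h2
        have h3 : Nat.bodd t = ε := by
          rw [Nat.bodd_succ] at h1; cases ε <;> simpa using h1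
        subst h3
        simp [moveC, ht]
      · simp [moveC, h1, h2, bigC_mul_mul]

theorem moveC_fst (x : Bool ⊕ δ) (y : BigGroup δ κ h β × Fin h) :
    (moveC β κ x y).1 = y.1 ∨ ∃ z, (moveC β κ x y).1 = bigC β κ z * y.1 := by
  unfold moveC
  cases x with
  | inr d => exact Or.inr ⟨_, rfl⟩
  | inl ε =>
    dsimp only
    split_ifs
    exacts [Or.inl rfl, Or.inr ⟨_, rfl⟩, Or.inl rfl, Or.inr ⟨_, rfl⟩]

/-- Left multiplication on the group coordinate, depending on the second coordinate. -/
def shiftPerm {K T : Type*} [Group K] {M : Type*} [Group M] (f : T → M →* K) :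
    M →* Equiv.Perm (K × T) where
  toFun b :=
    { toFun := fun y => (f y.2 b * y.1, y.2)
      invFun := fun y => (f y.2 b⁻¹ * y.1, y.2)
      left_inv := fun y => by simp
      right_inv := fun y => by simp }
  map_one' := by ext y <;> simp
  map_mul' a b := by ext y <;> simp [mul_assoc]

theorem moveC_shift (x : Bool ⊕ δ) (u : H) (y : BigGroup δ κ h β × Fin h) :
    moveC β κ x (amH _ u * y.1, y.2) = (amH _ u * (moveC β κ x y).1, (moveC β κ x y).2) := by
  have key : ∀ z, bigC β κ z * (amH (fun _ => β) u * y.1) = amH (fun _ => β) u * (bigC β κ z * y.1) :=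
    fun z => by rw [← mul_assoc, bigC, amA_comm, mul_assoc]
  unfold moveC
  cases x with
  | inr d => simp [key]
  | inl ε =>
    dsimp only
    split_ifs <;> simp [key]

/-- The linear part of `SmallGroup` acting on `BigGroup × Fin h`. -/
noncomputable def linearAct (κ : Type) :
    Fr (Bool ⊕ δ) →* Equiv.Perm (BigGroup δ κ h β × Fin h) :=
  racgLift (fun x => ⟨moveC β κ x, moveC β κ x, moveC_moveC β x, moveC_moveC β x⟩)
    (fun x => Equiv.ext fun y => moveC_moveC β x y) (by simp)

theorem linearAct_fgen (x : Bool ⊕ δ) (y : BigGroup δ κ h β × Fin h) :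
    linearAct β κ (fgen x) y = moveC β κ x y := by
  rw [linearAct, racgLift_gen]; rfl

/-- The action of `SmallGroup` on `BigGroup × Fin h`. -/
noncomputable def smallAct : SmallGroup δ β →* Equiv.Perm (BigGroup δ κ h β × Fin h) :=
  amLift _ (shiftPerm fun _ => amH _) (linearAct β κ)
    (fun _ => shiftPerm fun t => amB (fun _ => β) (e.symm t))
    (fun u a => by
      induction a using racg_induction with
      | one => simp
      | mul x a ih =>
        rw [map_mul]
        refine Commute.mul_right (Equiv.ext fun y => ?_) ih
        simp only [Equiv.Perm.mul_apply, linearAct_fgen]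
        exact (moveC_shift β x u y).symm)
    (fun _ u => Equiv.ext fun y => by
      simp only [shiftPerm, MonoidHom.coe_mk, OneHom.coe_mk, Equiv.coe_fn_mk]
      rw [amB_apply (A := Fr (Bool ⊕ δ × Fin h)) (fun _ => β)])

theorem smallAct_amH (u : H) (y : BigGroup δ κ h β × Fin h) :
    smallAct β e (amH _ u) y = (amH _ u * y.1, y.2) := by
  rw [smallAct, amLift_amH]; rfl

theorem smallAct_amB (b : B) (y : BigGroup δ κ h β × Fin h) :
    smallAct β e (amB _ () b) y = (amB (fun _ => β) (e.symm y.2) b * y.1, y.2) := by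
  rw [smallAct, amLift_amB]; rfl

theorem smallAct_smallC (x : Bool ⊕ δ) (y : BigGroup δ κ h β × Fin h) :
    smallAct β e (smallC β x) y = moveC β κ x y := by
  rw [smallAct, smallC, amLift_amA, linearAct_fgen]

/-- The alternating word moving level `0` to level `t`. -/
def theta (δ : Type) (β : H →* B) : ℕ → SmallGroup δ β
  | 0 => 1
  | t + 1 => smallC β (Sum.inl (Nat.bodd t)) * theta δ β t

theorem theta_comm (t : ℕ) (u : H) : theta δ β t * amH _ u = amH _ u * theta δ β t := by
  induction t with
  | zero => simp [theta]
  | succ t ih => rw [theta, mul_assoc, ih, ← mul_assoc, smallC, amA_comm, mul_assoc]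

theorem smallAct_theta (t : ℕ) (ht : t < h) (g : BigGroup δ κ h β) :
    smallAct β e (theta δ β t) (g, ⟨0, by omega⟩) = (g, ⟨t, ht⟩) := by
  induction t with
  | zero => simp [theta]
  | succ t ih =>
    rw [theta, map_mul, Equiv.Perm.mul_apply, ih (by omega), smallAct_smallC]
    simp [moveC, ht]

/-- The linear generators of `BigGroup` as elements of `SmallGroup`. -/
def bigCImage (δ : Type) (h : ℕ) (β : H →* B) : Bool ⊕ δ × Fin h → SmallGroup δ β
  | Sum.inl true => (theta δ β (h - 1))⁻¹ * smallC β (Sum.inl (Nat.bodd (h - 1))) * theta δ β (h - 1)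
  | Sum.inl false => smallC β (Sum.inl true)
  | Sum.inr (d, t) => (theta δ β t)⁻¹ * smallC β (Sum.inr d) * theta δ β t

theorem bigCImage_mul_self (x : Bool ⊕ δ × Fin h) :
    bigCImage δ h β x * bigCImage δ h β x = 1 := by
  have key : ∀ (t : SmallGroup δ β) x, t⁻¹ * smallC β x * t * (t⁻¹ * smallC β x * t) = 1 :=
    fun t x => by simp [mul_assoc, smallC_mul_mul]
  rcases x with (_ | _) | ⟨d, t⟩
  exacts [smallC_mul_self _ _, key _ _, key _ _]

theorem commute_theta (t : ℕ) (u : H) : Commute (amH _ u) (theta δ β t) := (theta_comm β t u).symm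

theorem bigCImage_comm (u : H) (x : Bool ⊕ δ × Fin h) :
    Commute (amH (fun _ => β) u) (bigCImage δ h β x) := by
  have h1 : ∀ x : Bool ⊕ δ, Commute (amH (fun _ => β) u) (smallC β x) := fun x => (amA_comm _ _ u).symm
  have h2 := fun t => commute_theta (δ := δ) β t u
  rcases x with (_ | _) | ⟨d, t⟩
  · exact h1 _
  · exact ((h2 _).inv_right.mul_right (h1 _)).mul_right (h2 _)
  · exact ((h2 _).inv_right.mul_right (h1 _)).mul_right (h2 _)

/-- The homomorphism from `BigGroup` onto a finite-index subgroup of `SmallGroup`. -/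
noncomputable def bigToSmall : BigGroup δ κ h β →* SmallGroup δ β :=
  amLift _ (amH _) (racgLift (bigCImage δ h β) (bigCImage_mul_self β) (by simp))
    (fun j => (MulAut.conj (theta δ β (e j))⁻¹).toMonoidHom.comp (amB (fun _ => β) ()))
    (fun u a => by
      induction a using racg_induction with
      | one => simp
      | mul x a ih =>
        rw [map_mul, racgLift_gen]
        exact (bigCImage_comm β u x).mul_right ih)
    (fun j u => by
      simp only [MonoidHom.comp_apply, MulEquiv.coe_toMonoidHom, MulAut.conj_apply, inv_inv]
      rw [amB_apply (A := Fr (Bool ⊕ δ)) (κ := Unit) (fun _ => β) (), mul_assoc, ← theta_comm]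
      simp)

theorem bigToSmall_amH (u : H) :
    bigToSmall (δ := δ) β e (amH _ u) = amH _ u := amLift_amH _ _ _ _ _ _ _

theorem bigToSmall_amB (j : κ) (b : B) :
    bigToSmall (δ := δ) β e (amB (fun _ => β) j b) =
      (theta δ β (e j))⁻¹ * amB _ () b * theta δ β (e j) := by
  rw [bigToSmall, amLift_amB]
  simp

theorem bigToSmall_bigC (x : Bool ⊕ δ × Fin h) :
    bigToSmall β e (bigC β κ x) = bigCImage δ h β x := by
  rw [bigToSmall, bigC, amLift_amA, racgLift_gen]

/-- The inverse of the orbit map of `SmallGroup` on `BigGroup × Fin h`. -/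
noncomputable def evalBig (y : BigGroup δ κ h β × Fin h) : SmallGroup δ β :=
  theta δ β y.2 * bigToSmall β e y.1

theorem evalBig_moveC (x : Bool ⊕ δ) (y : BigGroup δ κ h β × Fin h) :
    evalBig β e (moveC β κ x y) = smallC β x * evalBig β e y := by
  obtain ⟨g, t, ht⟩ := y
  cases x with
  | inr d => simp [moveC, evalBig, bigToSmall_bigC, bigCImage, mul_assoc]
  | inl ε =>
    by_cases h1 : Nat.bodd t = ε
    · subst h1
      by_cases h2 : t + 1 < h
      · simp [moveC, h2, evalBig, theta, mul_assoc]
      · obtain rfl : t = h - 1 := by omega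
        have h3 : ¬ (h - 1 + 1 < h) := by omega
        simp [moveC, evalBig, bigToSmall_bigC, bigCImage, h3, mul_assoc]
    · by_cases h2 : 1 ≤ t
      · obtain ⟨t, rfl⟩ := Nat.exists_eq_add_of_le' h2
        have h3 : Nat.bodd t = ε := by
          rw [Nat.bodd_succ] at h1; cases ε <;> simpa using h1
        subst h3
        simp [moveC, evalBig, theta, mul_assoc, smallC_mul_mul]
      · obtain rfl : t = 0 := by omega
        obtain rfl : ε = true := by cases ε <;> simp_all
        simp [moveC, evalBig, bigToSmall_bigC, bigCImage, theta]

theorem evalBig_smallAct (x : SmallGroup δ β) (y : BigGroup δ κ h β × Fin h) :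
    evalBig β e (smallAct β e x y) = x * evalBig β e y := by
  induction x using amalg_induction (fun _ => β) generalizing y with
  | hH u =>
    rw [smallAct_amH, evalBig, evalBig, map_mul, bigToSmall_amH, ← mul_assoc, theta_comm, mul_assoc]
  | hA a =>
    induction a using racg_induction generalizing y with
    | one => simp
    | mul v a ih =>
      rw [map_mul, map_mul, Equiv.Perm.mul_apply]
      change evalBig β e (smallAct β e (smallC β v) _) = smallC β v * _ * _
      rw [smallAct_smallC, evalBig_moveC, ih, mul_assoc]
  | hB j b =>
    rw [smallAct_amB, evalBig, evalBig, map_mul, bigToSmall_amB]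
    simp [mul_assoc]
  | mul x x' h1 h2 => rw [map_mul, Equiv.Perm.mul_apply, h1, h2, mul_assoc]

theorem smallAct_bigToSmall (hh : 1 ≤ h) (x g : BigGroup δ κ h β) :
    smallAct β e (bigToSmall β e x) (g, ⟨0, hh⟩) = (x * g, ⟨0, hh⟩) := by
  have hinv : ∀ t (ht : t < h) g, (smallAct β e (theta δ β t))⁻¹ (g, ⟨t, ht⟩) =
      ((g, ⟨0, hh⟩) : BigGroup δ κ h β × Fin h) := fun t ht g => by
    rw [Equiv.Perm.inv_eq_iff_eq, smallAct_theta]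
  induction x using amalg_induction (fun _ => β) generalizing g with
  | hH u => rw [bigToSmall_amH, smallAct_amH]
  | hA a =>
    induction a using racg_induction generalizing g with
    | one => simp
    | mul v a ih =>
      rw [map_mul, map_mul, map_mul, Equiv.Perm.mul_apply, ih, mul_assoc]
      change smallAct β e (bigToSmall β e (bigC β κ v)) _ = (bigC β κ v * _, _)
      generalize amA (fun _ => β) a * g = g
      rw [bigToSmall_bigC]
      rcases v with (_ | _) | ⟨d, t⟩
      · rw [bigCImage, smallAct_smallC]
        simp [moveC]
      · simp only [bigCImage, map_mul, map_inv, Equiv.Perm.mul_apply]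
        rw [smallAct_theta β e (h - 1) (by omega), smallAct_smallC]
        have h3 : ¬ (h - 1 + 1 < h) := by omega
        simp only [moveC, h3, if_true, dif_neg, not_false_eq_true]
        exact hinv _ _ _
      · simp only [bigCImage, map_mul, map_inv, Equiv.Perm.mul_apply]
        rw [smallAct_theta β e t t.2, smallAct_smallC]
        exact hinv _ _ _
  | hB j b =>
    rw [bigToSmall_amB]
    simp only [map_mul, map_inv, Equiv.Perm.mul_apply]
    rw [smallAct_theta β e (e j) (e j).2, smallAct_amB, hinv]
    simp
  | mul x x' h1 h2 => rw [map_mul, map_mul, Equiv.Perm.mul_apply, h2, h1, mul_assoc]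

theorem coarseEquiv_small_big [Finite δ] (e : κ ≃ Fin h) (hh : 1 ≤ h) :
    CoarseEquiv (SmallGroup δ β) (BigGroup δ κ h β) := by
  have hcoc : ∀ a : SmallGroup δ β, (Set.range fun y : BigGroup δ κ h β × Fin h =>
      (smallAct β e a y).1 * y.1⁻¹).Finite := by
    intro a
    induction a using amalg_induction (fun _ => β) with
    | hH u =>
      refine (Set.finite_singleton (amH (fun _ => β) u)).subset ?_
      rintro _ ⟨y, rfl⟩
      simp [smallAct_amH]
    | hA a =>
      induction a using racg_induction with
      | one =>
        refine (Set.finite_singleton 1).subset ?_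
        rintro _ ⟨y, rfl⟩
        simp
      | mul v a ih =>
        refine (Set.Finite.image2 (· * ·) ((Set.finite_singleton 1).union
          (Set.finite_range (bigC (δ := δ) (h := h) β κ))) ih).subset ?_
        rintro _ ⟨y, rfl⟩
        simp only [map_mul, Equiv.Perm.mul_apply]
        rw [show amA (fun _ : Unit => β) (gen (fun _ _ : Bool ⊕ δ => False) v) = smallC β v from rfl,
          smallAct_smallC]
        generalize hy' : smallAct β e (amA (fun _ => β) a) y = y'
        rcases moveC_fst β v y' with h1 | ⟨z, h1⟩
        · exact ⟨1, Or.inl rfl, _, ⟨y, rfl⟩, by simp [h1, hy']⟩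
        · exact ⟨_, Or.inr ⟨z, rfl⟩, _, ⟨y, rfl⟩, by simp [h1, hy', mul_assoc]⟩
    | hB j b =>
      refine (Set.finite_range fun t : Fin h => amB (fun _ => β) (e.symm t) b).subset ?_
      rintro _ ⟨y, rfl⟩
      exact ⟨y.2, by cases j; simp only [smallAct_amB, mul_inv_cancel_right]⟩
    | mul x x' h1 h2 =>
      refine (Set.Finite.image2 (· * ·) h1 h2).subset ?_
      rintro _ ⟨y, rfl⟩
      exact ⟨_, ⟨smallAct β e x' y, rfl⟩, _, ⟨y, rfl⟩, by simp⟩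
  refine ⟨fun x => (smallAct β e x (1, ⟨0, hh⟩)).1, bigToSmall β e, fun a => ?_, ctl_of_hom _, ?_,
    close_of_eq fun x => ?_⟩
  · refine (hcoc a).subset ?_
    rintro _ ⟨x, rfl⟩
    exact ⟨smallAct β e x (1, ⟨0, hh⟩), by simp⟩
  · refine (Set.finite_range fun t : Fin h => (theta δ β t)⁻¹).subset ?_
    rintro _ ⟨x, rfl⟩
    have := evalBig_smallAct β e x (1, ⟨0, hh⟩)
    refine ⟨(smallAct β e x (1, ⟨0, hh⟩)).2, ?_⟩
    simp only [evalBig, map_one, theta, mul_one] at this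
    simp only [Function.comp_apply]
    rw [eq_mul_inv_iff_mul_eq, inv_mul_eq_iff_eq_mul, this]
  · simp only [Function.comp_apply]
    rw [smallAct_bigToSmall β e hh, mul_one]

end FiniteIndex

section ThetaDecomposition

variable {k : ℕ} (n : Fin k → ℕ)

/-- The inclusions of the infinite dihedral group in the groups of the hyperbolic paths. -/
noncomputable abbrev hypIncl (j : {i : Fin k // n i ≠ 1}) : Dih →* PathGroup (n j + 1) :=
  dihToPath (n j + 1)

/-- The splitting of `ThetaRACG n` over the dihedral group of its essential vertices. -/
abbrev ThetaAmalg : Type := Amalg (Fr {i : Fin k // n i = 1}) (hypIncl n)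

/-- Images of the generators in the splitting. -/
noncomputable def thetaToAmalgGen : ThetaVertex n → ThetaAmalg n
  | Sum.inl e => amH _ (fgen e)
  | Sum.inr ⟨i, j⟩ =>
    if h : n i = 1 then amA _ (fgen ⟨i, h⟩) else amB (hypIncl n) ⟨i, h⟩ (pgen _ (j + 1))

theorem thetaToAmalgGen_mul_self (v : ThetaVertex n) :
    thetaToAmalgGen n v * thetaToAmalgGen n v = 1 := by
  rcases v with e | ⟨i, j⟩
  · simp only [thetaToAmalgGen]
    rw [← map_mul, gen_mul_self, map_one]
  · simp only [thetaToAmalgGen]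
    split_ifs
    · rw [← map_mul, gen_mul_self, map_one]
    · rw [← map_mul, pgen_mul_self, map_one]

theorem amH_fgen_eq (j : {i : Fin k // n i ≠ 1}) (e : Bool) :
    amH (A := Fr {i : Fin k // n i = 1}) (hypIncl n) (fgen e) =
      amB (hypIncl n) j (pgen _ (if e then 0 else n j + 1)) := by
  rw [← amB_apply _ j, hypIncl, dihToPath_gen]

theorem thetaToAmalgGen_inl_inr (e : Bool) (i : Fin k) (j : Fin (n i))
    (h : ThetaAdj n (Sum.inl e) (Sum.inr ⟨i, j⟩)) :
    Commute (thetaToAmalgGen n (Sum.inl e)) (thetaToAmalgGen n (Sum.inr ⟨i, j⟩)) := by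
  simp only [thetaToAmalgGen]
  split_ifs with h1
  · exact (amA_comm _ _ _).symm
  · rw [amH_fgen_eq n ⟨i, h1⟩]
    refine Commute.map ?_ _
    have := j.is_lt
    rcases h with ⟨rfl, h⟩ | ⟨rfl, h⟩
    · rw [h]; exact pgen_comm _ _
    · rw [h, Nat.sub_add_cancel (by omega)]
      exact (pgen_comm _ _).symm

theorem thetaToAmalgGen_comm (u v : ThetaVertex n) (h : ThetaAdj n u v) :
    thetaToAmalgGen n u * thetaToAmalgGen n v = thetaToAmalgGen n v * thetaToAmalgGen n u := by
  rcases u with e | ⟨i, j⟩ <;> rcases v with e' | ⟨i', j'⟩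
  · exact h.elim
  · exact thetaToAmalgGen_inl_inr n e i' j' h
  · exact (thetaToAmalgGen_inl_inr n e' i j h).symm
  · obtain ⟨hi, hj⟩ := h
    obtain rfl := Fin.ext hi
    have h1 : n i ≠ 1 := by have := j.is_lt; have := j'.is_lt; omega
    simp only [thetaToAmalgGen, dif_neg h1]
    rw [← map_mul, ← map_mul]
    congr 1
    rcases hj with hj | hj
    · rw [hj]; exact pgen_comm _ _
    · rw [hj]; exact (pgen_comm _ _).symm

/-- The homomorphism from `ThetaRACG n` to its splitting. -/
noncomputable def thetaToAmalg : ThetaRACG n →* ThetaAmalg n :=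
  racgLift (thetaToAmalgGen n) (thetaToAmalgGen_mul_self n) (thetaToAmalgGen_comm n)

/-- The generators of the group of the `i`-th path in `ThetaRACG n`. -/
noncomputable def pathVertex (i : Fin k) (j : ℕ) : ThetaRACG n :=
  if j = 0 then gen _ (Sum.inl true)
  else if h : j - 1 < n i then gen _ (Sum.inr ⟨i, j - 1, h⟩) else gen _ (Sum.inl false)

theorem pathVertex_comm (hn : ∀ i, 1 ≤ n i) (i : Fin k) (j : ℕ) (hj : j ≤ n i) :
    pathVertex n i j * pathVertex n i (j + 1) = pathVertex n i (j + 1) * pathVertex n i j := by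
  have := hn i
  rcases Nat.eq_zero_or_pos j with rfl | h0
  · simp only [pathVertex, if_true, zero_add, one_ne_zero, if_false, Nat.sub_self]
    rw [dif_pos (by omega)]
    exact gen_comm (Or.inl ⟨rfl, rfl⟩)
  · have h1 : j ≠ 0 := by omega
    have h2 : j - 1 < n i := by omega
    simp only [pathVertex, h1, if_false, Nat.succ_ne_zero, dif_pos h2, Nat.add_sub_cancel]
    split_ifs with h3
    · refine gen_comm ⟨rfl, Or.inl ?_⟩
      simp only; omega
    · refine gen_comm (Or.inr ⟨rfl, ?_⟩)
      simp only; omega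

/-- The homomorphism from the group of a path. -/
noncomputable def pathToTheta (hn : ∀ i, 1 ≤ n i) (i : Fin k) : PathGroup (n i + 1) →* ThetaRACG n :=
  racgLift (fun j => pathVertex n i j)
    (fun j => by unfold pathVertex; split_ifs <;> exact gen_mul_self _)
    (fun j j' h => by
      rcases h with h | h
      · rw [← h]; exact pathVertex_comm n hn i j (by omega)
      · rw [← h]; exact (pathVertex_comm n hn i j' (by omega)).symm)

theorem pathToTheta_pgen (hn : ∀ i, 1 ≤ n i) (i : Fin k) (j : ℕ) (hj : j ≤ n i + 1) :
    pathToTheta n hn i (pgen _ j) = pathVertex n i j := by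
  rw [pgen, dif_pos (by omega), pathToTheta, racgLift_gen]

/-- The homomorphism from the splitting back to `ThetaRACG n`. -/
noncomputable def amalgToTheta (hn : ∀ i, 1 ≤ n i) : ThetaAmalg n →* ThetaRACG n :=
  amLift _ (racgLift (fun e => gen _ (Sum.inl e)) (fun _ => gen_mul_self _) (by simp))
    (racgLift (fun i => gen _ (Sum.inr ⟨i, 0, by have := i.2; omega⟩)) (fun _ => gen_mul_self _) (by simp))
    (fun j => pathToTheta n hn j)
    (fun x a => by
      induction x using racg_induction with
      | one => simp
      | mul e x ihx =>
        rw [map_mul, racgLift_gen]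
        refine Commute.mul_left ?_ ihx
        clear ihx
        induction a using racg_induction with
        | one => simp
        | mul i a iha =>
          rw [map_mul, racgLift_gen]
          refine Commute.mul_right (gen_comm ?_) iha
          have := i.2
          cases e
          · exact Or.inr ⟨rfl, by simp [this]⟩
          · exact Or.inl ⟨rfl, rfl⟩)
    (fun j x => by
      refine DFunLike.congr_fun (racg_hom_ext (f := (pathToTheta n hn j).comp (dihToPath _)) fun e => ?_) x
      rw [racgLift_gen, MonoidHom.comp_apply, dihToPath_gen, pathToTheta_pgen _ _ _ _ (by split_ifs <;> omega)]
      cases e <;> simp [pathVertex])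

/-- `ThetaRACG n` splits over the dihedral group of its essential vertices. -/
noncomputable def thetaEquivAmalg (hn : ∀ i, 1 ≤ n i) : ThetaRACG n ≃* ThetaAmalg n :=
  MonoidHom.toMulEquiv (thetaToAmalg n) (amalgToTheta n hn)
    (racg_hom_ext fun v => by
      rw [MonoidHom.comp_apply, thetaToAmalg, racgLift_gen, amalgToTheta, MonoidHom.id_apply]
      rcases v with e | ⟨i, j⟩
      · simp [thetaToAmalgGen]
      · simp only [thetaToAmalgGen]
        split_ifs with h
        · rw [amLift_amA, racgLift_gen]
          have := j.is_lt
          have h2 : j = ⟨0, by omega⟩ := Fin.ext (by simp; omega)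
          rw [h2]
        · rw [amLift_amB, pathToTheta_pgen _ _ _ _ (by have := j.is_lt; simp only; omega)]
          simp [pathVertex])
    (amalg_hom_ext _
      (fun x => by
        refine DFunLike.congr_fun (racg_hom_ext
          (f := ((thetaToAmalg n).comp (amalgToTheta n hn)).comp (amH _)) (g := amH _) fun e => ?_) x
        rw [MonoidHom.comp_apply, MonoidHom.comp_apply, amalgToTheta, amLift_amH, racgLift_gen,
          thetaToAmalg, racgLift_gen, thetaToAmalgGen])
      (fun x => by
        refine DFunLike.congr_fun (racg_hom_ext
          (f := ((thetaToAmalg n).comp (amalgToTheta n hn)).comp (amA _)) (g := amA _) fun i => ?_) x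
        rw [MonoidHom.comp_apply, MonoidHom.comp_apply, amalgToTheta, amLift_amA, racgLift_gen,
          thetaToAmalg, racgLift_gen, thetaToAmalgGen, dif_pos i.2])
      (fun j x => by
        refine DFunLike.congr_fun (racg_hom_ext
          (f := ((thetaToAmalg n).comp (amalgToTheta n hn)).comp (amB (hypIncl n) j))
          (g := amB (hypIncl n) j)
            fun i => ?_) x
        have hi := i.is_lt
        rw [MonoidHom.comp_apply, MonoidHom.comp_apply, amalgToTheta, amLift_amB, ← pgen_coe,
          pathToTheta_pgen _ _ _ _ (by omega), thetaToAmalg, pathVertex]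
        split_ifs with h1 h2
        · rw [racgLift_gen, thetaToAmalgGen, amH_fgen_eq n j, h1]; rfl
        · rw [racgLift_gen, thetaToAmalgGen, dif_neg j.2]
          simp only
          rw [Nat.sub_add_cancel (by omega)]
        · rw [racgLift_gen, thetaToAmalgGen, amH_fgen_eq n j]
          have : (i : ℕ) = n j + 1 := by omega
          rw [this]; rfl))

end ThetaDecomposition

/-- Edges of the planar trivalent tree, oriented away from an end: the edges `root t` form a line
coming from the end, and `node t u` lies on the branch leaving the line after `root t`. -/
inductive Edge : Type
  | root (t : ℤ)
  | node (t : ℤ) (u : List Bool)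

namespace Edge

/-- The left successor of an edge. -/
def L : Edge → Edge
  | root t => root (t + 1)
  | node t u => node t (false :: u)

/-- The right successor of an edge. -/
def R : Edge → Edge
  | root t => node t []
  | node t u => node t (true :: u)

theorem induction {P : Edge → Prop} (root : ∀ t, P (root t)) (left : ∀ e, P e → P e.L)
    (right : ∀ e, P e → P e.R) : ∀ e, P e
  | .root t => root t
  | .node t u => by
    induction u with
    | nil => exact right _ (root t)
    | cons b u ih => cases b; exacts [left _ ih, right _ ih]

theorem exists_eq (e : Edge) : ∃ e', e = L e' ∨ e = R e' := by
  rcases e with t | ⟨t, _ | ⟨_ | _, u⟩⟩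
  exacts [⟨root (t - 1), Or.inl (by simp [L])⟩, ⟨root t, Or.inr rfl⟩, ⟨node t u, Or.inl rfl⟩,
    ⟨node t u, Or.inr rfl⟩]

theorem iterate_L_root (j : ℕ) (t : ℤ) : L^[j] (root t) = root (t + j) := by
  induction j with
  | zero => simp
  | succ j ih => rw [Function.iterate_succ_apply', ih, L]; push_cast; ring_nf

end Edge

open Edge

/-- Directed edges of the tree; the flag is `true` for the orientation away from the end. -/
abbrev DEdge : Type := Edge × Bool

/-- The successor of a directed edge on the boundary walk of the tree. -/
def nextEdge : DEdge → DEdge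
  | (e, true) => (e.L, true)
  | (root t, false) => (node (t - 1) [], true)
  | (node t [], false) => (root t, false)
  | (node t (false :: u), false) => (node t (true :: u), true)
  | (node t (true :: u), false) => (node t u, false)

/-- The predecessor of a directed edge on the boundary walk of the tree. -/
def prevEdge : DEdge → DEdge
  | (e, false) => (e.R, false)
  | (root t, true) => (root (t - 1), true)
  | (node t [], true) => (root (t + 1), false)
  | (node t (false :: u), true) => (node t u, true)
  | (node t (true :: u), true) => (node t (false :: u), false)

/-- The boundary walk of the tree. -/
def walk : Equiv.Perm DEdge where
  toFun := nextEdge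
  invFun := prevEdge
  left_inv := by
    rintro ⟨t | ⟨t, _ | ⟨_ | _, u⟩⟩, _ | _⟩ <;> simp [nextEdge, prevEdge, L, R]
  right_inv := by
    rintro ⟨t | ⟨t, _ | ⟨_ | _, u⟩⟩, _ | _⟩ <;> simp [nextEdge, prevEdge, L, R]

/-- Reversal of directed edges. -/
def flipEdge : Equiv.Perm DEdge where
  toFun z := (z.1, !z.2)
  invFun z := (z.1, !z.2)
  left_inv z := by simp
  right_inv z := by simp

@[simp] theorem flipEdge_apply (e : Edge) (b : Bool) : flipEdge (e, b) = (e, !b) := rfl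

@[simp] theorem flipEdge_flipEdge (z : DEdge) : flipEdge (flipEdge z) = z := by simp [flipEdge]

theorem walk_out (e : Edge) : walk (e, true) = (e.L, true) := rfl

theorem walk_left_in (e : Edge) : walk (e.L, false) = (e.R, true) := by
  cases e <;> simp [walk, L, R, nextEdge]

theorem walk_right_in (e : Edge) : walk (e.R, false) = (e, false) := by
  cases e <;> simp [walk, R, nextEdge]

theorem walk_pow_out (j : ℕ) (e : Edge) : (walk ^ j) (e, true) = (L^[j] e, true) := by
  induction j with
  | zero => rfl
  | succ j ih => rw [pow_succ', Equiv.Perm.mul_apply, ih, Function.iterate_succ_apply', walk_out]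

theorem walk_pow_in (j : ℕ) (e : Edge) : (walk ^ j) (R^[j] e, false) = (e, false) := by
  induction j generalizing e with
  | zero => rfl
  | succ j ih =>
    rw [pow_succ', Equiv.Perm.mul_apply, Function.iterate_succ_apply, ih, walk_right_in]

theorem right_out_eq (e : Edge) : ((e.R, true) : DEdge) = (walk * flipEdge * walk) (e, true) := by
  simp [walk_out, walk_left_in]

theorem dEdge_induction {P : DEdge → Prop} (base : P (root 0, true)) (hw : ∀ z, P z → P (walk z))
    (hw' : ∀ z, P z → P (walk⁻¹ z)) (hf : ∀ z, P z → P (flipEdge z)) (z : DEdge) : P z := by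
  suffices h : ∀ e, P (e, true) by
    obtain ⟨e, _ | _⟩ := z
    · exact hf _ (h e)
    · exact h e
  intro e
  induction e using Edge.induction with
  | root t =>
    induction t with
    | zero => exact base
    | succ t ih => exact hw _ ih
    | pred t ih => exact hw' _ ih
  | left e ih => exact hw _ ih
  | right e ih =>
    rw [right_out_eq]
    exact hw _ (hf _ (hw _ ih))

section Lines

/-- The line of the boundary walk containing a directed edge, with the position on it. Lines are
indexed by the edges `e`, for the line through `(e.R, true)`, together with the line of the
roots. -/
def linePos : DEdge → Option Edge × ℤ
  | (root t, true) => (none, t)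
  | (node t [], true) => (some (root t), 0)
  | (node t (true :: u), true) => (some (node t u), 0)
  | (node t (false :: u), true) => ((linePos (node t u, true)).1, (linePos (node t u, true)).2 + 1)
  | (root t, false) => (some (root (t - 1)), -1)
  | (node t [], false) => (some (root (t - 1)), -2)
  | (node t (true :: u), false) => ((linePos (node t u, false)).1, (linePos (node t u, false)).2 - 1)
  | (node t (false :: u), false) => (some (node t u), -1)
termination_by z => match z.1 with | root _ => 0 | node _ u => u.length + 1

/-- The base point of a line. -/
def lineBase : Option Edge → DEdge
  | none => (root 0, true)
  | some e => (e.R, true)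

theorem linePos_lineBase (o : Option Edge) : linePos (lineBase o) = (o, 0) := by
  rcases o with _ | ⟨t | ⟨t, u⟩⟩ <;> simp [lineBase, R, linePos]

theorem linePos_walk (z : DEdge) : linePos (walk z) = ((linePos z).1, (linePos z).2 + 1) := by
  change linePos (nextEdge z) = _
  rcases z with ⟨t | ⟨t, _ | ⟨_ | _, u⟩⟩, _ | _⟩ <;> simp [nextEdge, L, linePos]

theorem linePos_zpow (j : ℤ) (z : DEdge) :
    linePos ((walk ^ j) z) = ((linePos z).1, (linePos z).2 + j) := by
  induction j with
  | zero => simp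
  | succ j ih =>
    rw [add_comm, zpow_add, zpow_one, Equiv.Perm.mul_apply, linePos_walk, ih]
    refine Prod.ext rfl ?_
    simp only; ring
  | pred j ih =>
    have := linePos_walk ((walk ^ (-(j : ℤ) - 1)) z)
    rw [← Equiv.Perm.mul_apply, ← zpow_one_add, show 1 + (-(j : ℤ) - 1) = -j by ring, ih] at this
    refine Prod.ext (congrArg Prod.fst this).symm ?_
    have h2 := congrArg Prod.snd this
    simp only at h2 ⊢; linarith

theorem eq_lineBase (z : DEdge) : z = (walk ^ (linePos z).2) (lineBase (linePos z).1) := by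
  suffices h : ∃ (j : ℤ) (o : Option Edge), z = (walk ^ j) (lineBase o) by
    obtain ⟨j, o, rfl⟩ := h
    rw [linePos_zpow, linePos_lineBase]; simp
  have hw : ∀ z, (∃ (j : ℤ) (o : Option Edge), z = (walk ^ j) (lineBase o)) →
      ∃ (j : ℤ) (o : Option Edge), walk z = (walk ^ j) (lineBase o) := by
    rintro _ ⟨j, o, rfl⟩
    exact ⟨1 + j, o, by rw [zpow_one_add, Equiv.Perm.mul_apply]⟩
  have hw' : ∀ z, (∃ (j : ℤ) (o : Option Edge), walk z = (walk ^ j) (lineBase o)) →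
      ∃ (j : ℤ) (o : Option Edge), z = (walk ^ j) (lineBase o) := by
    rintro z ⟨j, o, h⟩
    refine ⟨j - 1, o, walk.injective ?_⟩
    rw [h, ← Equiv.Perm.mul_apply, ← zpow_one_add]; simp
  obtain ⟨e, b⟩ := z
  induction e using Edge.induction generalizing b with
  | root t =>
    cases b
    · refine hw' _ ⟨0, some (root (t - 1)), ?_⟩
      simp [walk, nextEdge, lineBase, R]
    · refine ⟨t, none, ?_⟩
      have : ∀ t : ℤ, (walk ^ t) (root 0, true) = (root t, true) := fun t => by
        induction t with
        | zero => rfl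
        | succ j ih => rw [add_comm, zpow_one_add, Equiv.Perm.mul_apply, ih, walk_out, L, add_comm]
        | pred j ih =>
          refine walk.injective ?_
          rw [← Equiv.Perm.mul_apply, ← zpow_one_add, show 1 + (-(j : ℤ) - 1) = -j by ring, ih,
            walk_out, L]
          simp
      exact (this t).symm
  | left e ih =>
    cases b
    · refine hw' _ ⟨0, some e, ?_⟩
      rw [walk_left_in]; rfl
    · exact hw _ (ih true)
  | right e ih =>
    cases b
    · refine hw' _ ?_
      rw [walk_right_in]
      exact ih false
    · exact ⟨0, some e, rfl⟩

theorem linePos_injective : Function.Injective linePos := fun z z' h => by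
  rw [eq_lineBase z, eq_lineBase z', h]

end Lines

open Edge

/-- States of the automaton describing the self-map of the tree. -/
inductive SrcState : Type
  | plain | left | right | descL (j : ℕ) | descR (j : ℕ)

open SrcState

section Automaton

variable (k : ℕ)

/-- Transition of the automaton along a left edge. -/
def srcLeft : SrcState × Edge → SrcState × Edge
  | (plain, v) => (left, v.L)
  | (left, v) => (left, L^[k] v)
  | (right, v) => (descR (k - 2), v)
  | (descL j, v) => (plain, (L^[j + 1] v).R)
  | (descR _, v) => (plain, v.L)

/-- Transition of the automaton along a right edge. -/
def srcRight : SrcState × Edge → SrcState × Edge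
  | (plain, v) => (right, v.R)
  | (left, v) => (descL (k - 2), v)
  | (right, v) => (right, R^[k] v)
  | (descL 0, v) => (plain, v.R)
  | (descL (j + 1), v) => (descL j, v)
  | (descR 0, v) => (plain, v.R.L)
  | (descR (j + 1), v) => (descR j, v.R)

/-- The line of the target to which the line of the source leaving to the right is mapped. -/
def srcLine : SrcState × Edge → Edge
  | (plain, v) => v
  | (left, v) => L^[k - 1] v
  | (right, v) => R^[k - 1] v
  | (descL j, v) => L^[j] v
  | (descR _, v) => v

/-- Extension of data along the tree from data on the roots. -/
def extend {β : Type*} (base : ℤ → β) (l r : Edge → β → β) : Edge → β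
  | root t => base t
  | node t [] => r (root t) (base t)
  | node t (false :: u) => l (node t u) (extend base l r (node t u))
  | node t (true :: u) => r (node t u) (extend base l r (node t u))
termination_by e => match e with | root _ => 0 | node _ u => u.length + 1

theorem extend_right {β : Type*} (base : ℤ → β) (l r : Edge → β → β) (e : Edge) :
    extend base l r e.R = r e (extend base l r e) := by
  cases e <;> simp [R, extend]

theorem extend_left {β : Type*} (base : ℤ → β) (l r : Edge → β → β)
    (h : ∀ t, base (t + 1) = l (root t) (base t)) (e : Edge) :
    extend base l r e.L = l e (extend base l r e) := by
  cases e <;> simp [L, extend, h]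

/-- The state and the pointer of the automaton at an edge of the source. -/
def src : Edge → SrcState × Edge :=
  extend (fun t => (left, root (k * t))) (fun _ => srcLeft k) (fun _ => srcRight k)

theorem src_root (t : ℤ) : src k (root t) = (left, root (k * t)) := by
  rw [src, extend]

theorem src_left (e : Edge) : src k e.L = srcLeft k (src k e) :=
  extend_left _ _ _ (fun t => by
    simp only [srcLeft, iterate_L_root]
    rw [mul_add, mul_one]) e

theorem src_right (e : Edge) : src k e.R = srcRight k (src k e) := extend_right _ _ _ e

/-- The images of the two orientations of an edge of the source. -/
noncomputable def imgPair : Edge → DEdge × DEdge :=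
  extend (fun t => ((root (k * t), true), (walk ^ (1 - k : ℤ)) (root (k * t), false)))
    (fun e y => ((walk ^ (k : ℤ)) y.1, (walk ^ (-k : ℤ)) ((srcLine k (src k e)).R, true)))
    (fun e y => (((srcLine k (src k e)).R, true), (walk ^ (-k : ℤ)) y.2))

theorem walk_zpow_out (j : ℕ) (e : Edge) : (walk ^ (j : ℤ)) (e, true) = (L^[j] e, true) := by
  rw [zpow_natCast, walk_pow_out]

theorem walk_zpow_in (j : ℕ) (e : Edge) : (walk ^ (j : ℤ)) (R^[j] e, false) = (e, false) := by
  rw [zpow_natCast, walk_pow_in]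

theorem zpow_zpow_apply (a b : ℤ) (z : DEdge) :
    (walk ^ a) ((walk ^ b) z) = (walk ^ (a + b)) z := by
  rw [zpow_add, Equiv.Perm.mul_apply]

theorem right_out_eq_left_in (e : Edge) :
    ((e.R, true) : DEdge) = (walk ^ (1 : ℤ)) (e.L, false) := by
  rw [zpow_one, walk_left_in]

theorem iterate_left_right_out (j : ℕ) (e : Edge) :
    (((L^[j] e).R, true) : DEdge) = (walk ^ (1 : ℤ)) (L^[j + 1] e, false) := by
  rw [right_out_eq_left_in, Function.iterate_succ_apply']

theorem imgPair_root (t : ℤ) :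
    imgPair k (root t) = ((root (k * t), true), (walk ^ (1 - k : ℤ)) (root (k * t), false)) := by
  rw [imgPair, extend]

variable {k}

theorem imgPair_left (hk : 2 ≤ k) (e : Edge) :
    imgPair k e.L =
      ((walk ^ (k : ℤ)) (imgPair k e).1, (walk ^ (-k : ℤ)) ((srcLine k (src k e)).R, true)) :=
  extend_left _ _ _ (fun t => by
    refine Prod.ext ?_ ?_
    · simp only [walk_zpow_out, iterate_L_root]
      rw [mul_add, mul_one]
    · simp only [src_root, srcLine]
      rw [iterate_left_right_out, zpow_zpow_apply, iterate_L_root, Nat.sub_add_cancel (by omega),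
        mul_add, mul_one]
      ring_nf) e

theorem imgPair_right (e : Edge) :
    imgPair k e.R =
      (((srcLine k (src k e)).R, true), (walk ^ (-k : ℤ)) (imgPair k e).2) :=
  extend_right _ _ _ e

/-- The self-map of the directed edges multiplying the boundary walk by `k`. -/
noncomputable def selfMap (k : ℕ) : DEdge → DEdge
  | (e, true) => (imgPair k e).1
  | (e, false) => (imgPair k e).2

theorem selfMap_walk (hk : 2 ≤ k) (z : DEdge) :
    selfMap k (walk z) = (walk ^ (k : ℤ)) (selfMap k z) := by
  obtain ⟨e, _ | _⟩ := z
  · obtain ⟨e, rfl | rfl⟩ := e.exists_eq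
    · rw [walk_left_in]
      simp only [selfMap, imgPair_left hk, imgPair_right, zpow_zpow_apply]
      simp
    · rw [walk_right_in]
      simp only [selfMap, imgPair_right, zpow_zpow_apply]
      simp
  · rw [walk_out]
    simp only [selfMap, imgPair_left hk]

theorem selfMap_zpow (hk : 2 ≤ k) (j : ℤ) (z : DEdge) :
    selfMap k ((walk ^ j) z) = (walk ^ (k * j : ℤ)) (selfMap k z) := by
  induction j with
  | zero => simp
  | succ j ih =>
    rw [add_comm, zpow_one_add, Equiv.Perm.mul_apply, selfMap_walk hk, ih, zpow_zpow_apply]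
    ring_nf
  | pred j ih =>
    refine (walk ^ (k : ℤ)).injective ?_
    rw [← selfMap_walk hk, ← Equiv.Perm.mul_apply, ← zpow_one_add, zpow_zpow_apply,
      show 1 + (-(j : ℤ) - 1) = -j by ring, ih]
    ring_nf

end Automaton

section Bounds

variable {k : ℕ}

/-- The exponents relating images to pointers in the plain and left states. -/
def outExps (k : ℕ) : Set ℤ := {-1, 0, (k - 1 : ℤ), (k : ℤ), (2 * k - 1 : ℤ), (3 * k - 2 : ℤ), (2 * k - 2 : ℤ), (k - 2 : ℤ)}

/-- The exponents relating images of reversed edges to pointers. -/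
def inExps (k : ℕ) : Set ℤ :=
  {(3 - 2 * k : ℤ), (2 - 2 * k : ℤ), (3 - 4 * k - (k - 2) * k : ℤ), (2 - 3 * k - (k - 2) * k : ℤ)}

/-- The relation between the images of an edge and the pointer of the automaton. -/
def SrcBound (k : ℕ) (X Y : DEdge) : SrcState × Edge → Prop
  | (plain, v) => (∃ e ∈ ({-1, 0, (k - 1 : ℤ), (k : ℤ), (2 * k - 1 : ℤ)} : Set ℤ), X = (walk ^ e) (v, true)) ∧
      ∃ d ∈ ({(2 - k : ℤ), (1 - k : ℤ), (2 - 3 * k - (k - 2) * k : ℤ),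
        (1 - 2 * k - (k - 2) * k : ℤ)} : Set ℤ),
        Y = (walk ^ d) (v, false)
  | (left, v) => (∃ e ∈ outExps k, X = (walk ^ e) (v, true)) ∧ Y = (walk ^ (1 - k : ℤ)) (v, false)
  | (right, v) => X = (v, true) ∧ ∃ d ∈ inExps k, Y = (walk ^ d) (v, false)
  | (descL j, v) => j + 2 ≤ k ∧ X = ((L^[j + 1] v).R, true) ∧
      Y = (walk ^ (1 - 2 * k - (k - 2 - j) * k : ℤ)) (v, false)
  | (descR j, v) => j + 2 ≤ k ∧ (∃ e ∈ ({0, (k : ℤ)} : Set ℤ), X = (walk ^ e) (v, true)) ∧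
      Y = (walk ^ (-k - (k - 2 - j) * k : ℤ)) (R^[j + 2] v, true)

theorem out_eq_left (e : ℤ) (v : Edge) : (walk ^ e) (v, true) = (walk ^ (e - 1)) (v.L, true) := by
  rw [← walk_out, ← Equiv.Perm.mul_apply, ← zpow_add_one, sub_add_cancel]

theorem in_eq_right (e : ℤ) (v : Edge) : (walk ^ e) (v, false) = (walk ^ (e + 1)) (v.R, false) := by
  rw [zpow_add_one, Equiv.Perm.mul_apply, walk_right_in]

theorem srcBound_imgPair (hk : 2 ≤ k) (x : Edge) :
    SrcBound k (imgPair k x).1 (imgPair k x).2 (src k x) := by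
  induction x using Edge.induction with
  | root t =>
    rw [imgPair_root, src_root]
    exact ⟨⟨0, by simp [outExps], rfl⟩, rfl⟩
  | left x ih =>
    rw [imgPair_left hk, src_left]
    generalize imgPair k x = y at ih ⊢
    generalize src k x = w at ih ⊢
    obtain ⟨X, Y⟩ := y
    obtain ⟨_ | _ | _ | j | j, v⟩ := w
    · obtain ⟨⟨e, he, rfl⟩, -⟩ := ih
      refine ⟨⟨k + e - 1, ?_, ?_⟩, ?_⟩
      · simp only [outExps, Set.mem_insert_iff, Set.mem_singleton_iff] at he ⊢; omega
      · rw [zpow_zpow_apply, out_eq_left]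
      · simp only [srcLine]
        rw [right_out_eq_left_in, zpow_zpow_apply, neg_add_eq_sub]
    · obtain ⟨⟨e, he, rfl⟩, -⟩ := ih
      refine ⟨⟨e, he, ?_⟩, ?_⟩
      · simp only
        rw [zpow_zpow_apply, add_comm, ← zpow_zpow_apply, walk_zpow_out]
      · simp only [srcLine]
        rw [iterate_left_right_out, zpow_zpow_apply, neg_add_eq_sub, Nat.sub_add_cancel (by omega)]
    · obtain ⟨rfl, -⟩ := ih
      refine ⟨by omega, ⟨k, by simp, rfl⟩, ?_⟩
      simp only [srcLine]
      rw [← Function.iterate_succ_apply' R, show (k - 1).succ = k - 2 + 2 by omega]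
      push_cast [hk]; ring_nf
    · obtain ⟨hj, rfl, -⟩ := ih
      refine ⟨⟨k, by simp, rfl⟩, 2 - k, by simp, ?_⟩
      simp only [srcLine]
      rw [iterate_left_right_out, zpow_zpow_apply, in_eq_right]
      ring_nf
    · obtain ⟨hj, ⟨e, he, rfl⟩, -⟩ := ih
      refine ⟨⟨k + e - 1, ?_, ?_⟩, 1 - k, by simp, ?_⟩
      · simp only [Set.mem_insert_iff, Set.mem_singleton_iff] at he ⊢; omega
      · rw [zpow_zpow_apply, out_eq_left]
      · simp only [srcLine]
        rw [right_out_eq_left_in, zpow_zpow_apply, neg_add_eq_sub]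
  | right x ih =>
    rw [imgPair_right, src_right]
    generalize imgPair k x = y at ih ⊢
    generalize src k x = w at ih ⊢
    obtain ⟨X, Y⟩ := y
    obtain ⟨_ | _ | _ | j | j, v⟩ := w
    · obtain ⟨-, d, hd, rfl⟩ := ih
      refine ⟨rfl, -k + d + 1, ?_, ?_⟩
      · simp only [inExps, Set.mem_insert_iff, Set.mem_singleton_iff] at hd ⊢
        generalize ((k : ℤ) - 2) * k = m at *
        omega
      · simp only
        rw [zpow_zpow_apply, in_eq_right]
    · obtain ⟨-, rfl⟩ := ih
      refine ⟨by omega, ?_, ?_⟩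
      · simp only [srcLine]
        rw [show k - 2 + 1 = k - 1 by omega]
      · simp only
        rw [zpow_zpow_apply]
        push_cast [hk]; ring_nf
    · obtain ⟨rfl, d, hd, rfl⟩ := ih
      refine ⟨?_, d, hd, ?_⟩
      · simp only [srcLine]
        rw [← Function.iterate_succ_apply' R, show (k - 1).succ = k by omega]
      · simp only
        rw [← walk_zpow_in k v, zpow_zpow_apply, zpow_zpow_apply]
        ring_nf
    · obtain ⟨hj, rfl, rfl⟩ := ih
      rcases j with _ | j
      · refine ⟨⟨0, by simp, rfl⟩, 2 - 3 * k - (k - 2) * k, by simp, ?_⟩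
        simp only
        rw [zpow_zpow_apply, in_eq_right]
        push_cast; ring_nf
      · refine ⟨by omega, rfl, ?_⟩
        simp only
        rw [zpow_zpow_apply]
        push_cast; ring_nf
    · obtain ⟨hj, -, rfl⟩ := ih
      rcases j with _ | j
      · refine ⟨⟨-1, by simp, ?_⟩, 1 - 2 * k - (k - 2) * k, by simp, ?_⟩
        · simp only [srcLine]
          rw [← zero_sub, ← out_eq_left]; rfl
        · simp only
          rw [show R^[0 + 2] v = v.R.R from rfl, right_out_eq_left_in, zpow_zpow_apply,
            zpow_zpow_apply]
          push_cast; ring_nf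
      · refine ⟨by omega, ⟨0, by simp, rfl⟩, ?_⟩
        simp only
        rw [zpow_zpow_apply, ← Function.iterate_succ_apply R,
          show (j + 2).succ = j + 1 + 2 by omega]
        push_cast; ring_nf

end Bounds

open Edge SrcState

/-- States of the automaton inverting the self-map of the tree. -/
inductive TgtState : Type
  | plain | left (i : ℕ) | right (i : ℕ)

section Inverse

variable (k : ℕ)

/-- Transition of the inverse automaton along a left edge. -/
def tgtLeft : Edge × TgtState → Edge × TgtState
  | (x, .plain) => (x.L, .left 0)
  | (x, .left i) => if i + 1 = k then (x.L, .left 0) else (x, .left (i + 1))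
  | (x, .right i) => if i + 1 = k then (R^[k - 1] x.L, .plain) else ((R^[i] x.L).L, .plain)

/-- Transition of the inverse automaton along a right edge. -/
def tgtRight : Edge × TgtState → Edge × TgtState
  | (x, .plain) => (x.R, .right 0)
  | (x, .left i) => if i = 0 then (R^[k] x, .plain) else ((R^[k - i] x).L, .plain)
  | (x, .right i) => if i + 1 = k then (x.R, .right 0) else (x, .right (i + 1))

/-- The source edge and the state of the inverse automaton at an edge of the target. -/
def tgt : Edge → Edge × TgtState :=
  extend (fun t => (root (t / k), .left (t % k).toNat)) (fun _ => tgtLeft k) (fun _ => tgtRight k)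

theorem tgt_root (t : ℤ) : tgt k (root t) = (root (t / k), .left (t % k).toNat) := by
  rw [tgt, extend]

theorem tgt_right (e : Edge) : tgt k e.R = tgtRight k (tgt k e) := extend_right _ _ _ e

variable {k}

theorem tgt_left (hk : 2 ≤ k) (e : Edge) : tgt k e.L = tgtLeft k (tgt k e) :=
  extend_left _ _ _ (fun t => by
    have hk0 : (0 : ℤ) < k := by omega
    have h1 := Int.emod_nonneg t hk0.ne'
    have h2 := Int.emod_lt_of_pos t hk0
    have h3 := Int.mul_ediv_add_emod t k
    simp only [tgtLeft]
    split_ifs with h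
    · have h4 : t + 1 = k * (t / k + 1) := by
        have : t % k + 1 = k := by omega
        linarith
      rw [h4, Int.mul_ediv_cancel_left _ hk0.ne', Int.mul_emod_right]
      rfl
    · have h4 : t + 1 = (t % k + 1) + k * (t / k) := by linarith
      have h5 : t % k + 1 < k := by omega
      rw [h4, Int.add_mul_ediv_left _ _ hk0.ne', Int.add_mul_emod_self_left,
        Int.emod_eq_of_lt (by omega) h5, Int.ediv_eq_zero_of_lt (by omega) h5, zero_add]
      congr 2
      omega) e

theorem src_iterate_descL {x v : Edge} (h : src k x = (left, v)) (a : ℕ)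
    (ha : a + 2 ≤ k) : src k (R^[a + 1] x) = (descL (k - 2 - a), v) := by
  induction a with
  | zero => rw [Function.iterate_one, src_right, h]; rfl
  | succ a ih =>
    rw [Function.iterate_succ_apply', src_right, ih (by omega),
      show k - 2 - a = k - 2 - (a + 1) + 1 by omega]
    rfl

theorem src_iterate_descR {x v : Edge} (h : src k x = (right, v)) (a : ℕ)
    (ha : a + 2 ≤ k) : src k (R^[a] x.L) = (descR (k - 2 - a), R^[a] v) := by
  induction a with
  | zero => rw [Function.iterate_zero_apply, src_left, h]; rfl
  | succ a ih =>
    rw [Function.iterate_succ_apply', src_right, ih (by omega),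
      show k - 2 - a = k - 2 - (a + 1) + 1 by omega, Function.iterate_succ_apply' R a v]
    rfl

/-- The relation between the inverse automaton at `z` and the automaton. -/
def TgtSpec (k : ℕ) (z : Edge) : Edge × TgtState → Prop
  | (x, .plain) => src k x = (plain, z)
  | (x, .left i) => i < k ∧ ∃ v, src k x = (left, v) ∧ L^[i] v = z
  | (x, .right i) => i < k ∧ ∃ v, src k x = (right, v) ∧ R^[i] v = z

theorem tgtSpec_tgt (hk : 2 ≤ k) (z : Edge) : TgtSpec k z (tgt k z) := by
  induction z using Edge.induction with
  | root t =>
    rw [tgt_root]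
    have hk0 : (0 : ℤ) < k := by omega
    have h1 := Int.emod_nonneg t hk0.ne'
    have h2 := Int.emod_lt_of_pos t hk0
    refine ⟨by omega, _, src_root _ _, ?_⟩
    rw [iterate_L_root, Int.toNat_of_nonneg h1, Int.mul_ediv_add_emod]
  | left z ih =>
    rw [tgt_left hk]
    generalize tgt k z = w at ih ⊢
    obtain ⟨x, _ | i | i⟩ := w
    · have ih : src k x = (plain, z) := ih
      exact ⟨by omega, z.L, by rw [src_left, ih]; rfl, rfl⟩
    · obtain ⟨hi, v, hx, rfl⟩ := ih
      simp only [tgtLeft]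
      split_ifs with h
      · refine ⟨by omega, L^[k] v, by rw [src_left, hx]; rfl, ?_⟩
        rw [← Function.iterate_succ_apply' L, ← h]; rfl
      · exact ⟨by omega, v, hx, Function.iterate_succ_apply' L i v⟩
    · obtain ⟨hi, v, hx, rfl⟩ := ih
      simp only [tgtLeft]
      split_ifs with h
      · change src k _ = _
        have := src_iterate_descR hx (k - 2) (by omega)
        rw [show k - 1 = k - 2 + 1 by omega, Function.iterate_succ_apply', src_right, this,
          show k - 2 - (k - 2) = 0 by omega, show i = k - 2 + 1 by omega,
          Function.iterate_succ_apply']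
        rfl
      · change src k _ = _
        rw [src_left, src_iterate_descR hx i (by omega)]
        rfl
  | right z ih =>
    rw [tgt_right]
    generalize tgt k z = w at ih ⊢
    obtain ⟨x, _ | i | i⟩ := w
    · have ih : src k x = (plain, z) := ih
      exact ⟨by omega, z.R, by rw [src_right, ih]; rfl, rfl⟩
    · obtain ⟨hi, v, hx, rfl⟩ := ih
      simp only [tgtRight]
      split_ifs with h
      · subst h
        change src k _ = _
        have := src_iterate_descL hx (k - 2) (by omega)
        rw [show k = (k - 2 + 1) + 1 by omega, Function.iterate_succ_apply',
          ← show k = (k - 2 + 1) + 1 by omega, src_right, this, show k - 2 - (k - 2) = 0 by omega]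
        rfl
      · change src k _ = _
        obtain ⟨i, rfl⟩ := Nat.exists_eq_succ_of_ne_zero h
        have := src_iterate_descL hx (k - 2 - i) (by omega)
        rw [show k - i.succ = k - 2 - i + 1 by omega, src_left, this,
          show k - 2 - (k - 2 - i) = i by omega]
        rfl
    · obtain ⟨hi, v, hx, rfl⟩ := ih
      simp only [tgtRight]
      split_ifs with h
      · refine ⟨by omega, R^[k] v, by rw [src_right, hx]; rfl, ?_⟩
        rw [← Function.iterate_succ_apply' R, ← h]; rfl
      · exact ⟨by omega, v, hx, Function.iterate_succ_apply' R i v⟩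

theorem tgt_iterate_left (hk : 2 ≤ k) {x v : Edge} (h : tgt k v = (x, .left 0)) (i : ℕ)
    (hi : i < k) : tgt k (L^[i] v) = (x, .left i) := by
  induction i with
  | zero => exact h
  | succ i ih =>
    rw [Function.iterate_succ_apply', tgt_left hk, ih (by omega), tgtLeft, if_neg (by omega)]

theorem tgt_iterate_right {x v : Edge} (h : tgt k v = (x, .right 0)) (i : ℕ)
    (hi : i < k) : tgt k (R^[i] v) = (x, .right i) := by
  induction i with
  | zero => exact h
  | succ i ih =>
    rw [Function.iterate_succ_apply', tgt_right, ih (by omega), tgtRight, if_neg (by omega)]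

/-- The relation between the automaton at `x` and the inverse automaton. -/
def SrcSpec (k : ℕ) (x : Edge) : SrcState × Edge → Prop
  | (plain, v) => tgt k v = (x, .plain)
  | (left, v) => tgt k v = (x, .left 0)
  | (right, v) => tgt k v = (x, .right 0)
  | (descL j, v) => j + 2 ≤ k ∧ ∃ y, tgt k v = (y, .left 0) ∧ x = R^[k - 1 - j] y
  | (descR j, v) => j + 2 ≤ k ∧ ∃ y, tgt k v = (y, .right (k - 2 - j)) ∧ x = R^[k - 2 - j] y.L

theorem srcSpec_src (hk : 2 ≤ k) (x : Edge) : SrcSpec k x (src k x) := by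
  induction x using Edge.induction with
  | root t =>
    rw [src_root]
    change tgt k _ = _
    rw [tgt_root, Int.mul_ediv_cancel_left _ (by omega), Int.mul_emod_right]
    rfl
  | left x ih =>
    rw [src_left]
    generalize src k x = w at ih ⊢
    obtain ⟨_ | _ | _ | j | j, v⟩ := w
    · change tgt k v = _ at ih
      change tgt k _ = _
      rw [tgt_left hk, ih]; rfl
    · change tgt k v = _ at ih
      change tgt k _ = _
      rw [show k = k - 1 + 1 by omega, Function.iterate_succ_apply', ← show k = k - 1 + 1 by omega,
        tgt_left hk, tgt_iterate_left hk ih _ (by omega), tgtLeft, if_pos (by omega)]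
    · change tgt k v = _ at ih
      exact ⟨by omega, x, by rw [Nat.sub_self]; exact ih, by rw [Nat.sub_self]; rfl⟩
    · obtain ⟨hj, y, hv, rfl⟩ := ih
      change tgt k _ = _
      rw [tgt_right, tgt_iterate_left hk hv _ (by omega), tgtRight, if_neg (by omega),
        show k - (j + 1) = k - 1 - j by omega]
    · obtain ⟨hj, y, hv, rfl⟩ := ih
      change tgt k _ = _
      rw [tgt_left hk, hv, tgtLeft, if_neg (by omega)]
  | right x ih =>
    rw [src_right]
    generalize src k x = w at ih ⊢
    obtain ⟨_ | _ | _ | j | j, v⟩ := w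
    · change tgt k v = _ at ih
      change tgt k _ = _
      rw [tgt_right, ih]; rfl
    · change tgt k v = _ at ih
      refine ⟨by omega, x, ih, ?_⟩
      rw [show k - 1 - (k - 2) = 1 by omega]; rfl
    · change tgt k v = _ at ih
      change tgt k _ = _
      rw [show k = k - 1 + 1 by omega, Function.iterate_succ_apply', ← show k = k - 1 + 1 by omega,
        tgt_right, tgt_iterate_right ih _ (by omega), tgtRight, if_pos (by omega)]
    · obtain ⟨hj, y, hv, rfl⟩ := ih
      rcases j with _ | j
      · change tgt k _ = _
        rw [tgt_right, hv, tgtRight, if_pos rfl, ← Function.iterate_succ_apply' R,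
          show (k - 1 - 0).succ = k by omega]
      · refine ⟨by omega, y, hv, ?_⟩
        rw [← Function.iterate_succ_apply' R, show (k - 1 - (j + 1)).succ = k - 1 - j by omega]
    · obtain ⟨hj, y, hv, rfl⟩ := ih
      rcases j with _ | j
      · change tgt k _ = _
        rw [tgt_left hk, tgt_right, hv, tgtRight, if_neg (by omega), tgtLeft, if_pos (by omega),
          ← Function.iterate_succ_apply' R, show (k - 2 - 0).succ = k - 1 by omega]
      · refine ⟨by omega, y, ?_, ?_⟩
        · rw [tgt_right, hv, tgtRight, if_neg (by omega)]
          congr 2; omega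
        · rw [← Function.iterate_succ_apply' R, show (k - 2 - (j + 1)).succ = k - 2 - j by omega]

/-- Recovery of the source edge from the inverse automaton at the image line. -/
def recover (k : ℕ) : Edge × TgtState → Edge
  | (x, .plain) => x
  | (x, .left i) => if i + 1 = k then x else R^[k - 1 - i] x
  | (x, .right i) => if i + 1 = k then x else R^[i] x.L

theorem recover_srcLine (hk : 2 ≤ k) (x : Edge) : recover k (tgt k (srcLine k (src k x))) = x := by
  have ih := srcSpec_src hk x
  generalize src k x = w at ih ⊢
  obtain ⟨_ | _ | _ | j | j, v⟩ := w
  · change tgt k v = _ at ih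
    rw [srcLine, ih]; rfl
  · change tgt k v = _ at ih
    rw [srcLine, tgt_iterate_left hk ih _ (by omega), recover, if_pos (by omega)]
  · change tgt k v = _ at ih
    rw [srcLine, tgt_iterate_right ih _ (by omega), recover, if_pos (by omega)]
  · obtain ⟨hj, y, hv, rfl⟩ := ih
    rw [srcLine, tgt_iterate_left hk hv _ (by omega), recover, if_neg (by omega)]
  · obtain ⟨hj, y, hv, rfl⟩ := ih
    rw [srcLine, hv, recover, if_neg (by omega)]

theorem srcLine_injective (hk : 2 ≤ k) : Function.Injective fun x => srcLine k (src k x) :=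
  fun x y h => by rw [← recover_srcLine hk x, ← recover_srcLine hk y]; exact congrArg _ (congrArg _ h)

theorem selfMap_lineBase (o : Option Edge) :
    selfMap k (lineBase o) = lineBase (o.map fun x => srcLine k (src k x)) := by
  cases o with
  | none => simp [lineBase, selfMap, imgPair_root]
  | some e => simp [lineBase, selfMap, imgPair_right]

theorem linePos_selfMap (hk : 2 ≤ k) (z : DEdge) :
    linePos (selfMap k z) =
      ((linePos z).1.map fun x => srcLine k (src k x), k * (linePos z).2) := by
  rw [eq_lineBase z, selfMap_zpow hk, linePos_zpow, selfMap_lineBase, linePos_lineBase,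
    linePos_zpow, linePos_lineBase]
  simp

theorem eq_of_selfMap_eq (hk : 2 ≤ k) {z z' : DEdge} {j : ℤ}
    (h : selfMap k z' = (walk ^ j) (selfMap k z)) : ∃ i : ℤ, j = k * i ∧ z' = (walk ^ i) z := by
  have h1 := congrArg linePos h
  rw [linePos_zpow, linePos_selfMap hk, linePos_selfMap hk, Prod.mk.injEq] at h1
  refine ⟨(linePos z').2 - (linePos z).2, by linarith [h1.2], linePos_injective ?_⟩
  rw [linePos_zpow, ← Option.map_injective (srcLine_injective hk) h1.1]
  simp

end Inverse

open Edge SrcState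

/-- The directed edge `z'` is reached from `z` by at most `N` elementary moves. -/
def Within : ℕ → DEdge → DEdge → Prop
  | 0, z, z' => z' = z
  | N + 1, z, z' => ∃ y, Within N z y ∧ (z' = y ∨ z' = walk y ∨ walk z' = y ∨ z' = flipEdge y)

theorem Within.mono {N M : ℕ} {z z' : DEdge} (h : Within N z z') (hNM : N ≤ M) :
    Within M z z' := by
  induction hNM with
  | refl => exact h
  | step _ ih => exact ⟨_, ih, Or.inl rfl⟩

theorem Within.trans {N M : ℕ} {x y z : DEdge} (h : Within N x y) (h' : Within M y z) :
    Within (N + M) x z := by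
  induction M generalizing z with
  | zero => cases h'; exact h
  | succ M ih =>
    obtain ⟨w, hw, h2⟩ := h'
    exact ⟨w, ih hw, h2⟩

theorem Within.symm {N : ℕ} {x y : DEdge} (h : Within N x y) : Within N y x := by
  induction N generalizing y with
  | zero => exact Eq.symm h
  | succ N ih =>
    obtain ⟨w, hw, h2⟩ := h
    have h3 : Within 1 y w := by
      refine ⟨y, rfl, ?_⟩
      rcases h2 with rfl | rfl | rfl | rfl
      · exact Or.inl rfl
      · exact Or.inr (Or.inr (Or.inl rfl))
      · exact Or.inr (Or.inl rfl)
      · exact Or.inr (Or.inr (Or.inr (by simp)))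
    rw [add_comm]
    exact h3.trans (ih hw)

theorem within_flip (z : DEdge) : Within 1 z (flipEdge z) :=
  ⟨z, rfl, Or.inr (Or.inr (Or.inr rfl))⟩

theorem within_walk (z : DEdge) : Within 1 z (walk z) := ⟨z, rfl, Or.inr (Or.inl rfl)⟩

theorem within_walk_zpow {N : ℕ} {j : ℤ} (hj : |j| ≤ N) (z : DEdge) :
    Within N z ((walk ^ j) z) := by
  have key : ∀ (n : ℕ) (z : DEdge), Within n z ((walk ^ n) z) := fun n z => by
    induction n with
    | zero => rfl
    | succ n ih => exact ⟨_, ih, Or.inr (Or.inl (by rw [pow_succ', Equiv.Perm.mul_apply]))⟩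
  rw [abs_le] at hj
  obtain ⟨n, rfl | rfl⟩ := j.eq_nat_or_neg
  · rw [zpow_natCast]
    exact (key n z).mono (by omega)
  · rw [zpow_neg, zpow_natCast]
    have := key n ((walk ^ n)⁻¹ z)
    rw [← Equiv.Perm.mul_apply, mul_inv_cancel, Equiv.Perm.one_apply] at this
    exact this.symm.mono (by omega)

theorem within_right_out (e : Edge) : Within 3 (e, true) (e.R, true) := by
  rw [right_out_eq]
  exact ((within_walk _).trans (within_flip _)).trans (within_walk _)

theorem within_iterate_right_out (j : ℕ) (e : Edge) :
    Within (3 * j) (e, true) (R^[j] e, true) := by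
  induction j with
  | zero => rfl
  | succ j ih =>
    rw [Function.iterate_succ_apply']
    exact ih.trans (within_right_out _)

theorem within_map {φ : DEdge → DEdge} {N : ℕ} (hw : ∀ z, Within N (φ z) (φ (walk z)))
    (hf : ∀ z, Within N (φ z) (φ (flipEdge z))) {M : ℕ} {z z' : DEdge} (h : Within M z z') :
    Within (N * M) (φ z) (φ z') := by
  induction M generalizing z' with
  | zero => cases h; rfl
  | succ M ih =>
    obtain ⟨y, hy, h⟩ := h
    refine (ih hy).trans ?_
    rcases h with rfl | rfl | rfl | rfl
    · exact Within.mono (N := 0) rfl (Nat.zero_le _)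
    · exact hw _
    · exact (hw _).symm
    · exact hf _

section Bounds

variable {k : ℕ}

theorem outExps_bound {e : ℤ} (h : e ∈ outExps k) : |e| ≤ 3 * k + 2 := by
  simp only [outExps, Set.mem_insert_iff, Set.mem_singleton_iff] at h
  rw [abs_le]
  omega

theorem inExps_bound {e : ℤ} (h : e ∈ inExps k) : |e| ≤ ((k * k + 8 * k + 9 : ℕ) : ℤ) := by
  simp only [inExps, Set.mem_insert_iff, Set.mem_singleton_iff] at h
  rw [abs_le]
  push_cast
  constructor <;> rcases h with rfl | rfl | rfl | rfl <;> nlinarith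

theorem within_selfMap_flip (hk : 2 ≤ k) (z : DEdge) :
    Within (2 * (k * k + 8 * k + 9) + 8 * k) (selfMap k z) (selfMap k (flipEdge z)) := by
  suffices h : ∀ x, Within (2 * (k * k + 8 * k + 9) + 8 * k) (imgPair k x).1 (imgPair k x).2 by
    obtain ⟨x, _ | _⟩ := z
    · exact (h x).symm
    · exact h x
  intro x
  have hb := srcBound_imgPair hk x
  generalize imgPair k x = y at hb ⊢
  generalize src k x = w at hb ⊢
  obtain ⟨X, Y⟩ := y
  have hflip : ∀ v : Edge, Within 1 (v, true) (v, false) := fun v => within_flip (v, true)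
  obtain ⟨_ | _ | _ | j | j, v⟩ := w
  · obtain ⟨⟨e, he, rfl⟩, d, hd, rfl⟩ := hb
    have he' : |e| ≤ ((3 * k + 2 : ℕ) : ℤ) := by
      simp only [Set.mem_insert_iff, Set.mem_singleton_iff] at he
      rw [abs_le]; push_cast; omega
    have hd' : |d| ≤ ((k * k + 8 * k + 9 : ℕ) : ℤ) := by
      simp only [Set.mem_insert_iff, Set.mem_singleton_iff] at hd
      rw [abs_le]; push_cast
      constructor <;> rcases hd with rfl | rfl | rfl | rfl <;> nlinarith
    refine (((within_walk_zpow he' _).symm.trans (hflip v)).trans (within_walk_zpow hd' _)).mono ?_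
    nlinarith
  · obtain ⟨⟨e, he, rfl⟩, rfl⟩ := hb
    have he' : |e| ≤ ((3 * k + 2 : ℕ) : ℤ) := by exact_mod_cast outExps_bound he
    have hd' : |(1 - k : ℤ)| ≤ ((k : ℕ) : ℤ) := by rw [abs_le]; omega
    refine (((within_walk_zpow he' _).symm.trans (hflip v)).trans (within_walk_zpow hd' _)).mono ?_
    nlinarith
  · obtain ⟨rfl, d, hd, rfl⟩ := hb
    refine ((hflip v).trans (within_walk_zpow (inExps_bound hd) _)).mono ?_
    nlinarith
  · obtain ⟨hj, rfl, rfl⟩ := hb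
    have hd' : |(1 - 2 * k - (k - 2 - j) * k : ℤ)| ≤ ((k * k + 8 * k + 9 : ℕ) : ℤ) := by
      have : (j : ℤ) + 2 ≤ k := by exact_mod_cast hj
      rw [abs_le]; push_cast
      constructor <;> nlinarith
    have h1 : Within k (v, true) (L^[j + 1] v, true) := by
      rw [← walk_zpow_out]
      exact within_walk_zpow (by rw [abs_le]; push_cast; omega) _
    refine ((((within_right_out _).symm.trans h1.symm).trans (hflip v)).trans
      (within_walk_zpow hd' _)).mono ?_
    nlinarith
  · obtain ⟨hj, ⟨e, he, rfl⟩, rfl⟩ := hb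
    have he' : |e| ≤ ((k : ℕ) : ℤ) := by
      simp only [Set.mem_insert_iff, Set.mem_singleton_iff] at he
      rw [abs_le]; omega
    have hd' : |(-k - (k - 2 - j) * k : ℤ)| ≤ ((k * k + 8 * k + 9 : ℕ) : ℤ) := by
      have : (j : ℤ) + 2 ≤ k := by exact_mod_cast hj
      rw [abs_le]; push_cast
      constructor <;> nlinarith
    refine (((within_walk_zpow he' _).symm.trans (within_iterate_right_out (j + 2) v)).trans
      (within_walk_zpow hd' _)).mono ?_
    nlinarith

/-- Preimages of the two orientations of an edge under the self-map, up to the boundary walk. -/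
theorem exists_preimage_pair (hk : 2 ≤ k) : ∃ N : ℕ, ∀ z : DEdge, ∃ (s s' : DEdge) (j j' : ℤ),
    |j| ≤ N ∧ |j'| ≤ N ∧ z = (walk ^ j) (selfMap k s) ∧ flipEdge z = (walk ^ j') (selfMap k s') ∧
      Within N s s' := by
  refine ⟨k * k + 12 * k + 12, fun z => ?_⟩
  suffices h : ∀ z : Edge, ∃ (s s' : DEdge) (j j' : ℤ),
      |j| ≤ ((k * k + 12 * k + 12 : ℕ) : ℤ) ∧ |j'| ≤ ((k * k + 12 * k + 12 : ℕ) : ℤ) ∧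
      (z, true) = (walk ^ j) (selfMap k s) ∧
      (z, false) = (walk ^ j') (selfMap k s') ∧ Within (k * k + 12 * k + 12) s s' by
    obtain ⟨z, _ | _⟩ := z
    · obtain ⟨s, s', j, j', h1, h2, h3, h4, h5⟩ := h z
      exact ⟨s', s, j', j, h2, h1, h4, h3, h5.symm⟩
    · exact h z
  clear z
  intro z
  have hinv : ∀ (i : ℤ) (z z' : DEdge), z = (walk ^ i) z' → z' = (walk ^ (-i)) z :=
    fun i z z' h => by rw [h, zpow_zpow_apply]; simp
  have hflip : ∀ v : Edge, Within (k * k + 12 * k + 12) (v, true) (v, false) :=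
    fun v => (within_flip (v, true)).mono (by omega)
  have ht := tgtSpec_tgt hk z
  generalize tgt k z = w at ht
  obtain ⟨x, st⟩ := w
  have hb := srcBound_imgPair hk x
  rcases st with _ | i | i
  · have ht : src k x = (plain, z) := ht
    rw [ht] at hb
    obtain ⟨⟨e, he, hX⟩, d, hd, hY⟩ := hb
    simp only [Set.mem_insert_iff, Set.mem_singleton_iff] at hd he
    refine ⟨(x, true), (x, false), -e, -d, ?_, ?_, hinv _ _ _ hX, hinv _ _ _ hY, hflip x⟩
    · rw [abs_le]; push_cast
      constructor <;> rcases he with rfl | rfl | rfl | rfl | rfl <;> nlinarith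
    · rw [abs_le]; push_cast
      constructor <;> rcases hd with rfl | rfl | rfl | rfl <;> nlinarith
  · obtain ⟨hi, v, hv, rfl⟩ : i < k ∧ ∃ v, src k x = (left, v) ∧ L^[i] v = z := ht
    rw [hv] at hb
    obtain ⟨⟨e, he, hX⟩, hY⟩ := hb
    have he' := abs_le.mp (outExps_bound he)
    have hout : ((L^[i] v, true) : DEdge) = (walk ^ (i - e : ℤ)) (selfMap k (x, true)) := by
      change _ = (walk ^ (i - e : ℤ)) (imgPair k x).1
      rw [hX, zpow_zpow_apply, sub_add_cancel, walk_zpow_out]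
    have hbd : |(i - e : ℤ)| ≤ ((k * k + 12 * k + 12 : ℕ) : ℤ) := by
      rw [abs_le]; push_cast
      constructor <;> nlinarith
    rcases i with _ | i
    · refine ⟨(x, true), (x, false), _, -(1 - k), hbd, ?_, hout, hinv _ _ _ hY, hflip x⟩
      rw [abs_le]; push_cast
      constructor <;> nlinarith
    · refine ⟨(x, true), (R^[k - i] x, true), _, -1, hbd, ?_, hout, ?_, ?_⟩
      · rw [abs_le]; push_cast
        constructor <;> nlinarith
      · have h1 := src_iterate_descL hv (k - 2 - i) (by omega)
        rw [show k - i = (k - 2 - i + 1) + 1 by omega, Function.iterate_succ_apply' R]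
        change _ = (walk ^ (-1 : ℤ)) (imgPair k _).1
        rw [imgPair_right, h1, show k - 2 - (k - 2 - i) = i by omega]
        change _ = (walk ^ (-1 : ℤ)) ((L^[i] v).R, true)
        rw [iterate_left_right_out, zpow_zpow_apply]
        simp
      · exact (within_iterate_right_out _ _).mono (by nlinarith [Nat.sub_le k i])
  · obtain ⟨hi, v, hv, rfl⟩ : i < k ∧ ∃ v, src k x = (right, v) ∧ R^[i] v = z := ht
    rw [hv] at hb
    obtain ⟨hX, d, hd, hY⟩ := hb
    have hd' := abs_le.mp (inExps_bound hd)
    push_cast at hd'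
    have hin : ((R^[i] v, false) : DEdge) = (walk ^ (-i - d : ℤ)) (selfMap k (x, false)) := by
      change _ = (walk ^ (-i - d : ℤ)) (imgPair k x).2
      rw [hY, zpow_zpow_apply, sub_add_cancel]
      exact hinv _ _ _ (walk_zpow_in i v).symm
    have hbd : |(-i - d : ℤ)| ≤ ((k * k + 12 * k + 12 : ℕ) : ℤ) := by
      rw [abs_le]; push_cast
      constructor <;> nlinarith
    rcases i with _ | i
    · exact ⟨(x, true), (x, false), 0, _, by simp; positivity, hbd, hX.symm, hin, hflip x⟩
    · refine ⟨(R^[i + 1] x.L, true), (x, false), 0, _, by simp; positivity, hbd, ?_, hin, ?_⟩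
      · have h1 := src_iterate_descR hv i (by omega)
        rw [Function.iterate_succ_apply', Function.iterate_succ_apply']
        change _ = (walk ^ (0 : ℤ)) (imgPair k _).1
        rw [imgPair_right, h1]
        rfl
      · have h1 : Within 1 (x, true) (x.L, true) := within_walk (x, true)
        refine ((within_iterate_right_out (i + 1) x.L).symm.trans
          (h1.symm.trans (within_flip _))).mono ?_
        nlinarith

end Bounds

open Edge

/-- Generators of a free product of `m` copies of `ℤ/2`, indexed by natural numbers. -/
noncomputable def ugen (m j : ℕ) : Fr (Fin m) := if h : j < m then fgen ⟨j, h⟩ else 1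

theorem ugen_mul_self (m j : ℕ) : ugen m j * ugen m j = 1 := by
  unfold ugen; split_ifs <;> simp [gen_mul_self]

theorem ugen_inv (m j : ℕ) : (ugen m j)⁻¹ = ugen m j :=
  inv_eq_of_mul_eq_one_left (ugen_mul_self m j)

theorem ugen_mul_ugen_mul (m j : ℕ) (g : Fr (Fin m)) : ugen m j * (ugen m j * g) = g := by
  rw [← mul_assoc, ugen_mul_self, one_mul]

theorem ugen_coe {m : ℕ} (j : Fin m) : ugen m j = fgen j := dif_pos j.is_lt

/-- The product of the first generators of a free product of copies of `ℤ/2`. -/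
noncomputable def uprod (m : ℕ) : ℕ → Fr (Fin m)
  | 0 => 1
  | j + 1 => uprod m j * ugen m j

theorem ugen_mul_uprod_inv (m j : ℕ) : ugen m j * (uprod m (j + 1))⁻¹ = (uprod m j)⁻¹ := by
  rw [uprod, mul_inv_rev, ugen_inv, ugen_mul_ugen_mul]

theorem walk_flip_cube (z : DEdge) :
    walk (flipEdge (walk (flipEdge (walk (flipEdge z))))) = z := by
  obtain ⟨e, _ | _⟩ := z
  · simp [walk_out, walk_left_in, walk_right_in]
  · obtain ⟨e, rfl | rfl⟩ := e.exists_eq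
    · simp [walk_out, walk_left_in, walk_right_in]
    · simp [walk_out, walk_left_in, walk_right_in]

theorem exists_equivariant {Y : Type*} (p r : Equiv.Perm Y) (hr : ∀ y, r (r y) = y)
    (hpr : ∀ y, p (r (p (r (p (r y))))) = y) (y₀ : Y) : ∃ Φ : DEdge → Y,
      Φ (root 0, true) = y₀ ∧ (∀ z, Φ (walk z) = p (Φ z)) ∧ ∀ z, Φ (flipEdge z) = r (Φ z) := by
  let X : Edge → Y := extend (fun t => (p ^ t) y₀) (fun _ => p) (fun _ y => p (r (p y)))
  have hl : ∀ e : Edge, X e.L = p (X e) := extend_left _ _ _ fun t => by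
    rw [add_comm, zpow_one_add, Equiv.Perm.mul_apply]
  have hR : ∀ e : Edge, X e.R = p (r (p (X e))) := extend_right _ _ _
  refine ⟨fun z => if z.2 then X z.1 else r (X z.1), ?_, ?_, ?_⟩
  · simp [X, extend]
  · rintro ⟨e, _ | _⟩
    · obtain ⟨e, rfl | rfl⟩ := e.exists_eq
      · rw [walk_left_in]; simp [hl, hR]
      · rw [walk_right_in]
        have := hpr (r (X e))
        rw [hr] at this
        simp [hR, this]
    · rw [walk_out]; simp [hl]
  · rintro ⟨e, _ | _⟩ <;> simp [hr]

theorem equivariant_zpow {X Y : Type*} {a : Equiv.Perm X} {b : Equiv.Perm Y} {Φ : X → Y}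
    (h : ∀ x, Φ (a x) = b (Φ x)) (j : ℤ) (x : X) : Φ ((a ^ j) x) = (b ^ j) (Φ x) := by
  induction j with
  | zero => simp
  | succ j ih =>
    rw [add_comm, zpow_one_add, Equiv.Perm.mul_apply, h, ih, zpow_one_add, Equiv.Perm.mul_apply]
  | pred j ih =>
    refine b.injective ?_
    rw [← h, ← Equiv.Perm.mul_apply, ← Equiv.Perm.mul_apply, ← zpow_one_add, ← zpow_one_add,
      show 1 + (-(j : ℤ) - 1) = -j by ring, ih]

theorem equivariant_pow {X Y : Type*} {a : Equiv.Perm X} {b : Equiv.Perm Y} {Φ : X → Y}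
    (h : ∀ x, Φ (a x) = b (Φ x)) (j : ℕ) (x : X) : Φ ((a ^ j) x) = (b ^ j) (Φ x) := by
  simpa using equivariant_zpow h j x

/-- The move carrying the base directed edge to the `i`-th edge on the boundary of the fundamental
domain. -/
def conjMove {M : Type*} [Group M] (p r : M) (s i : ℕ) : M :=
  if i = 0 then (p * r) ^ 2 else if i ≤ s then p * r * p ^ (i - 1) else p ^ (s - 1)

theorem equivariant_conjMove {X Y : Type*} {a c : Equiv.Perm X} {b d : Equiv.Perm Y} {Φ : X → Y}
    (h : ∀ x, Φ (a x) = b (Φ x)) (h' : ∀ x, Φ (c x) = d (Φ x)) (s i : ℕ) (x : X) :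
    Φ (conjMove a c s i x) = conjMove b d s i (Φ x) := by
  have h2 : ∀ x, Φ ((a * c) x) = (b * d) (Φ x) := fun x => by simp [h, h']
  unfold conjMove
  split_ifs
  · exact equivariant_pow h2 2 x
  · rw [Equiv.Perm.mul_apply, h2, equivariant_pow h, ← Equiv.Perm.mul_apply]
  · exact equivariant_pow h _ x

section Development

variable (s : ℕ)

/-- Copies of a caterpillar tree with `s` vertices indexed by the free product of `s + 2` copies of
`ℤ/2`: the entries `v` and `c` are the vertex and the half-edge at the vertex. -/
abbrev Cat : Type := Fr (Fin (s + 2)) × ℕ × Fin 3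

/-- Rotation about the vertices. -/
def catTurn : Equiv.Perm (Cat s) where
  toFun y := (y.1, y.2.1, y.2.2 + 1)
  invFun y := (y.1, y.2.1, y.2.2 - 1)
  left_inv y := by simp
  right_inv y := by simp

/-- Crossing of edges. -/
noncomputable def catFlipFun : Cat s → Cat s
  | (g, v, 0) => if v = 0 then (ugen (s + 2) 0 * g, 0, 0) else
      if v < s then (g, v - 1, 1) else (g, v, 0)
  | (g, v, 1) => if v + 1 < s then (g, v + 1, 0) else
      if v + 1 = s then (ugen (s + 2) (s + 1) * g, v, 1) else (g, v, 1)
  | (g, v, 2) => (ugen (s + 2) (v + 1) * g, v, 2)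

theorem catFlipFun_catFlipFun (y : Cat s) : catFlipFun s (catFlipFun s y) = y := by
  obtain ⟨g, v, c⟩ := y
  fin_cases c
  · by_cases h : v = 0
    · subst h; simp [catFlipFun, ugen_mul_ugen_mul]
    · by_cases h' : v < s
      · have : v - 1 + 1 = v := by omega
        simp [catFlipFun, h, h', this]
      · simp [catFlipFun, h, h']
  · by_cases h : v + 1 < s
    · simp [catFlipFun, h]
    · by_cases h' : v + 1 = s
      · subst h'; simp [catFlipFun, ugen_mul_ugen_mul]
      · simp [catFlipFun, h, h']
  · simp [catFlipFun, ugen_mul_ugen_mul]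

/-- Crossing of edges as a permutation. -/
noncomputable def catFlip : Equiv.Perm (Cat s) :=
  ⟨catFlipFun s, catFlipFun s, catFlipFun_catFlipFun s, catFlipFun_catFlipFun s⟩

/-- The boundary walk. -/
noncomputable def catWalk : Equiv.Perm (Cat s) := catTurn s * catFlip s

theorem catFlip_catFlip (y : Cat s) : catFlip s (catFlip s y) = y := catFlipFun_catFlipFun s y

theorem catWalk_catFlip (y : Cat s) : catWalk s (catFlip s y) = (y.1, y.2.1, y.2.2 + 1) := by
  change catTurn s (catFlip s (catFlip s y)) = _
  rw [catFlip_catFlip]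
  rfl

variable {s}

theorem catWalk_apply_one {v : ℕ} (hv : v + 1 < s) (g : Fr (Fin (s + 2))) :
    catWalk s (g, v, 1) = (g, v + 1, 1) := by
  simp [catWalk, catTurn, catFlip, catFlipFun, hv]

theorem catWalk_apply_last {v : ℕ} (hv : v + 1 = s) (g : Fr (Fin (s + 2))) :
    catWalk s (g, v, 1) = (ugen (s + 2) (s + 1) * g, v, 2) := by
  simp [catWalk, catTurn, catFlip, catFlipFun, hv]

theorem catWalk_apply_two (v : ℕ) (g : Fr (Fin (s + 2))) :
    catWalk s (g, v, 2) = (ugen (s + 2) (v + 1) * g, v, 0) := by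
  simp [catWalk, catTurn, catFlip, catFlipFun]

theorem catWalk_apply_zero {v : ℕ} (hv : v + 1 < s) (g : Fr (Fin (s + 2))) :
    catWalk s (g, v + 1, 0) = (g, v, 2) := by
  simp [catWalk, catTurn, catFlip, catFlipFun, hv]

theorem catWalk_apply_first (g : Fr (Fin (s + 2))) :
    catWalk s (g, 0, 0) = (ugen (s + 2) 0 * g, 0, 1) := by
  simp [catWalk, catTurn, catFlip, catFlipFun]

theorem catWalk_pow_one {v : ℕ} (hv : v < s) (g : Fr (Fin (s + 2))) :
    (catWalk s ^ v) (g, 0, 1) = (g, v, 1) := by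
  induction v with
  | zero => rfl
  | succ v ih =>
    rw [pow_succ', Equiv.Perm.mul_apply, ih (by omega), catWalk_apply_one hv]

theorem catWalk_pow_two {a : ℕ} (ha : a < s) (g : Fr (Fin (s + 2))) :
    (catWalk s ^ (s + 2 * a)) (g, 0, 1) =
      ((uprod (s + 2) (s + 1 - a))⁻¹ * uprod (s + 2) (s + 2) * g, s - 1 - a, 2) := by
  induction a with
  | zero =>
    rw [show s + 2 * 0 = (s - 1) + 1 by omega, pow_succ', Equiv.Perm.mul_apply,
      catWalk_pow_one (by omega), catWalk_apply_last (by omega), Nat.sub_zero, Nat.sub_zero,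
      show uprod (s + 2) (s + 2) = uprod (s + 2) (s + 1) * ugen (s + 2) (s + 1) from rfl,
      inv_mul_cancel_left]
  | succ a ih =>
    rw [show s + 2 * (a + 1) = s + 2 * a + 1 + 1 by ring, pow_succ', Equiv.Perm.mul_apply, pow_succ',
      Equiv.Perm.mul_apply, ih (by omega), catWalk_apply_two,
      show s - 1 - a = s - 1 - (a + 1) + 1 by omega, catWalk_apply_zero (by omega),
      show s - 1 - (a + 1) + 1 + 1 = s + 1 - (a + 1) by omega,
      show s + 1 - a = s + 1 - (a + 1) + 1 by omega, ← mul_assoc, ← mul_assoc, ugen_mul_uprod_inv]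

theorem catWalk_pow_zero {a : ℕ} (ha : a < s) (g : Fr (Fin (s + 2))) :
    (catWalk s ^ (s + 2 * a + 1)) (g, 0, 1) =
      ((uprod (s + 2) (s - a))⁻¹ * uprod (s + 2) (s + 2) * g, s - 1 - a, 0) := by
  rw [pow_succ', Equiv.Perm.mul_apply, catWalk_pow_two ha, catWalk_apply_two,
    show s - 1 - a + 1 = s - a by omega, show s + 1 - a = s - a + 1 by omega, ← mul_assoc,
    ← mul_assoc, ugen_mul_uprod_inv]

theorem catWalk_pow_period (hs : 1 ≤ s) (g : Fr (Fin (s + 2))) :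
    (catWalk s ^ (3 * s)) (g, 0, 1) = (uprod (s + 2) (s + 2) * g, 0, 1) := by
  rw [show 3 * s = s + 2 * (s - 1) + 1 + 1 by omega, pow_succ', Equiv.Perm.mul_apply,
    catWalk_pow_zero (by omega), show s - 1 - (s - 1) = 0 by omega, catWalk_apply_first,
    show s - (s - 1) = 0 + 1 by omega, ← mul_assoc, ← mul_assoc, ugen_mul_uprod_inv]
  simp [uprod]

theorem catWalk_zpow_period (hs : 1 ≤ s) (i : ℤ) (g : Fr (Fin (s + 2))) :
    (catWalk s ^ (3 * s * i : ℤ)) (g, 0, 1) = (uprod (s + 2) (s + 2) ^ i * g, 0, 1) := by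
  have h := equivariant_zpow (a := Equiv.mulLeft (uprod (s + 2) (s + 2)))
    (b := catWalk s ^ (3 * s)) (Φ := fun g => ((g, 0, 1) : Cat s))
    (fun g => (catWalk_pow_period hs g).symm) i g
  rw [← zpow_natCast, ← zpow_mul, Equiv.zpow_mulLeft] at h
  push_cast at h
  exact h.symm

theorem eq_of_catWalk_zpow (hs : 1 ≤ s) {g g' : Fr (Fin (s + 2))} {j : ℤ}
    (h : (g', 0, 1) = (catWalk s ^ j) (g, 0, 1)) :
    ∃ i : ℤ, j = (3 * s : ℕ) * i ∧ g' = uprod (s + 2) (s + 2) ^ i * g := by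
  have h3 : (0 : ℤ) < (3 * s : ℕ) := by omega
  have hj := Int.emod_add_mul_ediv j (3 * s : ℕ)
  have hj0 := Int.emod_nonneg j h3.ne'
  have hj1 := Int.emod_lt_of_pos j h3
  generalize hi : j / ((3 * s : ℕ) : ℤ) = i at hj
  generalize j % ((3 * s : ℕ) : ℤ) = a at hj hj0 hj1
  lift a to ℕ using hj0
  rw [← hj, zpow_add, Equiv.Perm.mul_apply] at h
  push_cast at h
  rw [catWalk_zpow_period hs, zpow_natCast] at h
  rcases lt_or_ge a s with ha | ha
  · rw [catWalk_pow_one ha] at h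
    simp only [Prod.mk.injEq] at h
    exact ⟨i, by rw [← hj, ← h.2.1]; simp, h.1⟩
  · exfalso
    rcases Nat.even_or_odd' (a - s) with ⟨b, hb | hb⟩
    · rw [show a = s + 2 * b by omega, catWalk_pow_two (by omega)] at h
      simp at h
    · rw [show a = s + 2 * b + 1 by omega, catWalk_pow_zero (by omega)] at h
      simp at h

theorem conjMove_cat {i : ℕ} (hi : i < s + 2) (hs : 1 ≤ s) (g : Fr (Fin (s + 2))) :
    ((conjMove (catWalk s) (catFlip s) s i)⁻¹ * catFlip s * conjMove (catWalk s) (catFlip s) s i)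
      (g, 0, 1) = (ugen (s + 2) i * g, 0, 1) := by
  rw [mul_assoc, Equiv.Perm.mul_apply, Equiv.Perm.inv_eq_iff_eq, Equiv.Perm.mul_apply]
  unfold conjMove
  split_ifs with h0 h1
  · subst h0
    simp only [pow_two, Equiv.Perm.mul_apply, catWalk_catFlip]
    simp [catFlip, catFlipFun]
  · simp only [Equiv.Perm.mul_apply, catWalk_catFlip, catWalk_pow_one (show i - 1 < s by omega)]
    have : i - 1 + 1 = i := by omega
    simp [catFlip, catFlipFun, this]
  · rw [catWalk_pow_one (by omega), catWalk_pow_one (by omega), show i = s + 1 by omega]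
    have : s - 1 + 1 = s := by omega
    simp [catFlip, catFlipFun, this]

end Development

open Edge

/-- The permutations of the directed edges of bounded displacement. -/
def boundedPerm : Subgroup (Equiv.Perm DEdge) where
  carrier := {a | ∃ N, ∀ z, Within N z (a z)}
  one_mem' := ⟨0, fun _ => rfl⟩
  mul_mem' := by
    rintro a b ⟨N, hN⟩ ⟨M, hM⟩
    exact ⟨M + N, fun z => (hM z).trans (hN (b z))⟩
  inv_mem' := by
    rintro a ⟨N, hN⟩
    refine ⟨N, fun z => ?_⟩
    have := (hN (a⁻¹ z)).symm
    rwa [← Equiv.Perm.mul_apply, mul_inv_cancel, Equiv.Perm.one_apply] at this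

theorem walk_mem_boundedPerm : walk ∈ boundedPerm := ⟨1, within_walk⟩

theorem flipEdge_mem_boundedPerm : flipEdge ∈ boundedPerm := ⟨1, within_flip⟩

theorem conjMove_mem_boundedPerm (s i : ℕ) : conjMove walk flipEdge s i ∈ boundedPerm := by
  have h := mul_mem walk_mem_boundedPerm flipEdge_mem_boundedPerm
  unfold conjMove
  split_ifs
  · exact pow_mem h _
  · exact mul_mem h (pow_mem walk_mem_boundedPerm _)
  · exact pow_mem walk_mem_boundedPerm _

/-- The free product of `m ≥ 3` copies of `ℤ/2` inside the directed edges of the tree, with the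
product of the generators acting as a power of the boundary walk. -/
structure Development (m k : ℕ) where
  /-- The inclusion. -/
  incl : Fr (Fin m) → DEdge
  /-- The projection. -/
  proj : DEdge → Fr (Fin m)
  proj_incl : ∀ g, proj (incl g) = g
  incl_mul : ∀ g, incl (uprod m m * g) = (walk ^ (k : ℤ)) (incl g)
  exists_eq : ∀ z, ∃ (g : Fr (Fin m)) (j : ℤ), z = (walk ^ j) (incl g)
  eq_of_eq : ∀ {g g' : Fr (Fin m)} {j : ℤ}, incl g' = (walk ^ j) (incl g) →
    ∃ i : ℤ, j = k * i ∧ g' = uprod m m ^ i * g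
  within : ∃ N, ∀ (i : Fin m) (g : Fr (Fin m)), Within N (incl g) (incl (fgen i * g))
  finite : ∃ T : Set (Fr (Fin m)), T.Finite ∧ ∀ z, proj (walk z) * (proj z)⁻¹ ∈ T ∧
    proj (flipEdge z) * (proj z)⁻¹ ∈ T

theorem nonempty_development {m : ℕ} (hm : 3 ≤ m) : Nonempty (Development m (3 * (m - 2))) := by
  obtain ⟨s, rfl⟩ : ∃ s, m = s + 2 := ⟨m - 2, by omega⟩
  have hs : 1 ≤ s := by omega
  rw [Nat.add_sub_cancel]
  obtain ⟨Φ, hbase, hw, hf⟩ := exists_equivariant (catWalk s) (catFlip s) (catFlip_catFlip s)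
    (fun y => by
      rw [catWalk_catFlip, catWalk_catFlip, catWalk_catFlip]
      simp only [add_assoc]
      exact Prod.ext rfl (Prod.ext rfl ((by decide : ∀ c : Fin 3, c + (1 + (1 + 1)) = c) _))) (1, 0, 1)
  let a : ℕ → Equiv.Perm DEdge := conjMove walk flipEdge s
  have ha : ∀ i z, Φ (a i z) = conjMove (catWalk s) (catFlip s) s i (Φ z) :=
    equivariant_conjMove hw hf s
  have hflip : flipEdge * flipEdge = 1 := Equiv.ext fun z => by simp
  let γ : Fr (Fin (s + 2)) →* Equiv.Perm DEdge :=
    racgLift (fun i => (a i)⁻¹ * flipEdge * a i) (fun i => by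
      rw [show (a i)⁻¹ * flipEdge * a i * ((a i)⁻¹ * flipEdge * a i) =
        (a i)⁻¹ * (flipEdge * flipEdge) * a i by group, hflip]; simp) (by simp)
  let ψ : Fr (Fin (s + 2)) → DEdge := fun g => γ g (root 0, true)
  have hψ1 : ψ 1 = (root 0, true) := by simp [ψ]
  have hψ : ∀ (i : ℕ), i < s + 2 → ∀ g, a i (ψ (ugen (s + 2) i * g)) = flipEdge (a i (ψ g)) := by
    intro i hi g
    have : γ (ugen (s + 2) i) = (a i)⁻¹ * flipEdge * a i := by
      rw [show ugen (s + 2) i = fgen (⟨i, hi⟩ : Fin (s + 2)) from dif_pos hi]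
      exact racgLift_gen _ _ _ _
    simp only [ψ, map_mul, Equiv.Perm.mul_apply, this]
    rw [← Equiv.Perm.mul_apply (a i), mul_inv_cancel, Equiv.Perm.one_apply]
  have hΦψ : ∀ g, Φ (ψ g) = (g, 0, 1) := fun g => by
    induction g using racg_induction with
    | one => rw [hψ1, hbase]
    | mul i g ih =>
      have h1 := congrArg Φ (hψ i i.is_lt g)
      rw [ha, hf, ha, ih, ← Equiv.Perm.mul_apply (catFlip s), ← Equiv.Perm.eq_inv_iff_eq,
        ← Equiv.Perm.mul_apply, ← mul_assoc, conjMove_cat i.is_lt hs, ugen_coe] at h1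
      exact h1
  -- the inverse of `Φ`
  let q : DEdge → DEdge := fun z => walk (flipEdge z)
  have hq : ∀ z, q (q (q z)) = z := walk_flip_cube
  let Ψ : Cat s → DEdge := fun y => q^[(y.2.2 : ℕ) + 2] ((walk ^ y.2.1) (ψ y.1))
  have hΨ0 : ∀ g v, Ψ (g, v, 0) = q (q ((walk ^ v) (ψ g))) := fun g v => rfl
  have hΨ1 : ∀ g v, Ψ (g, v, 1) = (walk ^ v) (ψ g) := fun g v => hq _
  have hΨ2 : ∀ g v, Ψ (g, v, 2) = q ((walk ^ v) (ψ g)) := fun g v => hq _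
  have hΨq : ∀ y, Ψ (y.1, y.2.1, y.2.2 + 1) = q (Ψ y) := by
    rintro ⟨g, v, c⟩
    fin_cases c
    · change Ψ (g, v, 1) = q (Ψ (g, v, 0)); rw [hΨ0, hΨ1, hq]
    · change Ψ (g, v, 2) = q (Ψ (g, v, 1)); rw [hΨ1, hΨ2]
    · change Ψ (g, v, 0) = q (Ψ (g, v, 2)); rw [hΨ2, hΨ0]
  have hqf : ∀ z, q (flipEdge z) = walk z := fun z => by simp [q]
  have hΨr : ∀ y : Cat s, y.2.1 < s → Ψ (catFlip s y) = flipEdge (Ψ y) ∧ (catFlip s y).2.1 < s := by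
    rintro ⟨g, v, c⟩ hv
    simp only at hv
    fin_cases c
    · change Ψ (catFlip s (g, v, 0)) = flipEdge (Ψ (g, v, 0)) ∧ (catFlip s (g, v, 0)).2.1 < s
      rcases v with _ | v
      · have h1 := hψ 0 (by omega) g
        have h2 : ∀ z, a 0 z = q (q z) := fun z => by simp [a, conjMove, pow_two, q]
        rw [show catFlip s (g, 0, 0) = (ugen (s + 2) 0 * g, 0, 0) by simp [catFlip, catFlipFun],
          hΨ0, hΨ0]
        rw [h2, h2] at h1
        exact ⟨h1, hv⟩
      · rw [show catFlip s (g, v + 1, 0) = (g, v, 1) by simp [catFlip, catFlipFun, hv], hΨ0, hΨ1]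
        refine ⟨?_, by simp only; omega⟩
        rw [pow_succ', Equiv.Perm.mul_apply, ← hqf, hq, flipEdge_flipEdge]
    · change Ψ (catFlip s (g, v, 1)) = flipEdge (Ψ (g, v, 1)) ∧ (catFlip s (g, v, 1)).2.1 < s
      by_cases h : v + 1 < s
      · rw [show catFlip s (g, v, 1) = (g, v + 1, 0) by simp [catFlip, catFlipFun, h], hΨ0, hΨ1]
        refine ⟨?_, h⟩
        rw [pow_succ', Equiv.Perm.mul_apply, ← hqf, hq]
      · obtain rfl : s = v + 1 := by omega
        have h1 := hψ (v + 1 + 1) (by omega) g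
        have h2 : a (v + 1 + 1) = walk ^ v := by simp [a, conjMove]
        rw [h2] at h1
        rw [show catFlip (v + 1) (g, v, 1) = (ugen (v + 1 + 2) (v + 1 + 1) * g, v, 1) by
          simp [catFlip, catFlipFun], hΨ1, hΨ1]
        exact ⟨h1, hv⟩
    · change Ψ (catFlip s (g, v, 2)) = flipEdge (Ψ (g, v, 2)) ∧ (catFlip s (g, v, 2)).2.1 < s
      have h1 := hψ (v + 1) (by omega) g
      have h2 : ∀ z, a (v + 1) z = q ((walk ^ v) z) := fun z => by
        have : v + 1 ≤ s := hv
        simp [a, conjMove, this, q]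
      rw [h2, h2] at h1
      rw [show catFlip s (g, v, 2) = (ugen (s + 2) (v + 1) * g, v, 2) by
        simp [catFlip, catFlipFun], hΨ2, hΨ2]
      exact ⟨h1, hv⟩
  have hinvol : ∀ z, Ψ (Φ z) = z ∧ (Φ z).2.1 < s := by
    have hF : ∀ z, (Ψ (Φ z) = z ∧ (Φ z).2.1 < s) →
        (Ψ (Φ (flipEdge z)) = flipEdge z ∧ (Φ (flipEdge z)).2.1 < s) := fun z h => by
      rw [hf, (hΨr _ h.2).1, h.1]
      exact ⟨rfl, (hΨr _ h.2).2⟩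
    have hQ : ∀ z, (Ψ (Φ z) = z ∧ (Φ z).2.1 < s) →
        (Ψ (Φ (q z)) = q z ∧ (Φ (q z)).2.1 < s) := fun z h => by
      have : Φ (q z) = ((Φ z).1, (Φ z).2.1, (Φ z).2.2 + 1) := by
        rw [hw, hf, catWalk_catFlip]
      rw [this, hΨq, h.1]
      exact ⟨rfl, h.2⟩
    refine dEdge_induction ?_ ?_ ?_ hF
    · rw [hbase, hΨ1, hψ1]; exact ⟨rfl, hs⟩
    · intro z h
      rw [← hqf]
      exact hQ _ (hF _ h)
    · intro z h
      have : walk⁻¹ z = flipEdge (q (q z)) := by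
        rw [Equiv.Perm.inv_eq_iff_eq]; exact (hq z).symm
      rw [this]
      exact hF _ (hQ _ (hQ _ h))
  have hinj : Function.Injective Φ :=
    Function.LeftInverse.injective (g := Ψ) fun z => (hinvol z).1
  have hcov : ∀ z, ∃ (g : Fr (Fin (s + 2))) (j : ℤ), z = (walk ^ j) (ψ g) := fun z => by
    suffices h : ∃ (g : Fr (Fin (s + 2))) (j : ℕ), Φ z = (catWalk s ^ j) (g, 0, 1) by
      obtain ⟨g, j, h⟩ := h
      refine ⟨g, j, hinj ?_⟩
      rw [h, equivariant_zpow hw, hΦψ, zpow_natCast]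
    have hv := (hinvol z).2
    generalize Φ z = y at hv ⊢
    obtain ⟨g, v, c⟩ := y
    simp only at hv
    fin_cases c
    · refine ⟨((uprod (s + 2) (v + 1))⁻¹ * uprod (s + 2) (s + 2))⁻¹ * g,
        s + 2 * (s - 1 - v) + 1, ?_⟩
      rw [catWalk_pow_zero (by omega), show s - (s - 1 - v) = v + 1 by omega, mul_inv_cancel_left,
        show s - 1 - (s - 1 - v) = v by omega]
      rfl
    · exact ⟨g, v, (catWalk_pow_one hv g).symm⟩
    · refine ⟨((uprod (s + 2) (v + 2))⁻¹ * uprod (s + 2) (s + 2))⁻¹ * g,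
        s + 2 * (s - 1 - v), ?_⟩
      rw [catWalk_pow_two (by omega), show s + 1 - (s - 1 - v) = v + 2 by omega,
        mul_inv_cancel_left, show s - 1 - (s - 1 - v) = v by omega]
      rfl
  refine ⟨⟨ψ, fun z => (Φ z).1, fun g => by rw [hΦψ], fun g => hinj ?_, hcov, fun {g g' j} h => ?_,
    ?_, ?_⟩⟩
  · rw [equivariant_zpow hw, hΦψ, hΦψ, zpow_natCast, catWalk_pow_period hs]
  · have h1 := congrArg Φ h
    rw [equivariant_zpow hw, hΦψ, hΦψ] at h1
    exact eq_of_catWalk_zpow hs h1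
  · have : ∀ i : Fin (s + 2), ∃ N, ∀ z, Within N z (γ (fgen i) z) := fun i => by
      have h1 := conjMove_mem_boundedPerm s i
      have h2 : (a i)⁻¹ * flipEdge * a i ∈ boundedPerm :=
        mul_mem (mul_mem (inv_mem h1) flipEdge_mem_boundedPerm) h1
      simp only [γ, racgLift_gen]
      exact h2
    choose N hN using this
    refine ⟨∑ i, N i, fun i g => ?_⟩
    have := hN i (ψ g)
    rw [← Equiv.Perm.mul_apply, ← map_mul] at this
    exact this.mono (Finset.single_le_sum (f := N) (fun _ _ => Nat.zero_le _) (Finset.mem_univ i))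
  · have hfst : ∀ y : Cat s, (catFlip s y).1 * y.1⁻¹ ∈ insert 1 (Set.range fgen) := by
      have hu : ∀ (i : ℕ) (g : Fr (Fin (s + 2))),
          ugen (s + 2) i * g * g⁻¹ ∈ insert 1 (Set.range fgen) := fun i g => by
        rw [mul_inv_cancel_right]
        unfold ugen
        split_ifs with h
        · exact Or.inr ⟨_, rfl⟩
        · exact Or.inl rfl
      have h1 : ∀ g : Fr (Fin (s + 2)), g * g⁻¹ ∈ insert 1 (Set.range fgen) := fun g =>
        Or.inl (mul_inv_cancel g)
      rintro ⟨g, v, c⟩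
      fin_cases c <;> simp only [catFlip, Equiv.coe_fn_mk, catFlipFun]
      · by_cases h : v = 0
        · subst h; exact hu 0 g
        · by_cases h' : v < s <;> simp [h, h']
      · by_cases h : v + 1 < s
        · simp [h]
        · by_cases h' : v + 1 = s
          · simpa [catFlipFun, h'] using hu (s + 1) g
          · simp [h, h']
      · exact hu (v + 1) g
    refine ⟨insert 1 (Set.range fgen), (Set.finite_range _).insert _, fun z => ⟨?_, ?_⟩⟩
    · rw [hw]
      exact hfst (Φ z)
    · rw [hf]
      exact hfst (Φ z)

open Edge
open scoped Pointwise

theorem Development.finite_of_within {m k : ℕ} (D : Development m k) (M : ℕ) :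
    ∃ T : Set (Fr (Fin m)), T.Finite ∧
      ∀ z z', Within M z z' → D.proj z' * (D.proj z)⁻¹ ∈ T := by
  obtain ⟨T, hT, h⟩ := D.finite
  induction M with
  | zero => exact ⟨{1}, Set.finite_singleton _, fun z z' h => by cases h; simp⟩
  | succ M ih =>
    obtain ⟨T', hT', h'⟩ := ih
    refine ⟨(insert 1 (T ∪ T⁻¹)) * T', ((hT.union hT.inv).insert 1).mul hT', ?_⟩
    rintro z z' ⟨y, hy, hz⟩
    rw [← inv_mul_cancel_right (D.proj z') (D.proj y), mul_assoc]
    refine Set.mul_mem_mul ?_ (h' _ _ hy)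
    rcases hz with rfl | rfl | rfl | rfl
    · exact Or.inl (mul_inv_cancel _)
    · exact Or.inr (Or.inl (h _).1)
    · refine Or.inr (Or.inr ?_)
      rw [Set.mem_inv, mul_inv_rev, inv_inv]
      exact (h _).1
    · exact Or.inr (Or.inl (h _).2)

section Quotient

variable {k : ℕ}

theorem zpow_selfMap_reduce (hk : 2 ≤ k) (j : ℤ) (s : DEdge) :
    (walk ^ j) (selfMap k s) = (walk ^ (j % k)) (selfMap k ((walk ^ (j / k)) s)) := by
  rw [selfMap_zpow hk, zpow_zpow_apply, Int.emod_add_mul_ediv]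

theorem zpow_selfMap_unique (hk : 2 ≤ k) {j j' : ℤ} (hj : 0 ≤ j ∧ j < k) (hj' : 0 ≤ j' ∧ j' < k)
    {s s' : DEdge} (h : (walk ^ j) (selfMap k s) = (walk ^ j') (selfMap k s')) : s = s' := by
  have h1 : selfMap k s = (walk ^ (-j + j')) (selfMap k s') := by
    rw [← zpow_zpow_apply, ← h, zpow_zpow_apply]; simp
  obtain ⟨i, hi, rfl⟩ := eq_of_selfMap_eq hk h1
  have : i = 0 := by
    have h2 : (k : ℤ) * i < k * 1 := by omega
    have h3 : (k : ℤ) * (-1) < k * i := by omega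
    have := lt_of_mul_lt_mul_left h2 (by omega)
    have := lt_of_mul_lt_mul_left h3 (by omega)
    omega
  simp [this]

/-- The self-map has a coarsely Lipschitz section modulo the boundary walk. -/
theorem exists_section (hk : 2 ≤ k) : ∃ (G : DEdge → DEdge) (N : ℕ),
    (∀ z, ∃ j : ℤ, (0 ≤ j ∧ j < k) ∧ z = (walk ^ j) (selfMap k (G z))) ∧
    ∀ M z z', Within M z z' → Within (N * M) (G z) (G z') := by
  obtain ⟨N, hN⟩ := exists_preimage_pair hk
  have hk0 : (0 : ℤ) < k := by omega
  have hmod : ∀ j : ℤ, 0 ≤ j % k ∧ j % k < k := fun j =>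
    ⟨Int.emod_nonneg _ hk0.ne', Int.emod_lt_of_pos _ hk0⟩
  have hex : ∀ z, ∃ s, ∃ j : ℤ, (0 ≤ j ∧ j < k) ∧ z = (walk ^ j) (selfMap k s) := fun z => by
    obtain ⟨s, -, j, -, -, -, h, -⟩ := hN z
    exact ⟨_, _, hmod j, h.trans (zpow_selfMap_reduce hk j s)⟩
  choose G hG using hex
  have hu : ∀ {z s} {j : ℤ}, (0 ≤ j ∧ j < k) → z = (walk ^ j) (selfMap k s) → G z = s := by
    intro z s j hj h
    obtain ⟨j', hj', h'⟩ := hG z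
    exact zpow_selfMap_unique hk hj' hj (h'.symm.trans h)
  have hu' : ∀ {z s} {j : ℤ}, |j| ≤ N → z = (walk ^ j) (selfMap k s) → Within N s (G z) := by
    intro z s j hj h
    rw [hu (hmod j) (h.trans (zpow_selfMap_reduce hk j s))]
    refine within_walk_zpow ?_ s
    have h1 := Int.emod_add_mul_ediv j k
    have h2 := hmod j
    rw [abs_le] at hj ⊢
    constructor
    · rw [Int.le_ediv_iff_mul_le hk0]; nlinarith
    · refine Int.ediv_le_of_le_mul hk0 ?_
      nlinarith
  refine ⟨G, N + N + N + 1, hG, fun M z z' h => within_map ?_ ?_ h⟩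
  · intro z
    obtain ⟨j, hj, h⟩ := hG z
    have h1 : walk z = (walk ^ (1 + j)) (selfMap k (G z)) := by
      rw [zpow_one_add, Equiv.Perm.mul_apply, ← h]
    rcases lt_or_ge (1 + j) k with hlt | hge
    · rw [hu (by omega) h1]
      exact Within.mono (N := 0) rfl (Nat.zero_le _)
    · have h2 : walk z = (walk ^ (0 : ℤ)) (selfMap k (walk (G z))) := by
        rw [h1, selfMap_walk hk, zpow_zpow_apply, show 1 + j = 0 + k by omega]
      rw [hu (by omega) h2]
      exact (within_walk _).mono (by omega)
  · intro z
    obtain ⟨s, s', j, j', hj, hj', h, h', hs⟩ := hN z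
    exact (((hu' hj h).symm.trans hs).trans (hu' hj' h')).mono (by omega)

end Quotient

/-- The directed edges of the tree are in bijection with the free product of `m` copies of `ℤ/2`
in such a way that the boundary walk corresponds to the product of the generators. -/
theorem exists_equiv_free {m : ℕ} (hm : 3 ≤ m) : ∃ F : DEdge ≃ Fr (Fin m),
    (∀ s, F (walk s) = uprod m m * F s) ∧
    (∀ M, ∃ T : Set (Fr (Fin m)), T.Finite ∧ ∀ s s', Within M s s' → F s' * (F s)⁻¹ ∈ T) ∧
    ∃ N, ∀ (i : Fin m) g, Within N (F.symm g) (F.symm (fgen i * g)) := by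
  obtain ⟨D⟩ := nonempty_development hm
  generalize hkm : 3 * (m - 2) = k at D
  have hk : 2 ≤ k := by omega
  have hk0 : (0 : ℤ) < k := by omega
  obtain ⟨G, N, hG, hGN⟩ := exists_section hk
  have hpow : ∀ (i : ℤ) g, D.incl (uprod m m ^ i * g) = (walk ^ (k * i : ℤ)) (D.incl g) :=
    fun i g => by
      have := equivariant_zpow (a := Equiv.mulLeft (uprod m m)) (b := walk ^ (k : ℤ)) (Φ := D.incl)
        D.incl_mul i g
      rwa [← zpow_mul, Equiv.zpow_mulLeft] at this
  have hex : ∀ s, ∃ g, ∃ j : ℤ, (0 ≤ j ∧ j < k) ∧ D.incl g = (walk ^ j) (selfMap k s) := fun s => by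
    obtain ⟨g, j, h⟩ := D.exists_eq (selfMap k s)
    refine ⟨uprod m m ^ (-(-j / k)) * g, -j % k,
      ⟨Int.emod_nonneg _ hk0.ne', Int.emod_lt_of_pos _ hk0⟩, ?_⟩
    have h1 : D.incl g = (walk ^ (-j)) (selfMap k s) := by rw [h, zpow_zpow_apply]; simp
    rw [hpow, h1, zpow_zpow_apply]
    congr 2
    have := Int.emod_add_mul_ediv (-j) k
    linarith
  choose F hF using hex
  have huniq : ∀ {s g} {j : ℤ}, (0 ≤ j ∧ j < k) → D.incl g = (walk ^ j) (selfMap k s) →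
      F s = g := by
    intro s g j hj h
    obtain ⟨j', hj', h'⟩ := hF s
    have h1 : D.incl (F s) = (walk ^ (j' - j)) (D.incl g) := by
      rw [h, h', zpow_zpow_apply]; simp
    obtain ⟨i, hi, h2⟩ := D.eq_of_eq h1
    have : i = 0 := by
      have h2 : (k : ℤ) * i < k * 1 := by omega
      have h3 : (k : ℤ) * (-1) < k * i := by omega
      have := lt_of_mul_lt_mul_left h2 (by omega)
      have := lt_of_mul_lt_mul_left h3 (by omega)
      omega
    rw [h2, this]; simp
  have hleft : ∀ s, G (D.incl (F s)) = s := fun s => by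
    obtain ⟨j, hj, h⟩ := hF s
    obtain ⟨j', hj', h'⟩ := hG (D.incl (F s))
    exact zpow_selfMap_unique hk hj' hj (h'.symm.trans h)
  have hright : ∀ g, F (G (D.incl g)) = g := fun g => by
    obtain ⟨j', hj', h'⟩ := hG (D.incl g)
    exact huniq hj' h'
  refine ⟨⟨F, fun g => G (D.incl g), hleft, hright⟩, fun s => ?_, fun M => ?_, ?_⟩
  · obtain ⟨j, hj, h⟩ := hF s
    refine huniq hj ?_
    rw [D.incl_mul]
    change (walk ^ (k : ℤ)) (D.incl (F s)) = _
    rw [h, selfMap_walk hk, zpow_zpow_apply, zpow_zpow_apply, add_comm]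
  · obtain ⟨T, hT, h⟩ := D.finite_of_within
      (k + (2 * (k * k + 8 * k + 9) + 8 * k) * M + k)
    refine ⟨T, hT, fun s s' hs => ?_⟩
    change F s' * (F s)⁻¹ ∈ T
    rw [← D.proj_incl (F s'), ← D.proj_incl (F s)]
    refine h _ _ ?_
    obtain ⟨j, hj, e⟩ := hF s
    obtain ⟨j', hj', e'⟩ := hF s'
    rw [e, e']
    refine ((within_walk_zpow (abs_le.mpr ?_) _).symm.trans (within_map ?_ ?_ hs)).trans
      (within_walk_zpow (abs_le.mpr ?_) _)
    · omega
    · intro z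
      rw [selfMap_walk hk]
      refine (within_walk_zpow (N := k) (by simp) _).mono ?_
      nlinarith
    · exact within_selfMap_flip hk
    · omega
  · obtain ⟨M, hM⟩ := D.within
    exact ⟨N * M, fun i g => hGN _ _ _ (hM i g)⟩

theorem exists_equiv_free_free {m m' : ℕ} (hm : 3 ≤ m) (hm' : 3 ≤ m') :
    ∃ F : Fr (Fin m) ≃ Fr (Fin m'), F 1 = 1 ∧ (∀ g, F (uprod m m * g) = uprod m' m' * F g) ∧
      Ctl F ∧ Ctl F.symm := by
  suffices h : ∃ F : Fr (Fin m) ≃ Fr (Fin m'),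
      (∀ g, F (uprod m m * g) = uprod m' m' * F g) ∧ Ctl F ∧ Ctl F.symm by
    obtain ⟨F, hF, h1, h2⟩ := h
    refine ⟨F.trans (Equiv.mulRight (F 1)⁻¹), by simp, fun g => ?_, fun a => ?_, fun a => ?_⟩
    · simp [hF, mul_assoc]
    · simpa using h1 a
    · refine (h2 a).subset ?_
      rintro _ ⟨x, rfl⟩
      exact ⟨x * F 1, by simp [mul_assoc]⟩
  obtain ⟨F, hFw, hF, N, hN⟩ := exists_equiv_free hm
  obtain ⟨F', hFw', hF', N', hN'⟩ := exists_equiv_free hm'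
  refine ⟨F.symm.trans F', fun g => ?_, ctl_of_gen fun i => ?_, ctl_of_gen fun i => ?_⟩
  · have : F.symm (uprod m m * g) = walk (F.symm g) := by
      rw [Equiv.symm_apply_eq, hFw, Equiv.apply_symm_apply]
    simp [this, hFw']
  · obtain ⟨T, hT, h⟩ := hF' N
    refine hT.subset ?_
    rintro _ ⟨g, rfl⟩
    exact h _ _ (hN i g)
  · obtain ⟨T, hT, h⟩ := hF N'
    refine hT.subset ?_
    rintro _ ⟨g, rfl⟩
    exact h _ _ (hN' i g)

section PathSplit

variable {m m' : ℕ}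

/-- The inclusion of the even subgroup of the group of a path. -/
noncomputable def evenHom (m : ℕ) : Fr (Fin m) →* PathGroup m :=
  racgLift (fun i => pgen m i * pgen m (i + 1)) (fun i => by
    nth_rewrite 2 [pgen_comm]
    rw [mul_assoc, ← mul_assoc (pgen m (i + 1)), pgen_mul_self, one_mul, pgen_mul_self])
    (by simp)

theorem evenHom_ugen {i : ℕ} (hi : i < m) : evenHom m (ugen m i) = pgen m i * pgen m (i + 1) := by
  rw [ugen, dif_pos hi]; exact racgLift_gen _ _ _ _

theorem evenHom_uprod {i : ℕ} (hi : i ≤ m) : evenHom m (uprod m i) = pgen m 0 * pgen m i := by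
  induction i with
  | zero => rw [uprod, map_one, pgen_mul_self]
  | succ i ih =>
    rw [uprod, map_mul, ih (by omega), evenHom_ugen hi, mul_assoc, ← mul_assoc (pgen m i),
      pgen_mul_self, one_mul]

theorem pgen_mul_pgen_mul (m j : ℕ) (g : PathGroup m) : pgen m j * (pgen m j * g) = g := by
  rw [← mul_assoc, pgen_mul_self, one_mul]

/-- The action of the generators of the group of a path on its decomposition into cosets of the
even subgroup. -/
noncomputable def pathMove (m i : ℕ) (y : Fr (Fin m) × Bool) : Fr (Fin m) × Bool :=
  (if y.2 then (uprod m i)⁻¹ * y.1 else uprod m i * y.1, !y.2)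

theorem pathMove_pathMove (i : ℕ) (y : Fr (Fin m) × Bool) :
    pathMove m i (pathMove m i y) = y := by
  obtain ⟨u, _ | _⟩ := y <;> simp [pathMove]

theorem pathMove_comm (i : ℕ) (y : Fr (Fin m) × Bool) :
    pathMove m i (pathMove m (i + 1) y) = pathMove m (i + 1) (pathMove m i y) := by
  obtain ⟨u, _ | _⟩ := y <;> simp [pathMove, uprod, ugen_inv, mul_assoc]

/-- The action of the group of a path on its decomposition into cosets of the even subgroup. -/
noncomputable def pathAct (m : ℕ) : PathGroup m →* Equiv.Perm (Fr (Fin m) × Bool) :=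
  racgLift (fun i => ⟨pathMove m i, pathMove m i, pathMove_pathMove _, pathMove_pathMove _⟩)
    (fun i => Equiv.ext fun y => pathMove_pathMove _ y) (fun i j h => Equiv.ext fun y => by
      simp only [Equiv.Perm.mul_apply, Equiv.coe_fn_mk]
      rcases h with h | h
      · rw [← h]; exact pathMove_comm _ y
      · rw [← h]; exact (pathMove_comm _ y).symm)

theorem pathAct_pgen {i : ℕ} (hi : i < m + 1) (y : Fr (Fin m) × Bool) :
    pathAct m (pgen m i) y = pathMove m i y := by
  rw [pgen, dif_pos hi, pathAct, racgLift_gen]; rfl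

/-- The element of the group of a path with given even part and parity. -/
noncomputable def pathEval (m : ℕ) (y : Fr (Fin m) × Bool) : PathGroup m :=
  if y.2 then pgen m 0 * evenHom m y.1 else evenHom m y.1

theorem pathEval_pathMove {i : ℕ} (hi : i < m + 1) (y : Fr (Fin m) × Bool) :
    pathEval m (pathMove m i y) = pgen m i * pathEval m y := by
  have hinv : ∀ j, (pgen m j)⁻¹ = pgen m j := fun j =>
    inv_eq_of_mul_eq_one_left (pgen_mul_self m j)
  obtain ⟨u, _ | _⟩ := y
  · simp [pathEval, pathMove, evenHom_uprod (show i ≤ m by omega), mul_assoc, pgen_mul_pgen_mul]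
  · simp [pathEval, pathMove, evenHom_uprod (show i ≤ m by omega), mul_assoc, hinv]

theorem pathEval_pathAct (g : PathGroup m) (y : Fr (Fin m) × Bool) :
    pathEval m (pathAct m g y) = g * pathEval m y := by
  induction g using racg_induction with
  | one => simp
  | mul i g ih =>
    rw [map_mul, Equiv.Perm.mul_apply, ← pgen_coe, pathAct_pgen i.is_lt, pathEval_pathMove i.is_lt,
      ih, mul_assoc]

theorem pathAct_evenHom (u v : Fr (Fin m)) : pathAct m (evenHom m u) (v, false) =
    (u * v, false) := by
  induction u using racg_induction with
  | one => simp
  | mul i u ih =>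
    rw [map_mul, map_mul, Equiv.Perm.mul_apply, ih, show gen _ i = ugen m i from (ugen_coe i).symm, evenHom_ugen i.is_lt, map_mul,
      Equiv.Perm.mul_apply, pathAct_pgen (by omega), pathAct_pgen (by omega)]
    simp [pathMove, uprod, mul_assoc]

/-- The decomposition of the group of a path into cosets of the even subgroup. -/
noncomputable def pathSplit (m : ℕ) : PathGroup m ≃ Fr (Fin m) × Bool where
  toFun g := pathAct m g (1, false)
  invFun := pathEval m
  left_inv g := by rw [pathEval_pathAct]; simp [pathEval]
  right_inv y := by
    obtain ⟨u, _ | _⟩ := y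
    · simp [pathEval, pathAct_evenHom]
    · simp [pathEval, pathAct_evenHom, pathAct_pgen, pathMove, uprod]

theorem pathSplit_pgen_mul {i : ℕ} (hi : i < m + 1) (g : PathGroup m) :
    pathSplit m (pgen m i * g) = pathMove m i (pathSplit m g) := by
  change pathAct m (pgen m i * g) _ = pathMove m i (pathAct m g _)
  rw [map_mul, Equiv.Perm.mul_apply, pathAct_pgen hi]

/-- The bijection between groups of paths induced by a bijection between even subgroups. -/
noncomputable def pathEquiv (F : Fr (Fin m) ≃ Fr (Fin m')) : PathGroup m ≃ PathGroup m' :=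
  ((pathSplit m).trans (F.prodCongr (Equiv.refl Bool))).trans (pathSplit m').symm

theorem ctl_pathEquiv {F : Fr (Fin m) ≃ Fr (Fin m')} (hF : Ctl F) : Ctl (pathEquiv F) := by
  refine ctl_of_gen fun i => ?_
  have h1 := (hF (uprod m i)).image fun t => pgen m' 0 * evenHom m' t
  have h2 := (hF (uprod m i)⁻¹).image fun t => evenHom m' t * (pgen m' 0)⁻¹
  refine (h1.union h2).subset ?_
  rintro _ ⟨g, rfl⟩
  change pathEval m' _ * (pathEval m' _)⁻¹ ∈ _
  simp only [Equiv.trans_apply]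
  rw [← pgen_coe, pathSplit_pgen_mul i.is_lt]
  obtain ⟨u, _ | _⟩ := pathSplit m g
  · refine Or.inl ⟨_, ⟨u, rfl⟩, ?_⟩
    simp [pathMove, pathEval, mul_assoc]
  · refine Or.inr ⟨_, ⟨u, rfl⟩, ?_⟩
    simp [pathMove, pathEval, mul_assoc]

theorem pathEquiv_dihToPath_mul {F : Fr (Fin m) ≃ Fr (Fin m')}
    (hF : ∀ g, F (uprod m m * g) = uprod m' m' * F g) (x : Dih) (g : PathGroup m) :
    pathEquiv F (dihToPath m x * g) = dihToPath m' x * pathEquiv F g := by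
  have hF' : ∀ g, F ((uprod m m)⁻¹ * g) = (uprod m' m')⁻¹ * F g := fun g => by
    rw [eq_inv_mul_iff_mul_eq, ← hF, mul_inv_cancel_left]
  induction x using racg_induction with
  | one => simp
  | mul e x ih =>
    rw [map_mul (dihToPath m), map_mul (dihToPath m'), mul_assoc, mul_assoc, ← ih]
    generalize dihToPath m x * g = y
    rw [dihToPath_gen, dihToPath_gen]
    change pathEval m' _ = _ * pathEval m' _
    simp only [Equiv.trans_apply]
    cases e
    · rw [if_neg (by simp), if_neg (by simp), pathSplit_pgen_mul (by omega),
        ← pathEval_pathMove (by omega)]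
      obtain ⟨u, _ | _⟩ := pathSplit m y <;> simp [pathMove, hF, hF']
    · rw [if_pos rfl, if_pos rfl, pathSplit_pgen_mul (by omega), ← pathEval_pathMove (by omega)]
      obtain ⟨u, _ | _⟩ := pathSplit m y <;> simp [pathMove, uprod]

end PathSplit

theorem exists_equiv_path {m m' : ℕ} (hm : 3 ≤ m) (hm' : 3 ≤ m') :
    ∃ F : PathGroup m ≃ PathGroup m', F 1 = 1 ∧
      (∀ x g, F (dihToPath m x * g) = dihToPath m' x * F g) ∧ Ctl F ∧ Ctl F.symm := by
  obtain ⟨F, h1, hF, hC, hC'⟩ := exists_equiv_free_free hm hm'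
  refine ⟨pathEquiv F, ?_, pathEquiv_dihToPath_mul hF, ctl_pathEquiv hC, ctl_pathEquiv hC'⟩
  simp [pathEquiv, pathSplit, pathEval, h1]

/-- Reindexing a free product of copies of `ℤ/2`. -/
def frCongr {ι ι' : Type} (e : ι ≃ ι') : Fr ι ≃* Fr ι' :=
  MonoidHom.toMulEquiv
    (racgLift (fun i => fgen (e i)) (fun _ => gen_mul_self _) (by simp))
    (racgLift (fun i => fgen (e.symm i)) (fun _ => gen_mul_self _) (by simp))
    (racg_hom_ext fun i => by simp) (racg_hom_ext fun i => by simp)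

theorem exists_equiv_fr {ι ι' : Type} [Finite ι] [Finite ι']
    (h : Nat.card ι = Nat.card ι' ∨ 3 ≤ Nat.card ι ∧ 3 ≤ Nat.card ι') :
    ∃ F : Fr ι ≃ Fr ι', F 1 = 1 ∧ Ctl F ∧ Ctl F.symm := by
  rcases h with h | ⟨h, h'⟩
  · have E := frCongr ((Finite.card_eq.1 h).some)
    exact ⟨E.toEquiv, map_one E, ctl_of_hom E.toMonoidHom, ctl_of_hom E.symm.toMonoidHom⟩
  · obtain ⟨F, h1, -, hF, hF'⟩ := exists_equiv_free_free h h'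
    let E := frCongr (Finite.equivFin ι)
    let E' := frCongr (Finite.equivFin ι')
    refine ⟨(E.toEquiv.trans F).trans E'.symm.toEquiv, ?_, ?_, ?_⟩
    · simp [h1]
    · exact (ctl_of_hom E'.symm.toMonoidHom).comp (hF.comp (ctl_of_hom E.toMonoidHom))
    · exact (ctl_of_hom E.symm.toMonoidHom).comp (hF'.comp (ctl_of_hom E'.toMonoidHom))

theorem commute_amH_amA {H A κ : Type} {B : κ → Type} [Group H] [Group A]
    [∀ j, Group (B j)] (β : ∀ j, H →* B j) (x : H) (a : A) : Commute (amH β x) (amA β a) :=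
  (amA_comm β a x).symm

/-- An amalgam with no further factors is a direct product. -/
noncomputable def amalgEmpty {H A κ : Type} {B : κ → Type} [Group H] [Group A] [IsEmpty κ]
    [∀ j, Group (B j)] (β : ∀ j, H →* B j) : Amalg A β ≃* H × A :=
  MonoidHom.toMulEquiv
    (amLift β (MonoidHom.inl H A) (MonoidHom.inr H A) (fun j => isEmptyElim j)
      MonoidHom.commute_inl_inr (fun j => isEmptyElim j))
    (MonoidHom.noncommCoprod (amH β) (amA β) (commute_amH_amA β))
    (amalg_hom_ext β
      (fun x => by rw [MonoidHom.comp_apply, amLift_amH, MonoidHom.noncommCoprod_apply]; simp)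
      (fun x => by rw [MonoidHom.comp_apply, amLift_amA, MonoidHom.noncommCoprod_apply]; simp)
      fun j => isEmptyElim j)
    (MonoidHom.ext fun x => by
      rw [MonoidHom.comp_apply, MonoidHom.noncommCoprod_apply, map_mul, amLift_amH, amLift_amA]
      simp)

section Classification

variable {k k' : ℕ} {n : Fin k → ℕ} {n' : Fin k' → ℕ}

theorem card_linear (n : Fin k → ℕ) : Nat.card {i // n i = 1} = linearDegree n := by
  rw [Nat.card_eq_fintype_card, Fintype.card_subtype]
  rfl

theorem card_hyperbolic (n : Fin k → ℕ) : Nat.card {i // n i ≠ 1} = k - linearDegree n := by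
  rw [Nat.card_eq_fintype_card, ← card_linear, Nat.card_eq_fintype_card]
  simp

theorem coarseEquiv_theta_small (δ : Type) [Finite δ] (hn : ∀ i, 1 ≤ n i)
    (hh : 1 ≤ k - linearDegree n)
    (h : linearDegree n = 2 ∧ IsEmpty δ ∨ 3 ≤ linearDegree n ∧ Nonempty δ) :
    CoarseEquiv (ThetaRACG n) (SmallGroup δ (dihToPath 3)) := by
  obtain ⟨FA, hA, hAC, hAC'⟩ := exists_equiv_fr (ι := {i // n i = 1})
    (ι' := Bool ⊕ δ × Fin (k - linearDegree n)) (by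
      rw [card_linear, Nat.card_sum, Nat.card_prod]
      rcases h with ⟨h, _⟩ | ⟨h, _⟩
      · left; simp [h]
      · right
        have : 0 < Nat.card δ := Nat.card_pos
        simp only [Nat.card_eq_fintype_card, Fintype.card_bool, Fintype.card_fin] at this ⊢
        exact ⟨h, by nlinarith⟩)
  have hj (j : {i // n i ≠ 1}) : 3 ≤ n j + 1 := by have := hn j; have := j.2; omega
  choose FB hB1 hB hBC hBC' using fun j => exists_equiv_path (hj j) (le_refl 3)
  refine (coarseEquiv_of_mulEquiv (thetaEquivAmalg n hn)).trans ((coarseEquiv_amalg _ _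
    (fun j => dihToPath_injective (by have := hj j; omega))
    (fun j => dihToPath_injective (by omega)) FA hA hAC hAC' FB hB1 hB hBC hBC').trans
      (coarseEquiv_small_big (dihToPath 3) ?_ hh).symm)
  exact Finite.equivFinOfCardEq (card_hyperbolic n)

theorem coarseEquiv_theta_prod (hn : ∀ i, 1 ≤ n i) (hh : k - linearDegree n = 0) :
    CoarseEquiv (ThetaRACG n) (Dih × Fr {i // n i = 1}) := by
  have : IsEmpty {i // n i ≠ 1} := by
    rw [← Finite.card_eq_zero_iff, card_hyperbolic, hh]
  exact (coarseEquiv_of_mulEquiv (thetaEquivAmalg n hn)).trans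
    (coarseEquiv_of_mulEquiv (amalgEmpty _))

theorem coarseEquiv_prod_fr (h : 3 ≤ linearDegree n) (h' : 3 ≤ linearDegree n') :
    CoarseEquiv (Dih × Fr {i // n i = 1}) (Dih × Fr {i // n' i = 1}) := by
  obtain ⟨F, -, hF, hF'⟩ := exists_equiv_fr (ι := {i // n i = 1}) (ι' := {i // n' i = 1})
    (Or.inr (by simp only [card_linear]; exact ⟨h, h'⟩))
  exact coarseEquiv_of_equiv (Equiv.prodCongr (Equiv.refl _) F) hF.prod_id hF'.prod_id

theorem quasiIsometric_of_coarseEquiv_theta (h : CoarseEquiv (ThetaRACG n) (ThetaRACG n')) :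
    QuasiIsometricGroups (ThetaRACG n) (ThetaRACG n') :=
  quasiIsometricGroups_of_coarseEquiv (S := Finset.univ.image (gen (ThetaAdj n)))
    (T := Finset.univ.image (gen (ThetaAdj n'))) (by simpa using closure_gen)
    (by simpa using closure_gen) h

theorem coarseEquiv_theta (hn : ∀ i, 1 ≤ n i) (hn' : ∀ i, 1 ≤ n' i)
    (h : (linearDegree n = 2 ∧ linearDegree n' = 2 ∧
        1 ≤ k - linearDegree n ∧ 1 ≤ k' - linearDegree n') ∨
      (3 ≤ linearDegree n ∧ 3 ≤ linearDegree n' ∧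
        1 ≤ k - linearDegree n ∧ 1 ≤ k' - linearDegree n') ∨
      (3 ≤ linearDegree n ∧ 3 ≤ linearDegree n' ∧
        k - linearDegree n = 0 ∧ k' - linearDegree n' = 0)) :
    CoarseEquiv (ThetaRACG n) (ThetaRACG n') := by
  rcases h with ⟨h, h', hh, hh'⟩ | ⟨h, h', hh, hh'⟩ | ⟨h, h', hh, hh'⟩
  · exact (coarseEquiv_theta_small Empty hn hh (Or.inl ⟨h, inferInstance⟩)).trans
      (coarseEquiv_theta_small Empty hn' hh' (Or.inl ⟨h', inferInstance⟩)).symm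
  · exact (coarseEquiv_theta_small Unit hn hh (Or.inr ⟨h, inferInstance⟩)).trans
      (coarseEquiv_theta_small Unit hn' hh' (Or.inr ⟨h', inferInstance⟩)).symm
  · exact ((coarseEquiv_theta_prod hn hh).trans (coarseEquiv_prod_fr h h')).trans
      (coarseEquiv_theta_prod hn' hh').symm

end Classification

section WordMetric

variable {V : Type} {adj : V → V → Prop}

/-- The word metric for the standard generators. -/
noncomputable def rd (g h : RACG adj) : ℕ := wordDist (Set.range (gen adj)) g h

/-- The element represented by a word in the standard generators. -/
def wprod (adj : V → V → Prop) (l : List V) : RACG adj := (l.map (gen adj)).prod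

@[simp]
theorem wprod_nil : wprod adj [] = 1 := rfl

@[simp]
theorem wprod_cons (v : V) (l : List V) : wprod adj (v :: l) = gen adj v * wprod adj l :=
  List.prod_cons

@[simp]
theorem wprod_append (l l' : List V) :
    wprod adj (l ++ l') = wprod adj l * wprod adj l' := by
  simp [wprod]

theorem wprod_reverse (l : List V) : wprod adj l.reverse = (wprod adj l)⁻¹ := by
  induction l with
  | nil => simp
  | cons v l ih => simp [ih, gen_inv]

theorem rd_mul_wprod_le (g : RACG adj) (l : List V) : rd g (g * wprod adj l) ≤ l.length := by
  refine (wordDist_mul_prod_le g (l.map (gen adj)) fun s hs => Or.inl ?_).trans (by simp)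
  obtain ⟨v, -, rfl⟩ := List.mem_map.1 hs
  exact ⟨v, rfl⟩

theorem exists_word (g h : RACG adj) : ∃ l : List V, l.length = rd g h ∧ h = g * wprod adj l := by
  obtain ⟨l, hl, hs, rfl⟩ := exists_list_wordDist closure_gen g h
  have : ∃ l' : List V, l'.map (gen adj) = l := by
    have hs' : ∀ s ∈ l, s ∈ Set.range (gen adj) := fun s h => by
      rcases hs s h with h | ⟨v, hv⟩
      · exact h
      · exact ⟨v, by rw [← inv_inv s, ← hv, gen_inv]⟩
    exact Set.mem_range.1 (Set.range_list_map (gen adj) ▸ hs')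
  obtain ⟨l', rfl⟩ := this
  exact ⟨l', (List.length_map _).symm.trans hl, rfl⟩

theorem rd_mul_left (z x y : RACG adj) : rd (z * x) (z * y) = rd x y := wordDist_mul_left z x y

theorem rd_triangle (x y z : RACG adj) : rd x z ≤ rd x y + rd y z :=
  wordDist_triangle closure_gen x y z

theorem rd_comm (x y : RACG adj) : rd x y = rd y x := wordDist_comm closure_gen x y

@[simp]
theorem rd_self (x : RACG adj) : rd x x = 0 := by
  simpa using rd_mul_wprod_le x []

theorem rd_mul_gen_le (g : RACG adj) (v : V) : rd g (g * gen adj v) ≤ 1 := by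
  simpa using rd_mul_wprod_le g [v]

theorem exists_geodesic (g h : RACG adj) :
    ∃ m : ℕ → RACG adj, m 0 = g ∧ m (rd g h) = h ∧ ∀ t, rd (m t) (m (t + 1)) ≤ 1 := by
  obtain ⟨l, hl, rfl⟩ := exists_word g h
  refine ⟨fun t => g * wprod adj (l.take t), by simp, by simp [← hl], fun t => ?_⟩
  beta_reduce
  rw [List.take_add_one, wprod_append, ← mul_assoc]
  refine (rd_mul_wprod_le _ _).trans ?_
  cases l[t]? <;> simp

theorem rd_le_of_steps {m : ℕ → RACG adj} {K : ℕ} {N : ℕ}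
    (hm : ∀ t < N, rd (m t) (m (t + 1)) ≤ K) (t i : ℕ) (h : t + i ≤ N) :
    rd (m t) (m (t + i)) ≤ K * i := by
  induction i with
  | zero => simp
  | succ i ih =>
    have h1 := ih (by omega)
    have h2 := hm (t + i) (by omega)
    have h3 := rd_triangle (m t) (m (t + i)) (m (t + (i + 1)))
    rw [← add_assoc] at *
    rw [mul_add]
    omega

end WordMetric

section Position

variable {V : Type} {adj : V → V → Prop} {s t : V}

/-- Two distinct vertices that are not joined by an edge. -/
structure Indep (adj : V → V → Prop) (s t : V) : Prop where
  ne : s ≠ t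
  not_adj : ¬ adj s t
  not_adj' : ¬ adj t s

theorem Indep.symm (h : Indep adj s t) : Indep adj t s := ⟨h.ne.symm, h.not_adj', h.not_adj⟩

/-- The action of a right-angled Coxeter group on `ℤ` through the dihedral group of two
non-adjacent vertices. -/
noncomputable def posHom (h : Indep adj s t) : RACG adj →* Equiv.Perm ℤ :=
  racgLift (fun v => if v = s then Equiv.subLeft 1 else if v = t then Equiv.subLeft (-1) else 1)
    (fun v => by
      ext n
      split_ifs <;> simp)
    (fun u v huv => by
      have h1 := h.not_adj
      have h2 := h.not_adj'
      have h3 := h.ne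
      split_ifs <;> first | rfl | (subst_vars; contradiction))

theorem posHom_left (h : Indep adj s t) (n : ℤ) : posHom h (gen adj s) n = 1 - n := by
  simp [posHom]

theorem posHom_right (h : Indep adj s t) (n : ℤ) : posHom h (gen adj t) n = -1 - n := by
  simp [posHom, h.ne.symm]

theorem posHom_other (h : Indep adj s t) {v : V} (hs : v ≠ s) (ht : v ≠ t) :
    posHom h (gen adj v) = 1 := by
  simp [posHom, hs, ht]

/-- The position of an element along the line of two non-adjacent vertices. -/
noncomputable def pos (h : Indep adj s t) (g : RACG adj) : ℤ := posHom h g 0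

theorem posHom_eq (h : Indep adj s t) (g : RACG adj) :
    (∀ n, posHom h g n = pos h g + n) ∨ (∀ n, posHom h g n = pos h g - n) := by
  unfold pos
  induction g using racg_induction with
  | one => simp
  | mul v g ih =>
    simp only [map_mul, Equiv.Perm.mul_apply]
    by_cases hs : v = s
    · subst hs
      simp only [posHom_left]
      rcases ih with ih | ih
      · right; intro n; rw [ih n]; ring
      · left; intro n; rw [ih n]; ring
    by_cases ht : v = t
    · subst ht
      simp only [posHom_right]
      rcases ih with ih | ih
      · right; intro n; rw [ih n]; ring
      · left; intro n; rw [ih n]; ring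
    rw [posHom_other h hs ht]
    exact ih

theorem abs_posHom_sub (h : Indep adj s t) (g : RACG adj) (m n : ℤ) :
    |posHom h g m - posHom h g n| = |m - n| := by
  rcases posHom_eq h g with hg | hg
  · rw [hg, hg]; congr 1; ring
  · rw [hg, hg, abs_sub_comm]; congr 1; ring

theorem pos_mul (h : Indep adj s t) (g g' : RACG adj) : pos h (g * g') = posHom h g (pos h g') := by
  simp [pos]

theorem abs_pos_mul_sub (h : Indep adj s t) (g u v : RACG adj) :
    |pos h (g * u) - pos h (g * v)| = |pos h u - pos h v| := by
  rw [pos_mul, pos_mul, abs_posHom_sub]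

theorem abs_pos_gen (h : Indep adj s t) (v : V) : |pos h (gen adj v)| ≤ 1 := by
  unfold pos
  by_cases hs : v = s
  · subst hs; simp [posHom_left]
  by_cases ht : v = t
  · subst ht; simp [posHom_right]
  simp [posHom_other h hs ht]

@[simp]
theorem pos_one (h : Indep adj s t) : pos h (1 : RACG adj) = 0 := by simp [pos]

theorem abs_pos_sub_le (h : Indep adj s t) (g g' : RACG adj) :
    |pos h g - pos h g'| ≤ rd g g' := by
  obtain ⟨l, hl, rfl⟩ := exists_word g g'
  rw [← hl]
  clear hl
  induction l generalizing g with
  | nil => simp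
  | cons v l ih =>
    have h1 := ih (g * gen adj v)
    have h2 := abs_pos_mul_sub h g 1 (gen adj v)
    have h3 := abs_pos_gen h v
    rw [mul_one, pos_one, zero_sub, abs_neg] at h2
    rw [wprod_cons, ← mul_assoc, List.length_cons]
    push_cast
    have := abs_sub_le (pos h g) (pos h (g * gen adj v)) (pos h (g * gen adj v * wprod adj l))
    linarith

/-- The line through the identity spanned by two vertices. -/
noncomputable def line (adj : V → V → Prop) (s t : V) (i : ℤ) : RACG adj :=
  (gen adj s * gen adj t) ^ (i / 2) * if Even i then 1 else gen adj s

@[simp]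
theorem line_zero : line adj s t 0 = 1 := by simp [line]

theorem line_succ_of_even {i : ℤ} (hi : Even i) :
    line adj s t (i + 1) = line adj s t i * gen adj s := by
  obtain ⟨k, rfl⟩ := hi
  have h1 : (k + k + 1) / 2 = k := by omega
  have h2 : (k + k) / 2 = k := by omega
  simp [line, h1, h2]

theorem line_succ_of_odd {i : ℤ} (hi : ¬ Even i) :
    line adj s t (i + 1) = line adj s t i * gen adj t := by
  rw [Int.not_even_iff_odd] at hi
  obtain ⟨k, rfl⟩ := hi
  have h1 : (2 * k + 1 + 1) / 2 = k + 1 := by omega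
  have h2 : (2 * k + 1) / 2 = k := by omega
  have h3 : Even (2 * k + 1 + 1) := ⟨k + 1, by ring⟩
  have h4 : ¬ Even (2 * k + 1) := by simp
  rw [line, line, if_pos h3, if_neg h4, h1, h2, zpow_add_one]
  group

theorem posHom_line (h : Indep adj s t) (i n : ℤ) :
    posHom h (line adj s t i) n = if Even i then i + n else i - n := by
  have key : ∀ i : ℤ, (∀ n, posHom h (line adj s t i) n = if Even i then i + n else i - n) ↔
      ∀ n, posHom h (line adj s t (i + 1)) n = if Even (i + 1) then i + 1 + n else i + 1 - n := by
    intro i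
    by_cases hi : Even i
    · have hi' : ¬ Even (i + 1) := by simpa [Int.even_add_one] using hi
      simp only [line_succ_of_even hi, map_mul, Equiv.Perm.mul_apply, posHom_left, if_pos hi,
        if_neg hi']
      exact ⟨fun H n => by rw [H]; ring, fun H n => by
        have := H (1 - n); rw [sub_sub_cancel] at this; rw [this]; ring⟩
    · have hi' : Even (i + 1) := by simpa [Int.even_add_one] using hi
      simp only [line_succ_of_odd hi, map_mul, Equiv.Perm.mul_apply, posHom_right, if_neg hi,
        if_pos hi']
      exact ⟨fun H n => by rw [H]; ring, fun H n => by
        have := H (-1 - n); rw [sub_sub_cancel] at this; rw [this]; ring⟩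
  revert n
  induction i using Int.induction_on with
  | zero => simp
  | succ i ih => exact (key i).1 ih
  | pred i ih => exact (key (-i - 1)).2 (by simpa using ih)

@[simp]
theorem pos_line (h : Indep adj s t) (i : ℤ) : pos h (line adj s t i) = i := by
  simp [pos, posHom_line]

theorem rd_line_le (i j : ℤ) : (rd (line adj s t i) (line adj s t j) : ℤ) ≤ |i - j| := by
  have step : ∀ i, rd (line adj s t i) (line adj s t (i + 1)) ≤ 1 := fun i => by
    by_cases hi : Even i
    · rw [line_succ_of_even hi]; exact rd_mul_gen_le _ _
    · rw [line_succ_of_odd hi]; exact rd_mul_gen_le _ _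
  have key : ∀ (n : ℕ) (i : ℤ), rd (line adj s t i) (line adj s t (i + n)) ≤ n := by
    intro n i
    have := rd_le_of_steps (m := fun n : ℕ => line adj s t (i + n)) (K := 1) (N := n)
      (fun t _ => by
        have := step (i + t)
        push_cast
        rwa [← add_assoc]) 0 n (by simp)
    simpa using this
  rcases le_total i j with h | h
  · obtain ⟨n, rfl⟩ := Int.le.dest h
    have := key n i
    simpa using this
  · obtain ⟨n, rfl⟩ := Int.le.dest h
    have := key n j
    rw [rd_comm]
    simpa using this

theorem line_mul_left (i : ℤ) :
    line adj s t i * gen adj s = line adj s t (if Even i then i + 1 else i - 1) := by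
  split_ifs with hi
  · rw [line_succ_of_even hi]
  · have := line_succ_of_even (adj := adj) (s := s) (t := t) (i := i - 1)
      (by simpa [Int.even_sub_one] using hi)
    rw [sub_add_cancel] at this
    rw [this, mul_gen_mul_gen]

theorem line_mul_right (i : ℤ) :
    line adj s t i * gen adj t = line adj s t (if Even i then i - 1 else i + 1) := by
  split_ifs with hi
  · have := line_succ_of_odd (adj := adj) (s := s) (t := t) (i := i - 1)
      (by simpa [Int.even_sub_one] using hi)
    rw [sub_add_cancel] at this
    rw [this, mul_gen_mul_gen]
  · rw [line_succ_of_odd hi]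

theorem map_line {M : Type*} [Group M] (f : RACG adj →* M) (hs : f (gen adj s) = 1)
    (ht : f (gen adj t) = 1) (i : ℤ) : f (line adj s t i) = 1 := by
  unfold line
  split_ifs <;> simp [hs, ht]

end Position

section Walls

variable {V : Type} {adj : V → V → Prop}

/-- The subgroup generated by the star of a vertex. -/
def star (adj : V → V → Prop) (v : V) : Subgroup (RACG adj) :=
  Subgroup.closure (gen adj '' {u | u = v ∨ adj u v ∨ adj v u})

theorem gen_mem_star {u v : V} (h : u = v ∨ adj u v ∨ adj v u) : gen adj u ∈ star adj v :=
  Subgroup.subset_closure ⟨u, h, rfl⟩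

theorem star_comm {v : V} {g : RACG adj} (hg : g ∈ star adj v) :
    g * gen adj v = gen adj v * g := by
  induction hg using Subgroup.closure_induction with
  | mem x hx =>
    obtain ⟨u, rfl | hu | hu, rfl⟩ := hx
    · rfl
    · exact gen_comm hu
    · exact (gen_comm hu).symm
  | one => simp
  | mul x y _ _ hx hy => rw [mul_assoc, hy, ← mul_assoc, hx, mul_assoc]
  | inv x _ hx =>
    have hx : Commute x (gen adj v) := hx
    exact hx.inv_left

/-- Crossing the wall of `v` through `c`. -/
def Crosses (v : V) (c g : RACG adj) (s : V) : Prop := s = v ∧ c⁻¹ * g ∈ star adj v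

theorem crosses_mul {v : V} {c g : RACG adj} {s u : V} (hu : u = v ∨ adj u v ∨ adj v u) :
    Crosses v c (g * gen adj u) s ↔ Crosses v c g s := by
  unfold Crosses
  rw [← mul_assoc, Subgroup.mul_mem_cancel_right _ (gen_mem_star hu)]

/-- The move of a generator on elements together with a side of a wall. -/
noncomputable def wallMove (v : V) (c : RACG adj) (s : V) (y : RACG adj × Bool) :
    RACG adj × Bool :=
  (y.1 * gen adj s, xor y.2 (decide (Crosses v c y.1 s)))

theorem wallMove_wallMove (v : V) (c : RACG adj) (s : V) (y : RACG adj × Bool) :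
    wallMove v c s (wallMove v c s y) = y := by
  have h : Crosses v c (y.1 * gen adj s) s ↔ Crosses v c y.1 s := by
    by_cases hs : s = v
    · exact crosses_mul (Or.inl hs)
    · simp [Crosses, hs]
  simp [wallMove, mul_gen_mul_gen, h]

theorem wallMove_comm (v : V) (c : RACG adj) {s u : V} (hsu : adj s u) (y : RACG adj × Bool) :
    wallMove v c s (wallMove v c u y) = wallMove v c u (wallMove v c s y) := by
  have h1 : Crosses v c (y.1 * gen adj u) s ↔ Crosses v c y.1 s := by
    by_cases hs : s = v
    · subst hs; exact crosses_mul (Or.inr (Or.inr hsu))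
    · simp [Crosses, hs]
  have h2 : Crosses v c (y.1 * gen adj s) u ↔ Crosses v c y.1 u := by
    by_cases hs : u = v
    · subst hs; exact crosses_mul (Or.inr (Or.inl hsu))
    · simp [Crosses, hs]
  simp only [wallMove, h1, h2, mul_assoc, gen_comm hsu]
  rw [Bool.xor_right_comm]

/-- The action on elements together with a side of a wall. -/
noncomputable def wallAct (v : V) (c : RACG adj) : RACG adj →* Equiv.Perm (RACG adj × Bool) :=
  racgLift (fun s => ⟨wallMove v c s, wallMove v c s, wallMove_wallMove v c s,
      wallMove_wallMove v c s⟩)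
    (fun s => Equiv.ext fun y => wallMove_wallMove v c s y)
    (fun _ _ h => Equiv.ext fun y => wallMove_comm v c h y)

/-- The side of the wall of `v` through `c` on which an element lies. -/
noncomputable def side (v : V) (c g : RACG adj) : Bool := (wallAct v c g⁻¹ (1, false)).2

theorem side_mul_gen (v : V) (c g : RACG adj) (s : V) :
    side v c (g * gen adj s) = xor (side v c g) (decide (Crosses v c g s)) := by
  have h : ∀ g : RACG adj, (wallAct v c g (1, false)).1 = g⁻¹ := fun g => by
    induction g using racg_induction with
    | one => simp
    | mul u g ih =>
      rw [map_mul, Equiv.Perm.mul_apply, wallAct, racgLift_gen]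
      change _ * gen adj u = _
      rw [mul_inv_rev, gen_inv, ← ih]
      rfl
  have := h g⁻¹
  rw [inv_inv] at this
  unfold side
  rw [mul_inv_rev, gen_inv, map_mul, Equiv.Perm.mul_apply]
  conv_lhs => rw [wallAct, racgLift_gen]
  change xor _ (decide (Crosses v c (wallAct v c g⁻¹ (1, false)).1 s)) = _
  rw [this]
  rfl

theorem side_mul_gen_of_ne {v s : V} (c g : RACG adj) (h : s ≠ v) :
    side v c (g * gen adj s) = side v c g := by
  simp [side_mul_gen, Crosses, h]

/-- A word joining opposite sides of a wall crosses it. -/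
theorem exists_crossing {v : V} {c g : RACG adj} {l : List V}
    (h : side v c g ≠ side v c (g * wprod adj l)) :
    ∃ l₁ l₂, l = l₁ ++ v :: l₂ ∧ c⁻¹ * (g * wprod adj l₁) ∈ star adj v := by
  induction l generalizing g with
  | nil => simp at h
  | cons s l ih =>
    by_cases hs : Crosses v c g s
    · obtain ⟨rfl, hs⟩ := hs
      exact ⟨[], l, rfl, by simpa using hs⟩
    · have h2 : side v c (g * gen adj s) = side v c g := by simp [side_mul_gen, hs]
      rw [wprod_cons, ← mul_assoc, ← h2] at h
      obtain ⟨l₁, l₂, rfl, h3⟩ := ih h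
      exact ⟨s :: l₁, l₂, rfl, by simpa [mul_assoc] using h3⟩

theorem exists_mem_wall {v : V} {c g h : RACG adj} (hs : side v c g ≠ side v c h) :
    ∃ z, c⁻¹ * z ∈ star adj v ∧ rd g z + rd z h ≤ rd g h := by
  obtain ⟨l, hl, rfl⟩ := exists_word g h
  obtain ⟨l₁, l₂, rfl, hz⟩ := exists_crossing hs
  refine ⟨g * wprod adj l₁, hz, ?_⟩
  rw [← hl, wprod_append, ← mul_assoc, List.length_append]
  exact add_le_add (rd_mul_wprod_le _ _) (rd_mul_wprod_le _ _)

/-- A geodesic word crosses each wall at most once. -/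
theorem not_crosses_twice {v : V} {c g : RACG adj} {l₁ l₂ l₃ : List V}
    (hl : (l₁ ++ v :: (l₂ ++ v :: l₃)).length =
      rd g (g * wprod adj (l₁ ++ v :: (l₂ ++ v :: l₃))))
    (h1 : c⁻¹ * (g * wprod adj l₁) ∈ star adj v)
    (h2 : c⁻¹ * (g * wprod adj (l₁ ++ v :: l₂)) ∈ star adj v) : False := by
  have h3 : wprod adj l₂ ∈ star adj v := by
    have := (star adj v).mul_mem ((star adj v).inv_mem h1) h2
    simp only [wprod_append, wprod_cons, mul_inv_rev, inv_inv, mul_assoc, mul_inv_cancel_left,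
      inv_mul_cancel_left] at this
    exact (Subgroup.mul_mem_cancel_left _ (gen_mem_star (Or.inl rfl))).1 this
  have h4 : wprod adj (l₁ ++ v :: (l₂ ++ v :: l₃)) = wprod adj (l₁ ++ (l₂ ++ l₃)) := by
    simp only [wprod_append, wprod_cons]
    rw [← mul_assoc (wprod adj l₂), star_comm h3, mul_assoc, gen_mul_gen_mul]
  rw [h4] at hl
  have := rd_mul_wprod_le g (l₁ ++ (l₂ ++ l₃))
  simp only [List.length_append, List.length_cons] at hl this
  omega

end Walls

section Lines

variable {V : Type} {adj : V → V → Prop} {s t v : V}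

theorem pos_of_mem_star (h : Indep adj s t) (ht : ¬ (t = v ∨ adj t v ∨ adj v t)) {z : RACG adj}
    (hz : z ∈ star adj v) : pos h z = 0 ∨ pos h z = 1 := by
  have hs : posHom h (gen adj s) * posHom h (gen adj s) = 1 := by
    rw [← map_mul, gen_mul_self, map_one]
  have key : posHom h z = 1 ∨ posHom h z = posHom h (gen adj s) := by
    induction hz using Subgroup.closure_induction with
    | mem x hx =>
      obtain ⟨u, hu, rfl⟩ := hx
      by_cases hus : u = s
      · exact Or.inr (by rw [hus])
      · refine Or.inl (posHom_other h hus ?_)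
        rintro rfl
        exact ht hu
    | one => simp
    | mul x y _ _ hx hy =>
      rw [map_mul]
      rcases hx with hx | hx <;> rcases hy with hy | hy <;> simp [hx, hy, hs]
    | inv x _ hx =>
      rw [map_inv]
      rcases hx with hx | hx
      · simp [hx]
      · exact Or.inr (by rw [hx, inv_eq_of_mul_eq_one_left hs])
  rcases key with h' | h' <;> simp [pos, h', posHom_left]

theorem eq_line_of_mem_star (hv : ∀ u, adj u v ∨ adj v u → u = s ∨ u = t) {z : RACG adj}
    (hz : z ∈ star adj v) : ∃ i, z = line adj s t i ∨ z = line adj s t i * gen adj v := by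
  have hstep : ∀ (z : RACG adj) (u : V), (u = v ∨ adj u v ∨ adj v u) →
      (∃ i, z = line adj s t i ∨ z = line adj s t i * gen adj v) →
      ∃ i, z * gen adj u = line adj s t i ∨ z * gen adj u = line adj s t i * gen adj v := by
    rintro _ u hu ⟨i, rfl | rfl⟩
    · rcases hu with rfl | hu
      · exact ⟨i, Or.inr rfl⟩
      · rcases hv u hu with rfl | rfl
        · exact ⟨_, Or.inl (line_mul_left i)⟩
        · exact ⟨_, Or.inl (line_mul_right i)⟩
    · rw [mul_assoc, ← star_comm (gen_mem_star hu), ← mul_assoc]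
      rcases hu with rfl | hu
      · exact ⟨i, Or.inl (mul_gen_mul_gen _ _)⟩
      · rcases hv u hu with rfl | rfl
        · exact ⟨_, Or.inr (by rw [line_mul_left i])⟩
        · exact ⟨_, Or.inr (by rw [line_mul_right i])⟩
  induction hz using Subgroup.closure_induction_right with
  | one => exact ⟨0, by simp⟩
  | mul_right x _ y hy ih =>
    obtain ⟨u, hu, rfl⟩ := hy
    exact hstep x u hu ih
  | mul_inv_cancel x _ y hy ih =>
    obtain ⟨u, hu, rfl⟩ := hy
    rw [gen_inv]
    exact hstep x u hu ih

theorem side_line_eq {c g : RACG adj} (ht : t ≠ v) {i₀ : ℤ}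
    (h : ∀ i, i₀ ≤ i → ¬ Crosses v c (g * line adj s t i) s) {i j : ℤ} (hi : i₀ ≤ i) (hj : i₀ ≤ j) :
    side v c (g * line adj s t i) = side v c (g * line adj s t j) := by
  have key : ∀ n : ℕ, side v c (g * line adj s t (i₀ + n)) = side v c (g * line adj s t i₀) := by
    intro n
    induction n with
    | zero => simp
    | succ n ih =>
      rw [← ih]
      push_cast
      rw [← add_assoc]
      by_cases he : Even (i₀ + n)
      · rw [line_succ_of_even he, ← mul_assoc, side_mul_gen, decide_eq_false (h _ (by omega)),
          Bool.xor_false]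
      · rw [line_succ_of_odd he, ← mul_assoc, side_mul_gen_of_ne _ _ ht]
  obtain ⟨n, rfl⟩ := Int.le.dest hi
  obtain ⟨m, rfl⟩ := Int.le.dest hj
  rw [key, key]

theorem side_line_const {c g : RACG adj} (ht : t ≠ v)
    (h : ∀ i, ¬ Crosses v c (g * line adj s t i) s) (i : ℤ) :
    side v c (g * line adj s t i) = side v c g := by
  have := side_line_eq (c := c) (g := g) ht (i₀ := min i 0) (fun i _ => h i) (i := i) (j := 0)
    (min_le_left _ _) (min_le_right _ _)
  simpa using this

/-- Along its line, the wall of `s` is crossed exactly once. -/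
theorem side_line_ne (h : Indep adj s t) (g : RACG adj) {k i j : ℤ} (hi : i ≤ 2 * k)
    (hj : 2 * k + 1 ≤ j) :
    side s (g * line adj s t (2 * k)) (g * line adj s t i) ≠
      side s (g * line adj s t (2 * k)) (g * line adj s t j) := by
  have hE : ∀ i, Crosses s (g * line adj s t (2 * k)) (g * line adj s t i) s → Even i →
      i = 2 * k := by
    rintro i ⟨-, hi⟩ he
    have h1 := pos_of_mem_star h (by
      rintro (h1 | h1 | h1)
      exacts [h.ne h1.symm, h.not_adj' h1, h.not_adj h1]) hi
    have h2 := abs_pos_mul_sub h (g * line adj s t (2 * k))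
      ((g * line adj s t (2 * k))⁻¹ * (g * line adj s t i)) 1
    rw [mul_inv_cancel_left, mul_one, abs_pos_mul_sub, pos_line, pos_line, pos_one] at h2
    obtain ⟨m, rfl⟩ := he
    rcases h1 with h1 | h1 <;> rw [h1] at h2
    · rw [sub_zero, abs_zero, abs_eq_zero] at h2
      omega
    · rw [sub_zero, abs_one, abs_eq zero_le_one] at h2
      omega
  have hstep : ∀ i, i ≠ 2 * k → side s (g * line adj s t (2 * k)) (g * line adj s t (i + 1)) =
      side s (g * line adj s t (2 * k)) (g * line adj s t i) := by
    intro i hi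
    by_cases he : Even i
    · rw [line_succ_of_even he, ← mul_assoc, side_mul_gen,
        decide_eq_false fun hc => hi (hE i hc he), Bool.xor_false]
    · rw [line_succ_of_odd he, ← mul_assoc, side_mul_gen_of_ne _ _ h.ne.symm]
  have hup : ∀ n : ℕ, side s (g * line adj s t (2 * k)) (g * line adj s t (2 * k + 1 + n)) =
      side s (g * line adj s t (2 * k)) (g * line adj s t (2 * k + 1)) := by
    intro n
    induction n with
    | zero => simp
    | succ n ih =>
      rw [← ih]
      push_cast
      rw [← add_assoc]
      exact hstep _ (by omega)
  have hdown : ∀ n : ℕ, side s (g * line adj s t (2 * k)) (g * line adj s t (2 * k - n)) =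
      side s (g * line adj s t (2 * k)) (g * line adj s t (2 * k)) := by
    intro n
    induction n with
    | zero => simp
    | succ n ih =>
      rw [← ih, ← hstep _ (by omega)]
      push_cast
      congr 3
      ring
  obtain ⟨n, rfl⟩ := Int.le.dest hj
  obtain ⟨m, hm⟩ := Int.le.dest hi
  obtain rfl : i = 2 * k - m := by omega
  rw [hup, hdown, line_succ_of_even ⟨k, by ring⟩, ← mul_assoc, side_mul_gen, decide_eq_true]
  · simp
  · exact ⟨rfl, by simp⟩

end Lines

section Divergence

variable {V : Type} {adj : V → V → Prop} {a x y b : V}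

/-- Vertices `a, x, y, b` spanning an induced path whose interior vertices have no further
neighbours. -/
structure HypPath (adj : V → V → Prop) (a x y b : V) : Prop where
  nx : ∀ u, adj u x ∨ adj x u → u = a ∨ u = y
  ny : ∀ u, adj u y ∨ adj y u → u = x ∨ u = b
  ab : Indep adj a b
  ax : a ≠ x
  ay : a ≠ y
  xy : x ≠ y
  xb : x ≠ b
  yb : y ≠ b

theorem HypPath.symm (H : HypPath adj a x y b) : HypPath adj b y x a :=
  ⟨fun u hu => (H.ny u hu).symm, fun u hu => (H.nx u hu).symm, H.ab.symm, H.yb.symm, H.xb.symm,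
    H.xy.symm, H.ay.symm, H.ax.symm⟩

theorem HypPath.indep (H : HypPath adj a x y b) : Indep adj y a := by
  have h : ¬ (adj a y ∨ adj y a) := fun h => by
    rcases H.ny a h with h | h
    exacts [H.ax h, H.ab.ne h]
  exact ⟨H.ay.symm, fun h' => h (Or.inr h'), fun h' => h (Or.inl h')⟩

theorem HypPath.not_star (H : HypPath adj a x y b) : ¬ (a = b ∨ adj a b ∨ adj b a) := by
  rintro (h | h | h)
  exacts [H.ab.ne h, H.ab.not_adj h, H.ab.not_adj' h]

theorem Indep.not_star {s t : V} (h : Indep adj s t) : ¬ (t = s ∨ adj t s ∨ adj s t) := by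
  rintro (h1 | h1 | h1)
  exacts [h.ne h1.symm, h.not_adj' h1, h.not_adj h1]

theorem separation (H : HypPath adj a x y b) {k k' : ℤ} (hk : k ≠ k') {l : ℤ} {u u' : RACG adj}
    (hu : u = line adj b x l ∨ u = line adj b x l * gen adj y) (hu' : u' ∈ star adj y) :
    |l| - 2 ≤ rd (line adj y a (2 * k) * u) (line adj y a (2 * k') * u') := by
  have hya := H.indep
  have hbx := H.symm.indep.symm
  obtain ⟨e, he, hle⟩ | hl : (∃ e : ℤ, (e = 0 ∨ e = -1) ∧
      side b (line adj y a (2 * k) * line adj b x (2 * e)) (line adj y a (2 * k)) ≠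
      side b (line adj y a (2 * k) * line adj b x (2 * e))
        (line adj y a (2 * k) * line adj b x l)) ∨ |l| ≤ 2 := by
    by_cases h1 : 1 ≤ l
    · refine Or.inl ⟨0, Or.inl rfl, ?_⟩
      simpa using side_line_ne hbx (line adj y a (2 * k)) (k := 0) (i := 0) (j := l) (by simp)
        (by omega)
    by_cases h2 : l ≤ -2
    · refine Or.inl ⟨-1, Or.inr rfl, ?_⟩
      have := side_line_ne hbx (line adj y a (2 * k)) (k := -1) (i := l) (j := 0) (by omega)
        (by simp)
      rw [line_zero, mul_one] at this
      exact this.symm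
    · right
      rw [abs_le]
      omega
  swap
  · omega
  set C := line adj y a (2 * k) * line adj b x (2 * e) with hC
  have hpos_bx : ∀ i, posHom hbx (line adj y a i) = 1 := fun i =>
    map_line _ (posHom_other hbx H.yb H.xy.symm) (posHom_other hbx H.ab.ne H.ax) i
  have hpos_ya : ∀ i, posHom hya (line adj b x i) = 1 := fun i =>
    map_line _ (posHom_other hya H.yb.symm H.ab.ne.symm) (posHom_other hya H.xy H.ax.symm) i
  have hsu : side b C (line adj y a (2 * k) * u) ≠ side b C (line adj y a (2 * k)) := by
    rcases hu with rfl | rfl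
    · exact hle.symm
    · rw [← mul_assoc, side_mul_gen_of_ne _ _ H.yb]
      exact hle.symm
  have hconst : ∀ i, side b C (line adj y a i) = side b C 1 := fun i => by
    have := side_line_const (c := C) (g := 1) (s := y) (t := a) (v := b) H.ab.ne
      (fun i hi => H.yb hi.1) i
    simpa using this
  have hsu' : side b C (line adj y a (2 * k') * u') = side b C (line adj y a (2 * k')) := by
    have hc : ∀ i, ¬ Crosses b C (line adj y a (2 * k') * line adj b x i) b := by
      rintro i ⟨-, hi⟩
      have h1 := pos_of_mem_star hya H.not_star hi
      have h2 := abs_pos_mul_sub hya C (C⁻¹ * (line adj y a (2 * k') * line adj b x i)) 1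
      rw [mul_inv_cancel_left, mul_one, pos_one, hC, pos_mul, pos_mul, pos, pos, hpos_ya, hpos_ya,
        Equiv.Perm.one_apply, ← pos, ← pos, pos_line, pos_line, ← hC] at h2
      rcases h1 with h1 | h1 <;> rw [h1] at h2
      · rw [sub_zero, abs_zero, abs_eq_zero] at h2
        omega
      · rw [sub_zero, abs_one, abs_eq zero_le_one] at h2
        omega
    obtain ⟨l', rfl | rfl⟩ := eq_line_of_mem_star (fun w hw => (H.ny w hw).symm) hu'
    · exact side_line_const H.xb hc l'
    · rw [← mul_assoc, side_mul_gen_of_ne _ _ H.yb]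
      exact side_line_const H.xb hc l'
  obtain ⟨w, hw, hd⟩ := exists_mem_wall (v := b) (c := C) (g := line adj y a (2 * k) * u)
    (h := line adj y a (2 * k') * u') (by rw [hsu', hconst]; rwa [hconst (2 * k)] at hsu)
  have h1 := pos_of_mem_star hbx hbx.not_star hw
  have h2 : pos hbx w = 2 * e + pos hbx (C⁻¹ * w) := by
    have : w = C * (C⁻¹ * w) := by simp
    conv_lhs => rw [this]
    rw [pos_mul, hC, map_mul, hpos_bx, one_mul, posHom_line, if_pos ⟨e, by ring⟩]
  have h3 : pos hbx (line adj y a (2 * k) * u) = l := by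
    rw [pos_mul, hpos_bx, Equiv.Perm.one_apply]
    rcases hu with rfl | rfl
    · simp
    · rw [pos_mul, pos, posHom_other hbx H.yb H.xy.symm, Equiv.Perm.one_apply, ← pos, pos_line]
  have h4 := abs_pos_sub_le hbx (line adj y a (2 * k) * u) w
  rw [h3, h2] at h4
  have h5 : |l| ≤ |l - (2 * e + pos hbx (C⁻¹ * w))| + 2 := by
    have : |l| ≤ |l - (2 * e + pos hbx (C⁻¹ * w))| + |2 * e + pos hbx (C⁻¹ * w)| := by
      simpa using abs_add_le (l - (2 * e + pos hbx (C⁻¹ * w))) (2 * e + pos hbx (C⁻¹ * w))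
    have h6 : |2 * e + pos hbx (C⁻¹ * w)| ≤ 2 := by
      rw [abs_le]
      rcases he with rfl | rfl <;> rcases h1 with h1 | h1 <;> rw [h1] <;> simp
    linarith
  omega

end Divergence

section Divergence

variable {V : Type} {adj : V → V → Prop} {a x y b s t : V}

theorem pos_of_mem_line_star (h : Indep adj s t) {c z : RACG adj} {k : ℤ}
    (hz : (c * line adj s t (2 * k))⁻¹ * z ∈ star adj s) :
    pos h (c⁻¹ * z) = 2 * k ∨ pos h (c⁻¹ * z) = 2 * k + 1 := by
  have h1 := pos_of_mem_star h h.not_star hz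
  have h2 : c⁻¹ * z = line adj s t (2 * k) * ((c * line adj s t (2 * k))⁻¹ * z) := by group
  rw [h2, pos_mul, posHom_line, if_pos ⟨k, by ring⟩]
  omega

theorem abs_pos_sub_le_rd (h : Indep adj s t) (c z z' : RACG adj) :
    |pos h (c⁻¹ * z) - pos h (c⁻¹ * z')| ≤ rd z z' := by
  rw [← rd_mul_left c⁻¹ z z']
  exact abs_pos_sub_le h _ _

theorem side_eq_of_near (h : Indep adj s t) {c q : RACG adj} {i k : ℤ} {ρ : ℕ}
    (hq : rd q (c * line adj s t i) ≤ ρ) (hi : i + ρ < 2 * k ∨ 2 * k + 1 + ρ < i) :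
    side s (c * line adj s t (2 * k)) q =
      side s (c * line adj s t (2 * k)) (c * line adj s t i) := by
  by_contra hne
  obtain ⟨z, hz, hd⟩ := exists_mem_wall hne
  have h1 := pos_of_mem_line_star h hz
  have h2 := abs_pos_sub_le_rd h c z (c * line adj s t i)
  rw [inv_mul_cancel_left, pos_line, abs_le] at h2
  omega

theorem exists_step_ne {α : Type*} {f : ℕ → α} {i j : ℕ} (hij : i ≤ j) (h : f i ≠ f j) :
    ∃ t, i ≤ t ∧ t < j ∧ f t ≠ f (t + 1) := by
  by_contra! hc
  refine h ?_
  obtain ⟨n, rfl⟩ := Nat.le.dest hij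
  clear hij h
  induction n with
  | zero => rfl
  | succ n ih =>
    rw [ih fun t ht ht' => hc t ht (by omega)]
    exact hc (i + n) (by omega) (by omega)

/-- A path joining distant points of the line through `y` and `a` while avoiding a large ball
centred on the line is long. -/
theorem HypPath.divergence (H : HypPath adj a x y b) {K s N ρ : ℕ} (hK : 1 ≤ K) (hs : 3 ≤ s)
    {c : RACG adj} {q : ℕ → RACG adj} (hq : ∀ t < N, rd (q t) (q (t + 1)) ≤ K) {i₁ n i₂ : ℤ}
    (h0 : rd (q 0) (c * line adj y a i₁) ≤ ρ) (hN : rd (q N) (c * line adj y a i₂) ≤ ρ)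
    (hav : ∀ t ≤ N, 8 * (K * s) ≤ rd (q t) (c * line adj y a n))
    (h1 : i₁ + ρ + 8 * (K * s) ≤ n) (h2 : n + 8 * (K * s) + ρ ≤ i₂) : 2 * K * s ^ 2 ≤ N := by
  have hya := H.indep
  obtain ⟨m, hm⟩ : ∃ m, m = K * s := ⟨_, rfl⟩
  rw [← Nat.cast_mul, ← hm] at h1 h2
  rw [← hm] at hav
  have key : ∀ j : ℕ, j < 2 * m → ∃ (t : ℕ) (u : RACG adj) (l : ℤ), t < N ∧ u ∈ star adj y ∧
      (u = line adj b x l ∨ u = line adj b x l * gen adj y) ∧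
      rd (q t) (c * (line adj y a (2 * ((n + 1) / 2 + j)) * u)) ≤ K ∧ 4 * m ≤ |l| + K := by
    intro j hj
    set k : ℤ := (n + 1) / 2 + j with hk
    have e1 : 2 * k ≤ n + 4 * m - 1 := by omega
    have e2 : n ≤ 2 * k := by omega
    have hne : side y (c * line adj y a (2 * k)) (q 0) ≠ side y (c * line adj y a (2 * k)) (q N) := by
      rw [side_eq_of_near hya h0 (by omega), side_eq_of_near hya hN (by omega)]
      exact side_line_ne hya c (by omega) (by omega)
    obtain ⟨t, -, ht, hne⟩ := exists_step_ne (f := fun t => side y (c * line adj y a (2 * k)) (q t))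
      (Nat.zero_le N) hne
    obtain ⟨z, hz, hd⟩ := exists_mem_wall hne
    obtain ⟨u, hu⟩ : ∃ u, u = (c * line adj y a (2 * k))⁻¹ * z := ⟨_, rfl⟩
    obtain rfl : z = c * (line adj y a (2 * k) * u) := by rw [hu]; group
    rw [← hu] at hz
    obtain ⟨l, hl⟩ := eq_line_of_mem_star (fun w hw => (H.ny w hw).symm) hz
    have e3 : rd (q t) (c * (line adj y a (2 * k) * u)) ≤ K := by
      have := hq t ht
      omega
    refine ⟨t, u, l, ht, hz, hl, e3, ?_⟩
    have e4 : (rd 1 u : ℤ) ≤ |l| + 1 := by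
      have e5 := rd_line_le (adj := adj) (s := b) (t := x) 0 l
      rw [line_zero, zero_sub, abs_neg] at e5
      rcases hl with rfl | rfl
      · omega
      · have := rd_triangle 1 (line adj b x l) (line adj b x l * gen adj y)
        have := rd_mul_gen_le (line adj b x l) y
        omega
    have e6 := rd_triangle (q t) (c * (line adj y a (2 * k) * u)) (c * line adj y a n)
    have e7 := rd_triangle (c * (line adj y a (2 * k) * u)) (c * line adj y a (2 * k))
      (c * line adj y a n)
    rw [rd_mul_left] at e6
    rw [rd_mul_left, rd_mul_left, rd_mul_left, rd_comm _ (line adj y a (2 * k))] at e7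
    have e8 := rd_mul_left (line adj y a (2 * k)) 1 u
    rw [mul_one] at e8
    have e9 := rd_line_le (adj := adj) (s := y) (t := a) (2 * k) n
    rw [abs_of_nonneg (by omega)] at e9
    have := hav t ht.le
    omega
  choose! T U L hT hU hUL hTU hL using key
  have hsep : ∀ j < 2 * m, ∀ j' < 2 * m, j ≠ j' → T j ≤ T j' → T j + 2 * s ≤ T j' := by
    intro j hj j' hj' hne hle
    have e1 := separation H (k := (n + 1) / 2 + j) (k' := (n + 1) / 2 + j') (by omega) (hUL j hj)
      (hU j' hj')
    rw [← rd_mul_left c] at e1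
    obtain ⟨i, hi⟩ := Nat.le.dest hle
    have e2 := rd_le_of_steps hq (T j) i (by have := hT j' hj'; omega)
    rw [hi] at e2
    have e3 := hTU j hj
    have e4 := hTU j' hj'
    have e5 := hL j hj
    have e6 := rd_triangle (c * (line adj y a (2 * ((n + 1) / 2 + j)) * U j)) (q (T j))
      (c * (line adj y a (2 * ((n + 1) / 2 + j')) * U j'))
    have e7 := rd_triangle (q (T j)) (q (T j'))
      (c * (line adj y a (2 * ((n + 1) / 2 + j')) * U j'))
    rw [rd_comm _ (q (T j))] at e6
    have e8 : 4 * m ≤ K * i + 5 * K := by omega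
    rw [hm] at e8
    have := Nat.le_of_mul_le_mul_left (show K * (4 * s) ≤ K * (i + 5) by linarith) (by omega)
    omega
  have hcard := Finset.card_le_card_of_injOn (s := Finset.range (2 * m))
    (t := Finset.range (N / (2 * s) + 1)) (fun j => T j / (2 * s))
    (fun j hj => by
      have := hT j (Finset.mem_range.1 hj)
      simp only [Finset.coe_range, Set.mem_Iio]
      exact Nat.lt_succ_of_le (Nat.div_le_div_right this.le))
    (fun j hj j' hj' hjj => by
      by_contra hne
      simp only [Finset.coe_range, Set.mem_Iio] at hj hj' hjj
      have d1 := Nat.div_add_mod (T j) (2 * s)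
      have d2 := Nat.div_add_mod (T j') (2 * s)
      have d3 := Nat.mod_lt (T j) (show 0 < 2 * s by omega)
      have d4 := Nat.mod_lt (T j') (show 0 < 2 * s by omega)
      rw [hjj] at d1
      rcases le_total (T j) (T j') with h | h
      · have := hsep j hj j' hj' hne h
        omega
      · have := hsep j' hj' j hj (Ne.symm hne) h
        omega)
  rw [Finset.card_range, Finset.card_range] at hcard
  have h3 : 2 * s * (2 * m) ≤ 2 * s * (N / (2 * s) + 1) := Nat.mul_le_mul_left _ hcard
  have h4 := Nat.mul_div_le N (2 * s)
  rw [hm] at h3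
  nlinarith

end Divergence

section Joined

variable {V : Type} {adj : V → V → Prop} {s t : V} {S : Set (RACG adj)}

/-- There is a path of length `n` from `p` to `p'` inside `S`. -/
def Joined (S : Set (RACG adj)) (n : ℕ) (p p' : RACG adj) : Prop :=
  ∃ m : ℕ → RACG adj, m 0 = p ∧ m n = p' ∧ (∀ t < n, rd (m t) (m (t + 1)) ≤ 1) ∧ ∀ t ≤ n, m t ∈ S

theorem Joined.symm {n : ℕ} {p p' : RACG adj} (h : Joined S n p p') : Joined S n p' p := by
  obtain ⟨m, h0, hn, hm, hS⟩ := h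
  refine ⟨fun t => m (n - t), by simpa using hn, by simpa using h0, fun t ht => ?_,
    fun t _ => hS _ (by omega)⟩
  beta_reduce
  have := hm (n - (t + 1)) (by omega)
  rwa [show n - (t + 1) + 1 = n - t by omega, rd_comm] at this

theorem Joined.trans {n n' : ℕ} {p p' p'' : RACG adj} (h : Joined S n p p')
    (h' : Joined S n' p' p'') : Joined S (n + n') p p'' := by
  obtain ⟨m, h0, hn, hm, hS⟩ := h
  obtain ⟨m', h0', hn', hm', hS'⟩ := h'
  refine ⟨fun t => if t < n then m t else m' (t - n), ?_, by simpa using hn', fun t ht => ?_,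
    fun t ht => ?_⟩
  · by_cases h : 0 < n
    · simpa [h] using h0
    · obtain rfl : n = 0 := by omega
      simp [h0', ← hn, h0]
  · beta_reduce
    by_cases h1 : t + 1 < n
    · rw [if_pos h1, if_pos (by omega)]
      exact hm t (by omega)
    by_cases h2 : t < n
    · obtain rfl : n = t + 1 := by omega
      rw [if_pos h2, if_neg (by omega), Nat.sub_self, h0', ← hn]
      exact hm t h2
    · rw [if_neg h1, if_neg h2, show t + 1 - n = t - n + 1 by omega]
      exact hm' _ (by omega)
  · beta_reduce
    split_ifs with h
    · exact hS t h.le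
    · exact hS' _ (by omega)

theorem joined_word {p : RACG adj} {l : List V} (h : ∀ l₁ l₂, l = l₁ ++ l₂ → p * wprod adj l₁ ∈ S) :
    Joined S l.length p (p * wprod adj l) := by
  refine ⟨fun t => p * wprod adj (l.take t), by simp, by simp, fun t _ => ?_,
    fun t _ => h _ (l.drop t) (by simp)⟩
  beta_reduce
  rw [List.take_add_one, wprod_append, ← mul_assoc]
  refine (rd_mul_wprod_le _ _).trans ?_
  cases l[t]? <;> simp

theorem joined_line {p : RACG adj} {i : ℤ} (h : ∀ j : ℤ, |j| ≤ |i| → p * line adj s t j ∈ S) :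
    Joined S i.natAbs p (p * line adj s t i) := by
  have hmul : i.sign * i.natAbs = i := Int.sign_mul_natAbs i
  refine ⟨fun n => p * line adj s t (i.sign * n), by simp, by beta_reduce; rw [hmul],
    fun n _ => ?_, fun n hn => h _ ?_⟩
  · beta_reduce
    rw [rd_mul_left]
    have h1 := rd_line_le (adj := adj) (s := s) (t := t) (i.sign * n) (i.sign * (n + 1 : ℕ))
    have h2 : i.sign * (n : ℤ) - i.sign * (n + 1 : ℕ) = - i.sign := by push_cast; ring
    rw [h2, abs_neg] at h1
    have h3 : |i.sign| ≤ 1 := by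
      rcases Int.sign_trichotomy i with h | h | h <;> rw [h] <;> simp
    omega
  · rw [abs_mul, Nat.abs_cast]
    rcases Int.sign_trichotomy i with h | h | h <;> rw [h] <;> simp <;> rw [← Int.natCast_natAbs] <;>
      exact_mod_cast hn

end Joined

section Product

variable {V : Type} {adj : V → V → Prop} {a b : V}

theorem commute_gen_line {v : V} (ha : adj v a) (hb : adj v b) (i : ℤ) :
    Commute (gen adj v) (line adj a b i) := by
  unfold line
  have ha : Commute (gen adj v) (gen adj a) := gen_comm ha
  have hb : Commute (gen adj v) (gen adj b) := gen_comm hb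
  refine ((ha.mul_right hb).zpow_right _).mul_right ?_
  split_ifs
  exacts [Commute.one_right _, ha]

theorem wprod_eq_mul_line (hab : ∀ v, v ≠ a → v ≠ b → adj v a ∧ adj v b) (l : List V) :
    ∃ l' i, (∀ v ∈ l', v ≠ a ∧ v ≠ b) ∧ l'.length ≤ l.length ∧
      wprod adj l = wprod adj l' * line adj a b i := by
  induction l using List.reverseRecOn with
  | nil => exact ⟨[], 0, by simp⟩
  | append_singleton l v ih =>
    obtain ⟨l', i, h1, h2, h3⟩ := ih
    simp only [wprod_append, wprod_cons, wprod_nil, mul_one, h3, List.length_append,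
      List.length_singleton]
    by_cases hva : v = a
    · subst hva
      exact ⟨l', _, h1, by omega, by rw [mul_assoc, line_mul_left]⟩
    by_cases hvb : v = b
    · subst hvb
      exact ⟨l', _, h1, by omega, by rw [mul_assoc, line_mul_right]⟩
    · refine ⟨l' ++ [v], i, ?_, by simpa using h2, ?_⟩
      · simp only [List.mem_append, List.mem_singleton]
        rintro w (hw | rfl)
        exacts [h1 w hw, ⟨hva, hvb⟩]
      · have hc := commute_gen_line (hab v hva hvb).1 (hab v hva hvb).2 i
        simp only [wprod_append, wprod_cons, wprod_nil, mul_one, mul_assoc]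
        rw [hc.eq]

theorem posHom_wprod_of_ne (h : Indep adj a b) {l : List V} (hl : ∀ v ∈ l, v ≠ a ∧ v ≠ b) :
    posHom h (wprod adj l) = 1 := by
  induction l with
  | nil => simp
  | cons v l ih =>
    simp only [List.mem_cons, forall_eq_or_imp] at hl
    rw [wprod_cons, map_mul, ih hl.2, posHom_other h hl.1.1 hl.1.2, mul_one]

/-- The graph is the join of `{a, b}` with three pairwise non-adjacent vertices. -/
structure JoinThree (adj : V → V → Prop) (a b : V) (c : Fin 3 → V) : Prop where
  ab : Indep adj a b
  cc : ∀ i j, i ≠ j → Indep adj (c i) (c j)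
  ca : ∀ i, c i ≠ a
  cb : ∀ i, c i ≠ b
  comm : ∀ v, v ≠ a → v ≠ b → adj v a ∧ adj v b

variable {c : Fin 3 → V}

theorem JoinThree.posHom_line_ab (H : JoinThree adj a b c) {i j : Fin 3} (hij : i ≠ j) (m : ℤ) :
    posHom (H.cc i j hij) (line adj a b m) = 1 :=
  map_line _ (posHom_other _ (H.ca i).symm (H.ca j).symm)
    (posHom_other _ (H.cb i).symm (H.cb j).symm) m

theorem pos_line_right {s t u : V} (h : Indep adj s t) (hs : u ≠ s) (ht : u ≠ t) (m : ℤ) :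
    pos h (line adj t u m) = 0 ∨ pos h (line adj t u m) = -1 := by
  unfold line pos
  have h1 : posHom h (gen adj t) * posHom h (gen adj t) = 1 := by
    rw [← map_mul, gen_mul_self, map_one]
  have h2 : (posHom h (gen adj t)) ^ (m / 2) = 1 ∨
      (posHom h (gen adj t)) ^ (m / 2) = posHom h (gen adj t) := by
    rcases Int.even_or_odd' (m / 2) with ⟨k, hk | hk⟩ <;> rw [hk]
    · left
      rw [zpow_mul, zpow_two, h1, one_zpow]
    · right
      rw [zpow_add, zpow_mul, zpow_two, h1, one_zpow, one_mul, zpow_one]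
  rw [map_mul, map_zpow, map_mul, posHom_other h hs ht, mul_one]
  split_ifs <;> rcases h2 with h2 | h2 <;> rw [h2] <;> simp [posHom_right, h1]

theorem JoinThree.ray_separation (H : JoinThree adj a b c) (i : Fin 3) (r : ℕ) (m m' : ℤ) :
    r ≤ rd (line adj (c i) (c (i + 1)) r * line adj a b m)
      (line adj (c (i + 1)) (c (i + 2)) r * line adj a b m') := by
  have h01 : i ≠ i + 1 := by fin_cases i <;> decide
  have h20 : i + 2 ≠ i := by fin_cases i <;> decide
  have h21 : i + 2 ≠ i + 1 := by fin_cases i <;> decide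
  have h := H.cc i (i + 1) h01
  have h1 := abs_pos_sub_le h (line adj (c i) (c (i + 1)) r * line adj a b m)
      (line adj (c (i + 1)) (c (i + 2)) r * line adj a b m')
  have h2 := pos_line_right (u := c (i + 2)) h (H.cc _ _ h20).ne (H.cc _ _ h21).ne r
  have hm : ∀ m, pos h (line adj a b m) = 0 := fun m => by
    rw [pos, H.posHom_line_ab h01, Equiv.Perm.one_apply]
  rw [pos_mul, hm, ← pos, pos_line, pos_mul, hm, ← pos, abs_le] at h1
  omega

theorem JoinThree.ray_separation' (H : JoinThree adj a b c) {i j : Fin 3} (hij : i ≠ j) (r : ℕ)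
    (m m' : ℤ) : r ≤ rd (line adj (c i) (c (i + 1)) r * line adj a b m)
      (line adj (c j) (c (j + 1)) r * line adj a b m') := by
  have : j = i + 1 ∨ i = j + 1 := by
    revert i j
    decide
  rcases this with rfl | rfl
  · rw [show i + 1 + 1 = i + 2 by rw [add_assoc]; rfl]
    exact H.ray_separation i r m m'
  · rw [rd_comm]
    rw [show j + 1 + 1 = j + 2 by rw [add_assoc]; rfl]
    exact H.ray_separation j r m' m

theorem JoinThree.exists_ray (H : JoinThree adj a b c) (p v₁ v₂ : RACG adj) (r : ℕ) :
    ∃ i : Fin 3, ∀ m, r ≤ rd (p * line adj (c i) (c (i + 1)) (2 * r : ℕ) * line adj a b m) v₁ ∧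
      r ≤ rd (p * line adj (c i) (c (i + 1)) (2 * r : ℕ) * line adj a b m) v₂ := by
  have key : ∀ (v : RACG adj) (i j : Fin 3), i ≠ j → ∀ m m',
      rd (p * line adj (c i) (c (i + 1)) (2 * r : ℕ) * line adj a b m) v < r →
      rd (p * line adj (c j) (c (j + 1)) (2 * r : ℕ) * line adj a b m') v < r → False := by
    intro v i j hij m m' h1 h2
    have h3 := H.ray_separation' hij (2 * r) m m'
    rw [← rd_mul_left p, ← mul_assoc, ← mul_assoc] at h3
    have h4 := rd_triangle (p * line adj (c i) (c (i + 1)) (2 * r : ℕ) * line adj a b m) v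
      (p * line adj (c j) (c (j + 1)) (2 * r : ℕ) * line adj a b m')
    rw [rd_comm v] at h4
    omega
  by_contra! hc
  have hb : ∀ i, ∃ (k : Bool) (m : ℤ),
      rd (p * line adj (c i) (c (i + 1)) (2 * r : ℕ) * line adj a b m) (bif k then v₁ else v₂) < r := by
    intro i
    obtain ⟨m, hm⟩ := hc i
    by_cases h : r ≤ rd (p * line adj (c i) (c (i + 1)) (2 * r : ℕ) * line adj a b m) v₁
    · exact ⟨false, m, hm h⟩
    · exact ⟨true, m, not_le.1 h⟩
  choose k m hm using hb
  obtain ⟨i, j, hij, hk⟩ := Fintype.exists_ne_map_eq_of_card_lt k (by simp)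
  exact key _ i j hij _ _ (hm i) (hk ▸ hm j)

/-- In the product of a line and a tree, two points can be joined avoiding two distant balls. -/
theorem JoinThree.detour (H : JoinThree adj a b c) {p p' v₁ v₂ : RACG adj} {r : ℕ}
    (h₁ : 5 * r ≤ rd p v₁) (h₂ : 5 * r ≤ rd p v₂) (h₁' : 5 * r ≤ rd p' v₁) (h₂' : 5 * r ≤ rd p' v₂) :
    ∃ n ≤ 3 * rd p p' + 24 * r, Joined {g | r ≤ rd g v₁ ∧ r ≤ rd g v₂} n p p' := by
  set S : Set (RACG adj) := {g | r ≤ rd g v₁ ∧ r ≤ rd g v₂} with hS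
  have hposle := fun g => abs_pos_sub_le H.ab g
  obtain ⟨L, hL, hL₁, hL₂⟩ : ∃ L : ℤ, |L - pos H.ab p| ≤ 4 * r ∧ r ≤ |L - pos H.ab v₁| ∧
      r ≤ |L - pos H.ab v₂| := by
    by_contra! hc
    have e0 := hc (pos H.ab p) (by simp)
    have e1 := hc (pos H.ab p + 2 * r) (by rw [abs_le]; omega)
    have e2 := hc (pos H.ab p + 4 * r) (by rw [abs_le]; omega)
    simp only [abs_lt, le_abs] at e0 e1 e2
    omega
  have climb : ∀ q : RACG adj, 5 * r ≤ rd q v₁ → 5 * r ≤ rd q v₂ → ∃ n P, Joined S n q P ∧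
      pos H.ab P = L ∧ (n : ℤ) ≤ 2 * r + |L - pos H.ab q| := by
    intro q hq₁ hq₂
    obtain ⟨i, hi⟩ := H.exists_ray q v₁ v₂ r
    have hii : i ≠ i + 1 := by fin_cases i <;> decide
    obtain ⟨m, hm, hml⟩ : ∃ m : ℤ, posHom H.ab q m = L ∧ |m| = |L - pos H.ab q| := by
      refine ⟨(posHom H.ab q).symm L, by simp, ?_⟩
      have := abs_posHom_sub H.ab q ((posHom H.ab q).symm L) 0
      rw [Equiv.apply_symm_apply, ← pos, sub_zero] at this
      exact this.symm
    have e1 : Joined S _ q (q * line adj (c i) (c (i + 1)) (2 * r : ℕ)) := joined_line fun j hj => by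
      have e2 := rd_line_le (adj := adj) (s := c i) (t := c (i + 1)) 0 j
      rw [line_zero, ← rd_mul_left q, mul_one, zero_sub, abs_neg] at e2
      rw [Nat.abs_cast] at hj
      have e3 := rd_triangle q (q * line adj (c i) (c (i + 1)) j) v₁
      have e4 := rd_triangle q (q * line adj (c i) (c (i + 1)) j) v₂
      constructor <;> omega
    have e2 : Joined S _ (q * line adj (c i) (c (i + 1)) (2 * r : ℕ))
        (q * line adj (c i) (c (i + 1)) (2 * r : ℕ) * line adj a b m) :=
      joined_line fun j _ => hi j
    refine ⟨_, _, e1.trans e2, ?_, ?_⟩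
    · rw [pos_mul, map_mul, map_line (posHom H.ab) (posHom_other _ (H.ca _) (H.cb _))
        (posHom_other _ (H.ca _) (H.cb _)), mul_one, pos_line, hm]
    · rw [← hml]
      push_cast
      rw [abs_of_nonneg (by omega)]
  obtain ⟨n, P, hP, hPL, hn⟩ := climb p h₁ h₂
  obtain ⟨n', P', hP', hPL', hn'⟩ := climb p' h₁' h₂'
  obtain ⟨l, hl, hlP⟩ := exists_word P P'
  obtain ⟨l', i, hl', hll, hli⟩ := wprod_eq_mul_line H.comm l
  have hi : i = 0 := by
    rw [hlP, hli, pos_mul, pos_mul, posHom_wprod_of_ne H.ab hl', Equiv.Perm.one_apply, pos_line,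
      ← hPL, pos, (posHom H.ab P).injective.eq_iff] at hPL'
    exact hPL'
  rw [hi, line_zero, mul_one] at hli
  have hJ : Joined S l'.length P P' := by
    rw [hlP, hli]
    refine joined_word fun l₁ l₂ hl₁ => ?_
    have e1 : pos H.ab (P * wprod adj l₁) = L := by
      rw [pos_mul, pos, posHom_wprod_of_ne H.ab fun v hv => hl' v (by simp [hl₁, hv]),
        Equiv.Perm.one_apply, ← pos, hPL]
    have e2 := hposle (P * wprod adj l₁) v₁
    have e3 := hposle (P * wprod adj l₁) v₂
    rw [e1] at e2 e3
    constructor <;> omega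
  have hdist : ∀ {n q q'}, Joined S n q q' → rd q q' ≤ n := by
    rintro n q q' ⟨m, rfl, rfl, hm, -⟩
    simpa using rd_le_of_steps hm 0 n (by simp)
  refine ⟨_, ?_, (hP.trans hJ).trans hP'.symm⟩
  have e1 := hdist hP
  have e2 := hdist hP'
  have e3 := rd_triangle P p P'
  have e4 := rd_triangle p p' P'
  rw [rd_comm P p] at e3
  have e5 := hposle p p'
  have e6 : |L - pos H.ab p'| ≤ 4 * r + rd p p' := by
    have := abs_sub_le L (pos H.ab p) (pos H.ab p')
    omega
  omega

end Product

section CutLines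

variable {V V' : Type} {adj : V → V → Prop} {adj' : V' → V' → Prop} {a x y b : V'}
  {d e : V} {w : Fin 3 → V} {f : RACG adj → RACG adj'} {K : ℕ}

/-- A quasi-isometric embedding with normalized constants. -/
structure QIEmb (K : ℕ) (f : RACG adj → RACG adj') : Prop where
  one_le : 1 ≤ K
  upper : ∀ p p', rd (f p) (f p') ≤ K * rd p p'
  lower : ∀ p p', rd p p' ≤ K * rd (f p) (f p') + K

theorem QIEmb.not_near_line (hf : QIEmb K f) (HX : JoinThree adj d e w) (H : HypPath adj' a x y b)
    {M s ρ : ℕ} (hs : 8 * K * (6 * M + 24) < s) (hρ : ρ + 1 ≤ 8 * (K * s)) {c : RACG adj'}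
    {u v w : RACG adj} {i₁ n i₂ : ℤ} (hu : rd (f u) (c * line adj' y a i₁) ≤ ρ)
    (hv : rd (f v) (c * line adj' y a n) ≤ ρ) (hw : rd (f w) (c * line adj' y a i₂) ≤ ρ)
    (h₁ : i₁ ≤ n) (h₂ : n ≤ i₂) (huv : 5 * (16 * K ^ 2 * s) ≤ rd u v)
    (hwv : 5 * (16 * K ^ 2 * s) ≤ rd w v) (huw : rd u w ≤ 2 * (M * (16 * K ^ 2 * s))) : False := by
  have hK := hf.one_le
  obtain ⟨N, hN, m, rfl, rfl, hm, hav⟩ := HX.detour huv huv hwv hwv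
  have hgap : ∀ {z : RACG adj} {i : ℤ}, rd (f z) (c * line adj' y a i) ≤ ρ →
      5 * (16 * K ^ 2 * s) ≤ rd z v → ρ + 8 * (K * s : ℕ) ≤ |i - n| := by
    intro z i hz hzv
    have h1 := hf.lower z v
    have h2 := rd_triangle (f z) (c * line adj' y a i) (f v)
    have h3 := rd_triangle (c * line adj' y a i) (c * line adj' y a n) (f v)
    rw [rd_mul_left, rd_comm (c * line adj' y a n) (f v)] at h3
    have h4 := rd_line_le (adj := adj') (s := y) (t := a) i n
    have h5 : K * (80 * (K * s)) ≤ K * (rd (f z) (f v) + 1) := by linarith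
    have h6 := Nat.le_of_mul_le_mul_left h5 (by omega)
    omega
  have h1 := hgap hu huv
  have h2 := hgap hw hwv
  rw [abs_of_nonpos (by omega)] at h1
  rw [abs_of_nonneg (by omega)] at h2
  have h3 := H.divergence (K := K) (s := s) (N := N) (ρ := ρ) hK
    (by nlinarith) (q := fun t => f (m t)) (fun t ht => by
      have := hf.upper (m t) (m (t + 1))
      have := Nat.mul_le_mul_left K (hm t ht)
      omega) hu hw (n := n) (fun t ht => by
      have e1 := hf.lower (m t) v
      have e2 := (hav t ht).1
      have e3 := rd_triangle (f (m t)) (c * line adj' y a n) (f v)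
      rw [rd_comm (c * line adj' y a n) (f v)] at e3
      have h5 : K * (16 * (K * s)) ≤ K * (rd (f (m t)) (f v) + 1) := by linarith
      have h6 := Nat.le_of_mul_le_mul_left h5 (by omega)
      omega) (by push_cast at h1; linarith) (by push_cast at h2; linarith)
  have h4 : 2 * K * s * s ≤ 2 * K * s * (8 * K * (6 * M + 24)) := by nlinarith
  have h5 := Nat.le_of_mul_le_mul_left h4 (Nat.mul_pos (by omega) (by omega))
  omega

theorem QIEmb.not_three_near_line (hf : QIEmb K f) (HX : JoinThree adj d e w)
    (H : HypPath adj' a x y b) {M s ρ : ℕ} (hs : 8 * K * (6 * M + 24) < s)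
    (hρ : ρ + 1 ≤ 8 * (K * s)) {c : RACG adj'} {u : Fin 3 → RACG adj}
    (hu : ∀ k, ∃ i, rd (f (u k)) (c * line adj' y a i) ≤ ρ)
    (hfar : ∀ k l, k ≠ l → 5 * (16 * K ^ 2 * s) ≤ rd (u k) (u l))
    (hnear : ∀ k l, rd (u k) (u l) ≤ 2 * (M * (16 * K ^ 2 * s))) : False := by
  choose i hi using hu
  have key : ∀ k l m : Fin 3, k ≠ l → m ≠ l → i k ≤ i l → i l ≤ i m → False :=
    fun k l m hkl hml h1 h2 => hf.not_near_line HX H hs hρ (hi k) (hi l) (hi m) h1 h2 (hfar k l hkl)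
      (hfar m l hml) (hnear k m)
  rcases le_total (i 0) (i 1) with h01 | h01 <;> rcases le_total (i 1) (i 2) with h12 | h12 <;>
    rcases le_total (i 0) (i 2) with h02 | h02
  · exact key 0 1 2 (by decide) (by decide) h01 h12
  · exact key 0 1 2 (by decide) (by decide) h01 h12
  · exact key 0 2 1 (by decide) (by decide) h02 h12
  · exact key 2 0 1 (by decide) (by decide) h02 h01
  · exact key 1 0 2 (by decide) (by decide) h01 h02
  · exact key 1 2 0 (by decide) (by decide) h12 h02
  · exact key 2 1 0 (by decide) (by decide) h12 h01
  · exact key 2 1 0 (by decide) (by decide) h12 h01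

theorem HypPath.near_of_mem_star (H : HypPath adj' a x y b) {c z : RACG adj'}
    (hz : c⁻¹ * z ∈ star adj' x) : ∃ i, rd z (c * line adj' y a i) ≤ 1 := by
  obtain ⟨i, hi | hi⟩ := eq_line_of_mem_star (fun u hu => (H.nx u hu).symm) hz <;>
    rw [inv_mul_eq_iff_eq_mul] at hi <;> subst hi
  · exact ⟨i, by simp⟩
  · refine ⟨i, ?_⟩
    rw [rd_comm, ← mul_assoc]
    exact rd_mul_gen_le _ _

theorem QIEmb.exists_crossing_near (hf : QIEmb K f) (H : HypPath adj' a x y b) {c : RACG adj'}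
    {m : ℕ → RACG adj} {n : ℕ} (hm : ∀ t < n, rd (m t) (m (t + 1)) ≤ 1)
    (hne : side x c (f (m 0)) ≠ side x c (f (m n))) :
    ∃ t ≤ n, ∃ i, rd (f (m t)) (c * line adj' y a i) ≤ K + 1 := by
  obtain ⟨t, -, ht, hne⟩ := exists_step_ne (f := fun t => side x c (f (m t))) (Nat.zero_le n) hne
  obtain ⟨z, hz, hd⟩ := exists_mem_wall hne
  obtain ⟨i, hi⟩ := H.near_of_mem_star hz
  refine ⟨t, ht.le, i, ?_⟩
  have h1 := hf.upper (m t) (m (t + 1))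
  have h2 := Nat.mul_le_mul_left K (hm t ht)
  have h3 := rd_triangle (f (m t)) z (c * line adj' y a i)
  omega

theorem QIEmb.geodesic_near_line_le (hf : QIEmb K f) (HX : JoinThree adj d e w)
    (H : HypPath adj' a x y b) {R D : ℕ} (hR : 1152 * K + 1 ≤ R) {m : ℕ → RACG adj} {c : RACG adj'}
    (hmeq : ∀ t t', t ≤ t' → t' ≤ D → rd (m t) (m t') = t' - t)
    (h_int : ∀ t, 0 < t → t < D → ∃ i, rd (f (m t)) (c * line adj' y a i) ≤ R) :
    D ≤ 160 * K ^ 2 * (2 * R) + 4 := by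
  have hK := hf.one_le
  by_contra! hDR
  obtain ⟨σ, hσ⟩ : ∃ σ, σ = (D - 4) / (160 * K ^ 2) := ⟨_, rfl⟩
  have hpos : 0 < 160 * K ^ 2 := by positivity
  have hσ1 : 160 * K ^ 2 * σ ≤ D - 4 := hσ ▸ Nat.mul_div_le _ _
  have hσ2 : D - 4 < 160 * K ^ 2 * (σ + 1) := by
    rw [hσ]
    exact Nat.lt_mul_div_succ _ hpos
  have hσ3 : 2 * R ≤ σ := by
    rw [hσ, Nat.le_div_iff_mul_le hpos, mul_comm]
    omega
  have hσ4 : R + 1 ≤ 8 * (K * σ) := by nlinarith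
  have hσ5 : 2 * K ^ 2 ≤ K ^ 2 * σ := by nlinarith
  have hσ6 : 160 * K ^ 2 * (σ + 1) = 160 * (K ^ 2 * σ) + 160 * K ^ 2 := by ring
  rw [mul_assoc] at hσ1
  rw [hσ6] at hσ2
  obtain ⟨h, hh⟩ : ∃ h, h = D / 2 := ⟨_, rfl⟩
  have hD2 : D ≤ 320 * (K ^ 2 * σ) := by omega
  refine hf.not_three_near_line HX H (M := 10) (s := σ) (ρ := R) (by nlinarith) hσ4
    (u := ![m 1, m h, m (D - 1)]) (c := c) ?_ ?_ ?_
  · intro k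
    fin_cases k
    · exact h_int 1 (by omega) (by omega)
    · exact h_int h (by omega) (by omega)
    · exact h_int (D - 1) (by omega) (by omega)
  · have e1 := hmeq 1 h (by omega) (by omega)
    have e2 := hmeq h (D - 1) (by omega) (by omega)
    have e3 := hmeq 1 (D - 1) (by omega) (by omega)
    have e4 : 5 * (16 * K ^ 2 * σ) ≤ (D - 4) / 2 := by
      rw [mul_assoc 16]
      omega
    intro k l hkl
    fin_cases k <;> fin_cases l <;> simp at hkl ⊢
    · omega
    · omega
    · rw [rd_comm]; omega
    · omega
    · rw [rd_comm]; omega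
    · rw [rd_comm]; omega
  · have e1 := hmeq 1 h (by omega) (by omega)
    have e2 := hmeq h (D - 1) (by omega) (by omega)
    have e3 := hmeq 1 (D - 1) (by omega) (by omega)
    have e4 : D ≤ 2 * (10 * (16 * K ^ 2 * σ)) := by linarith
    intro k l
    fin_cases k <;> fin_cases l <;> simp
    · omega
    · omega
    · rw [rd_comm]; omega
    · omega
    · rw [rd_comm]; omega
    · rw [rd_comm]; omega

/-- A quasi-isometrically embedded product of a line and a tree lies coarsely on one side of each
wall dual to an interior vertex of a hyperbolic path. -/
theorem QIEmb.one_sided (hf : QIEmb K f) (HX : JoinThree adj d e w) (H : HypPath adj' a x y b) :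
    ∃ R : ℕ, ∀ c p p', side x c (f p) ≠ side x c (f p') →
      (∃ i, rd (f p) (c * line adj' y a i) < R) ∨ ∃ i, rd (f p') (c * line adj' y a i) < R := by
  have hK := hf.one_le
  obtain ⟨M, hM⟩ : ∃ M, M = 50000 * K ^ 3 := ⟨_, rfl⟩
  obtain ⟨s, hs⟩ : ∃ s, s = 8 * K * (6 * M + 24) + 1152 * K + 1 := ⟨_, rfl⟩
  obtain ⟨R, hR⟩ : ∃ R, R = 400 * K ^ 3 * s + K + 1 := ⟨_, rfl⟩
  refine ⟨R, fun c p p' => ?_⟩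
  obtain ⟨D, hD⟩ : ∃ D, rd p p' = D := ⟨_, rfl⟩
  induction D using Nat.strong_induction_on generalizing p p' with | _ D ih
  intro hne
  by_contra! hfar
  obtain ⟨hp, hp'⟩ := hfar
  have hKs : s ≤ K * s := Nat.le_mul_of_pos_left _ hK
  have hK1 : K ≤ K ^ 2 := Nat.le_self_pow (by omega) K
  have hK2 : K ^ 2 * s ≤ K ^ 3 * s := Nat.mul_le_mul_right _ (Nat.pow_le_pow_right hK (by omega))
  have hK3 : s ≤ K ^ 2 * s := Nat.le_mul_of_pos_left _ (by positivity)
  have hDR : D ≤ 160 * K ^ 2 * (2 * R) + 4 := by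
    by_contra! hDR
    obtain ⟨m, hm0, hmD, hm⟩ := exists_geodesic p p'
    rw [hD] at hmD
    have hmle : ∀ t t', t ≤ t' → rd (m t) (m t') ≤ t' - t := fun t t' h => by
      obtain ⟨i, rfl⟩ := Nat.le.dest h
      have := rd_le_of_steps (m := m) (K := 1) (N := t + i) (fun t _ => hm t) t i le_rfl
      omega
    have hmeq : ∀ t t', t ≤ t' → t' ≤ D → rd (m t) (m t') = t' - t := fun t t' h h' => by
      have e1 := hmle t t' h
      have e2 := hmle 0 t (Nat.zero_le _)
      have e3 := hmle t' D h'
      have e4 := rd_triangle p (m t) p'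
      have e5 := rd_triangle (m t) (m t') p'
      rw [hm0] at e2
      rw [hmD] at e3
      omega
    have h_int : ∀ t, 0 < t → t < D → ∃ i, rd (f (m t)) (c * line adj' y a i) ≤ R := by
      intro t ht htD
      have e1 := hmle 0 t (Nat.zero_le _)
      have e2 := hmle t D htD.le
      rw [hm0] at e1
      rw [hmD] at e2
      by_cases hst : side x c (f p) = side x c (f (m t))
      · rcases ih _ (by omega) (m t) p' rfl (hst ▸ hne) with ⟨i, hi⟩ | ⟨i, hi⟩
        · exact ⟨i, hi.le⟩
        · exact absurd hi (hp' i).not_gt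
      · rcases ih _ (by omega) p (m t) rfl hst with ⟨i, hi⟩ | ⟨i, hi⟩
        · exact absurd hi (hp i).not_gt
        · exact ⟨i, hi.le⟩
    exact hDR.not_ge (hf.geodesic_near_line_le HX H (by nlinarith) hmeq h_int)
  have hfar : ∀ q : RACG adj, (∀ i, R ≤ rd (f q) (c * line adj' y a i)) → ∀ v i,
      rd (f v) (c * line adj' y a i) ≤ K + 1 → 5 * (5 * (16 * K ^ 2 * s)) ≤ rd q v := by
    intro q hq v i hv
    have e1 := hq i
    have e2 := rd_triangle (f q) (f v) (c * line adj' y a i)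
    have e3 := hf.upper q v
    have e4 : K * (5 * (5 * (16 * K ^ 2 * s))) ≤ K * rd q v := by
      rw [show K * (5 * (5 * (16 * K ^ 2 * s))) = 400 * K ^ 3 * s by ring]
      omega
    exact Nat.le_of_mul_le_mul_left e4 (by omega)
  have cross : ∀ v₁ v₂, (∃ i, rd (f v₁) (c * line adj' y a i) ≤ K + 1) →
      (∃ i, rd (f v₂) (c * line adj' y a i) ≤ K + 1) → ∃ v₃, 5 * (16 * K ^ 2 * s) ≤ rd v₃ v₁ ∧
      5 * (16 * K ^ 2 * s) ≤ rd v₃ v₂ ∧ (∃ i, rd (f v₃) (c * line adj' y a i) ≤ K + 1) ∧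
      rd p v₃ ≤ 3 * D + 24 * (5 * (16 * K ^ 2 * s)) := by
    rintro v₁ v₂ ⟨i₁, hi₁⟩ ⟨i₂, hi₂⟩
    obtain ⟨n, hn, m, h0, hn', hm, hav⟩ := HX.detour (hfar p hp _ _ hi₁) (hfar p hp _ _ hi₂)
      (hfar p' hp' _ _ hi₁) (hfar p' hp' _ _ hi₂)
    rw [← h0, ← hn'] at hne
    obtain ⟨t, ht, hi⟩ := hf.exists_crossing_near H hm hne
    refine ⟨m t, (hav t ht).1, (hav t ht).2, hi, ?_⟩
    have := rd_le_of_steps hm 0 t (by omega)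
    rw [zero_add, h0] at this
    omega
  obtain ⟨v₁, hv₁, hd₁⟩ : ∃ v, (∃ i, rd (f v) (c * line adj' y a i) ≤ K + 1) ∧ rd p v ≤ D := by
    obtain ⟨m, h0, hn', hm⟩ := exists_geodesic p p'
    rw [← h0, ← hn'] at hne
    obtain ⟨t, ht, hi⟩ := hf.exists_crossing_near H (fun t _ => hm t) hne
    refine ⟨m t, hi, ?_⟩
    have := rd_le_of_steps (N := t) (fun t _ => hm t) 0 t (by omega)
    rw [zero_add, h0] at this
    omega
  obtain ⟨v₂, h21, -, hv₂, hd₂⟩ := cross v₁ v₁ hv₁ hv₁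
  obtain ⟨v₃, h31, h32, hv₃, hd₃⟩ := cross v₁ v₂ hv₁ hv₂
  have hbd : 3 * D + 24 * (5 * (16 * K ^ 2 * s)) ≤ M * (16 * K ^ 2 * s) := by
    have e1 : R ≤ 402 * (K ^ 3 * s) := by
      have : K ^ 2 ≤ K ^ 2 * s := Nat.le_mul_of_pos_right _ (by omega)
      rw [hR, mul_assoc]
      omega
    have e2 : D ≤ 130000 * (K ^ 5 * s) := by
      have e3 : 160 * K ^ 2 * (2 * R) ≤ 160 * K ^ 2 * (2 * (402 * (K ^ 3 * s))) := by gcongr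
      have e4 : 160 * K ^ 2 * (2 * (402 * (K ^ 3 * s))) = 128640 * (K ^ 5 * s) := by ring
      have e5 : 1 ≤ K ^ 5 * s := Nat.mul_pos (by positivity) (by omega)
      omega
    have e3 : K ^ 2 * s ≤ K ^ 5 * s := Nat.mul_le_mul_right _ (Nat.pow_le_pow_right hK (by omega))
    rw [hM, show 50000 * K ^ 3 * (16 * K ^ 2 * s) = 800000 * (K ^ 5 * s) by ring,
      mul_assoc 16]
    omega
  have hdist : ∀ v v', rd p v ≤ 3 * D + 24 * (5 * (16 * K ^ 2 * s)) →
      rd p v' ≤ 3 * D + 24 * (5 * (16 * K ^ 2 * s)) → rd v v' ≤ 2 * (M * (16 * K ^ 2 * s)) := by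
    intro v v' h h'
    have := rd_triangle v p v'
    rw [rd_comm v p] at this
    omega
  have hd₁' : rd p v₁ ≤ 3 * D + 24 * (5 * (16 * K ^ 2 * s)) := by omega
  have hall : ∀ k, rd p (![v₁, v₂, v₃] k) ≤ 3 * D + 24 * (5 * (16 * K ^ 2 * s)) := by
    intro k
    fin_cases k
    exacts [hd₁', hd₂, hd₃]
  refine hf.not_three_near_line HX H (M := M) (s := s) (ρ := K + 1) (by omega) (by nlinarith)
    (u := ![v₁, v₂, v₃]) (c := c) ?_ ?_ fun k l => hdist _ _ (hall k) (hall l)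
  · intro k
    fin_cases k
    exacts [hv₁, hv₂, hv₃]
  · intro k l hkl
    fin_cases k <;> fin_cases l <;> simp only [Fin.zero_eta, Fin.mk_one, Fin.reduceFinMk, ne_eq,
      not_true_eq_false] at hkl
    exacts [rd_comm v₂ v₁ ▸ h21, rd_comm v₃ v₁ ▸ h31, h21, rd_comm v₃ v₂ ▸ h32, h31, h32]

end CutLines

section Surjective

variable {V V' : Type} {adj : V → V → Prop} {adj' : V' → V' → Prop} {a x y b : V'}
  {d e : V} {w : Fin 3 → V} {f : RACG adj → RACG adj'} {K : ℕ}

theorem QIEmb.not_coarsely_surjective (hf : QIEmb K f) (HX : JoinThree adj d e w)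
    (H : HypPath adj' a x y b) (C : ℕ) (hC : ∀ g, ∃ p, rd (f p) g ≤ C) : False := by
  obtain ⟨R, hR⟩ := hf.one_sided HX H
  have hxb := H.symm.indep
  obtain ⟨p, hp⟩ := hC (line adj' x b (R + C + 2 : ℕ))
  obtain ⟨p', hp'⟩ := hC (line adj' x b (-(R + C + 2 : ℕ)))
  have hfar : ∀ q (i : ℤ), rd (f q) (line adj' x b i) ≤ C → (R + C + 2 : ℕ) ≤ |i| →
      ∀ j, ¬ rd (f q) (1 * line adj' y a j) < R := by
    intro q i hq hi j hj
    have h1 := abs_pos_sub_le hxb (line adj' x b i) (line adj' y a j)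
    rw [pos_line, pos, map_line (posHom hxb) (posHom_other hxb H.xy.symm H.yb)
      (posHom_other hxb H.ax H.ab.ne), Equiv.Perm.one_apply, sub_zero] at h1
    have h2 := rd_triangle (line adj' x b i) (f q) (line adj' y a j)
    rw [rd_comm _ (f q)] at h2
    rw [one_mul] at hj
    omega
  have hside : ∀ q (i : ℤ), rd (f q) (line adj' x b i) ≤ C → (R + C + 2 : ℕ) ≤ |i| →
      side x 1 (f q) = side x 1 (line adj' x b i) := by
    intro q i hq hi
    have := side_eq_of_near hxb (c := 1) (q := f q) (i := i) (k := 0) (ρ := C) (by rwa [one_mul])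
      (by rcases le_abs.1 hi with h | h <;> omega)
    simpa using this
  have hne : side x 1 (f p') ≠ side x 1 (f p) := by
    rw [hside _ _ hp (le_abs_self _), hside _ _ hp' (by rw [abs_neg]; exact le_abs_self _)]
    have := side_line_ne hxb 1 (k := 0) (i := -(R + C + 2 : ℕ)) (j := (R + C + 2 : ℕ)) (by omega)
      (by omega)
    simpa using this
  rcases hR 1 p' p hne with ⟨i, hi⟩ | ⟨i, hi⟩
  · exact hfar _ _ hp' (by rw [abs_neg]; exact le_abs_self _) _ hi
  · exact hfar _ _ hp (le_abs_self _) _ hi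

end Surjective

section Geodesics

variable {V : Type} {adj : V → V → Prop}

/-- The word `l` is geodesic. -/
def Geod (adj : V → V → Prop) (l : List V) : Prop := rd 1 (wprod adj l) = l.length

theorem geod_iff {l : List V} (u : RACG adj) : Geod adj l ↔ rd u (u * wprod adj l) = l.length := by
  rw [Geod, ← rd_mul_left u, mul_one]

theorem Geod.append_left {l₁ l₂ : List V} (h : Geod adj (l₁ ++ l₂)) : Geod adj l₁ := by
  have h1 := rd_triangle 1 (wprod adj l₁) (wprod adj (l₁ ++ l₂))
  have h2 := rd_mul_wprod_le (adj := adj) 1 l₁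
  have h3 := rd_mul_wprod_le (wprod adj l₁) l₂
  rw [one_mul] at h2
  rw [← wprod_append] at h3
  rw [Geod, List.length_append] at h
  rw [Geod]
  omega

theorem Geod.reverse {l : List V} (h : Geod adj l) : Geod adj l.reverse := by
  rw [geod_iff (wprod adj l), wprod_reverse, mul_inv_cancel, rd_comm, List.length_reverse]
  exact h

theorem Geod.side_ne {v : V} {l₁ l₂ : List V} (h : Geod adj (l₁ ++ v :: l₂)) {u c : RACG adj}
    (hc : c⁻¹ * (u * wprod adj l₁) ∈ star adj v) :
    side v c u ≠ side v c (u * wprod adj (l₁ ++ v :: l₂)) := by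
  have h1 : side v c u = side v c (u * wprod adj l₁) := by
    by_contra hne
    obtain ⟨k₁, k₂, rfl, hk⟩ := exists_crossing hne
    rw [List.append_assoc, List.cons_append, geod_iff u] at h
    exact not_crosses_twice h.symm hk hc
  have h2 : side v c (u * wprod adj l₁ * gen adj v) =
      side v c (u * wprod adj l₁ * gen adj v * wprod adj l₂) := by
    by_contra hne
    obtain ⟨k₁, k₂, rfl, hk⟩ := exists_crossing hne
    rw [geod_iff u] at h
    refine not_crosses_twice h.symm hc ?_
    simpa only [wprod_append, wprod_cons, mul_assoc] using hk
  rw [wprod_append, wprod_cons, ← mul_assoc, ← mul_assoc, ← h2, h1, side_mul_gen, decide_eq_true]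
  · simp
  · exact ⟨rfl, hc⟩

end Geodesics

section Hyperbolic

variable {V V' : Type} {adj : V → V → Prop} {adj' : V' → V' → Prop} {a x y b : V'}
  {d e : V} {w : Fin 3 → V} {f : RACG adj → RACG adj'} {K : ℕ}

theorem HypPath.length_le_of_near (H : HypPath adj' a x y b) {R R' : ℕ}
    (hR' : ∀ c p p', side y c (f p) ≠ side y c (f p') →
      (∃ i, rd (f p) (c * line adj' x b i) < R') ∨ ∃ i, rd (f p') (c * line adj' x b i) < R')
    {p p' : RACG adj} {l₁ l₂ : List V'} (hg : Geod adj' (l₁ ++ l₂))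
    (hl : f p' = f p * wprod adj' (l₁ ++ l₂)) {i : ℤ}
    (hi : rd (f p) (f p * wprod adj' l₁ * line adj' y a i) < R) :
    l₁.length ≤ 3 * R' + 2 * R + 4 := by
  have hya := H.indep
  obtain ⟨c, hc⟩ : ∃ c, c = f p * wprod adj' l₁ := ⟨_, rfl⟩
  rw [← hc] at hi
  have h1 := rd_triangle (f p) (c * line adj' y a i) c
  have h2 := rd_line_le (adj := adj') (s := y) (t := a) i 0
  rw [← rd_mul_left c, line_zero, mul_one, sub_zero] at h2
  have h3 := (geod_iff (f p)).1 hg.append_left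
  rw [← hc] at h3
  by_contra! hlong
  have hlarge : 3 * R' + R + 4 < |i| := by omega
  have hwall : ∀ j : ℤ, (2 ≤ 2 * j ∧ 2 * j + R + R' + 1 < i) ∨
      (2 * j ≤ -2 ∧ i < 2 * j - R - R' - 1) → |pos hya (c⁻¹ * f p') - 2 * j| < R' := by
    intro j hj
    have e1 : side y (c * line adj' y a (2 * j)) (f p) ≠ side y (c * line adj' y a (2 * j)) c := by
      rw [side_eq_of_near hya hi.le (by omega)]
      rcases hj with hj | hj
      · have := side_line_ne hya c (k := j) (i := 0) (j := i) (by omega) (by omega)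
        rw [line_zero, mul_one] at this
        exact this.symm
      · have := side_line_ne hya c (k := j) (i := i) (j := 0) (by omega) (by omega)
        rwa [line_zero, mul_one] at this
    rw [hc] at e1
    obtain ⟨k₁, k₂, hk, hmem⟩ := exists_crossing e1
    have hl' : l₁ ++ l₂ = k₁ ++ y :: (k₂ ++ l₂) := by rw [hk]; simp
    rw [hl'] at hg hl
    have e2 := hg.side_ne hmem
    rw [← hl, ← hc] at e2
    have hpos : ∀ i', pos hya (c⁻¹ * (c * line adj' y a (2 * j) * line adj' x b i')) = 2 * j := by
      intro i'
      rw [mul_assoc, inv_mul_cancel_left, pos_mul, pos, map_line (posHom hya)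
        (posHom_other hya H.xy H.ax.symm) (posHom_other hya H.yb.symm H.ab.ne.symm),
        Equiv.Perm.one_apply, ← pos, pos_line]
    rcases hR' _ _ _ e2 with ⟨i', hi'⟩ | ⟨i', hi'⟩
    · exfalso
      have e3 := abs_pos_sub_le_rd hya c (f p) (c * line adj' y a (2 * j) * line adj' x b i')
      have e4 := abs_pos_sub_le_rd hya c (f p) (c * line adj' y a i)
      rw [hpos] at e3
      rw [inv_mul_cancel_left, pos_line] at e4
      rw [abs_le] at e3 e4
      omega
    · have e3 := abs_pos_sub_le_rd hya c (f p') (c * line adj' y a (2 * j) * line adj' x b i')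
      rw [hpos] at e3
      omega
  rcases lt_abs.1 hlarge with h | h
  · have e1 := hwall 1 (by omega)
    have e2 := hwall (1 + R') (by omega)
    rw [abs_lt] at e1 e2
    omega
  · have e1 := hwall (-1) (by omega)
    have e2 := hwall (-1 - R') (by omega)
    rw [abs_lt] at e1 e2
    omega

theorem QIEmb.short_of_mem (hf : QIEmb K f) (HX : JoinThree adj d e w) (H : HypPath adj' a x y b) :
    ∃ C : ℕ, ∀ p p' l₁ l₂, Geod adj' (l₁ ++ x :: l₂) → f p' = f p * wprod adj' (l₁ ++ x :: l₂) →
      l₁.length ≤ C ∨ l₂.length ≤ C := by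
  obtain ⟨R, hR⟩ := hf.one_sided HX H
  obtain ⟨R', hR'⟩ := hf.one_sided HX H.symm
  refine ⟨3 * R' + 2 * R + 4, fun p p' l₁ l₂ hg hl => ?_⟩
  have hne := hg.side_ne (u := f p) (c := f p * wprod adj' l₁) (by simp)
  rw [← hl] at hne
  rcases hR _ _ _ hne with ⟨i, hi⟩ | ⟨i, hi⟩
  · exact Or.inl (H.length_le_of_near hR' hg hl hi)
  · right
    have hg' := hg.reverse
    rw [List.reverse_append] at hg'
    have hc : f p' * wprod adj' (x :: l₂).reverse = f p * wprod adj' l₁ := by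
      rw [hl, wprod_reverse, wprod_append, ← mul_assoc, mul_inv_cancel_right]
    rw [← hc] at hi
    have := H.length_le_of_near hR' hg' (by
      rw [wprod_append, ← mul_assoc, hc, wprod_reverse, mul_inv_cancel_right]) hi
    rw [List.length_reverse, List.length_cons] at this
    omega

end Hyperbolic

section Planar

variable {V V' : Type} {adj : V → V → Prop} {adj' : V' → V' → Prop} {a x y b c c' : V'}
  {d e : V} {w : Fin 3 → V} {f : RACG adj → RACG adj'} {K : ℕ}

theorem exists_line_mul_line (ha : adj' a c ∧ adj' a c') (hb : adj' b c ∧ adj' b c')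
    (hc : adj' c a ∧ adj' c b) (hc' : adj' c' a ∧ adj' c' b) {l : List V'}
    (hl : ∀ v ∈ l, v = a ∨ v = b ∨ v = c ∨ v = c') :
    ∃ i j, wprod adj' l = line adj' c c' j * line adj' a b i := by
  induction l using List.reverseRecOn with
  | nil => exact ⟨0, 0, by simp⟩
  | append_singleton l v ih =>
    obtain ⟨i, j, h⟩ := ih fun v hv => hl v (by simp [hv])
    rw [wprod_append, h, wprod_cons, wprod_nil, mul_one, mul_assoc]
    rcases hl v (by simp) with rfl | rfl | rfl | rfl
    · exact ⟨_, _, by rw [line_mul_left]⟩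
    · exact ⟨_, _, by rw [line_mul_right]⟩
    · exact ⟨_, _, by rw [← (commute_gen_line hc.1 hc.2 i).eq, ← mul_assoc, line_mul_left]⟩
    · exact ⟨_, _, by rw [← (commute_gen_line hc'.1 hc'.2 i).eq, ← mul_assoc, line_mul_right]⟩

theorem length_or_exists_middle (l : List V') (n : ℕ) :
    l.length ≤ 2 * n ∨ ∃ A B E, l = A ++ (B ++ E) ∧ A.length = n ∧ E.length = n := by
  rcases le_or_gt l.length (2 * n) with h | h
  · exact Or.inl h
  · refine Or.inr ⟨l.take n, (l.drop n).take (l.length - 2 * n), (l.drop n).drop (l.length - 2 * n),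
      by simp, by simp; omega, by simp; omega⟩

theorem QIEmb.bounded_fibres (hf : QIEmb K f) (HX : JoinThree adj d e w)
    (H : HypPath adj' a x y b) (hcc : Indep adj' c c')
    (ha : adj' a c ∧ adj' a c') (hb : adj' b c ∧ adj' b c')
    (hc : adj' c a ∧ adj' c b) (hc' : adj' c' a ∧ adj' c' b)
    (hV : ∀ v, v = x ∨ v = y ∨ v = a ∨ v = b ∨ v = c ∨ v = c')
    (hne : a ≠ c ∧ a ≠ c' ∧ b ≠ c ∧ b ≠ c') :
    ∃ R : ℕ, ∀ p p', pos H.ab (f p) = pos H.ab (f p') → pos hcc (f p) = pos hcc (f p') →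
      rd p p' ≤ R := by
  obtain ⟨C₁, hC₁⟩ := hf.short_of_mem HX H
  obtain ⟨C₂, hC₂⟩ := hf.short_of_mem HX H.symm
  obtain ⟨C, hC⟩ : ∃ C, C = C₁ + C₂ + 1 := ⟨_, rfl⟩
  refine ⟨K * (6 * C) + K, fun p p' hab hcc' => (hf.lower p p').trans ?_⟩
  suffices rd (f p) (f p') ≤ 6 * C by gcongr
  obtain ⟨l, hl, hp'⟩ := exists_word (f p) (f p')
  rcases length_or_exists_middle l C with h | ⟨A, B, E, rfl, hA, hE⟩
  · omega
  have hg : Geod adj' (A ++ (B ++ E)) := by rw [geod_iff (f p), hl, ← hp']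
  have hB : ∀ v ∈ B, v = a ∨ v = b ∨ v = c ∨ v = c' := by
    intro v hv
    obtain ⟨B₁, B₂, rfl⟩ := List.append_of_mem hv
    have hsplit : A ++ (B₁ ++ v :: B₂ ++ E) = (A ++ B₁) ++ v :: (B₂ ++ E) := by simp
    rw [hsplit] at hg hp'
    rcases hV v with rfl | rfl | h
    · have := hC₁ p p' _ _ hg hp'
      simp only [List.length_append] at this
      omega
    · have := hC₂ p p' _ _ hg hp'
      simp only [List.length_append] at this
      omega
    · exact h
  obtain ⟨i, j, hij⟩ := exists_line_mul_line ha hb hc hc' hB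
  obtain ⟨q, hq⟩ : ∃ q, q = f p * wprod adj' A := ⟨_, rfl⟩
  obtain ⟨q', hq'⟩ : ∃ q', q' = q * wprod adj' B := ⟨_, rfl⟩
  have h1 : rd (f p) q ≤ C := by rw [hq, ← hA]; exact rd_mul_wprod_le _ _
  have h2 : rd q' (f p') ≤ C := by
    rw [hp', ← hE, wprod_append, wprod_append, ← mul_assoc, ← mul_assoc, ← hq, ← hq']
    exact rd_mul_wprod_le _ _
  have hpos : ∀ {s t : V'} (h : Indep adj' s t), ThetaQI.pos h (f p) = ThetaQI.pos h (f p') →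
      |ThetaQI.pos h (wprod adj' B)| ≤ 2 * C := by
    intro s t h heq
    have e1 := abs_pos_sub_le h (f p) q
    have e2 := abs_pos_sub_le h q' (f p')
    have e3 := abs_pos_mul_sub h q (wprod adj' B) 1
    rw [mul_one, ← hq', pos_one, sub_zero] at e3
    rw [← e3]
    rw [abs_le] at *
    omega
  have hi : |i| ≤ 2 * C := by
    have := hpos H.ab hab
    rwa [hij, pos_mul, pos_line, map_line (posHom H.ab)
      (posHom_other H.ab hne.1.symm hne.2.2.1.symm)
      (posHom_other H.ab hne.2.1.symm hne.2.2.2.symm), Equiv.Perm.one_apply] at this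
  have hj : |j| ≤ 2 * C := by
    have := hpos hcc hcc'
    rwa [hij, pos_mul, ThetaQI.pos, map_line (posHom hcc) (posHom_other hcc hne.1 hne.2.1)
      (posHom_other hcc hne.2.2.1 hne.2.2.2), Equiv.Perm.one_apply, ← ThetaQI.pos, pos_line] at this
  have h3 : rd q (q * line adj' c c' j) ≤ 2 * C := by
    have := rd_line_le (adj := adj') (s := c) (t := c') 0 j
    rw [← rd_mul_left q, line_zero, mul_one, zero_sub, abs_neg] at this
    omega
  have h4 : rd (q * line adj' c c' j) q' ≤ 2 * C := by
    have := rd_line_le (adj := adj') (s := a) (t := b) 0 i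
    rw [← rd_mul_left (q * line adj' c c' j), line_zero, mul_one, zero_sub, abs_neg, mul_assoc,
      ← hij, ← hq'] at this
    omega
  have t1 := rd_triangle (f p) q (f p')
  have t2 := rd_triangle q q' (f p')
  have t3 := rd_triangle q (q * line adj' c c' j) q'
  omega

end Planar

section Growth

variable {V : Type} {adj : V → V → Prop} {d e : V} {w : Fin 3 → V}

/-- A three-parameter family of elements witnessing cubic growth. -/
noncomputable def cubic (adj : V → V → Prop) (d e : V) (w : Fin 3 → V) (q : ℕ × ℕ × ℕ) : RACG adj :=
  line adj d e q.1 *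
    (line adj (w 1) (w 0) (4 * q.2.1 : ℕ) * line adj (w 0) (w 2) (4 * q.2.2 : ℕ))

theorem JoinThree.cubic_injective (H : JoinThree adj d e w) :
    Function.Injective (cubic adj d e w) := by
  rintro ⟨i, j, l⟩ ⟨i', j', l'⟩ h
  unfold cubic at h
  dsimp only at h
  have hline : ∀ (s t : Fin 3) m, posHom H.ab (line adj (w s) (w t) m) = 1 := fun s t m =>
    map_line _ (posHom_other _ (H.ca s) (H.cb s)) (posHom_other _ (H.ca t) (H.cb t)) m
  have hi := congrArg (pos H.ab) h
  simp only [pos_mul, hline, Equiv.Perm.one_apply] at hi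
  simp only [pos, hline, Equiv.Perm.one_apply, posHom_line] at hi
  obtain rfl : i = i' := by
    split_ifs at hi <;> omega
  have h10 : (1 : Fin 3) ≠ 0 := by decide
  rw [mul_right_inj] at h
  have hj := congrArg (pos (H.cc 1 0 h10)) h
  have heven : ∀ n : ℕ, Even ((4 * n : ℕ) : ℤ) := fun n => ⟨2 * n, by push_cast; ring⟩
  simp only [pos_mul, posHom_line, heven, if_true] at hj
  have hr := fun m => pos_line_right (u := w 2) (H.cc 1 0 h10) (H.cc 2 1 (by decide)).ne
    (H.cc 2 0 (by decide)).ne m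
  obtain rfl : j = j' := by
    rcases hr (4 * l : ℕ) with h1 | h1 <;> rcases hr (4 * l' : ℕ) with h2 | h2 <;>
      rw [h1, h2] at hj <;> omega
  rw [mul_right_inj] at h
  have hl := congrArg (pos (H.cc 0 2 (by decide))) h
  rw [pos_line, pos_line] at hl
  obtain rfl : l = l' := by omega
  rfl

theorem rd_one_cubic_le (q : ℕ × ℕ × ℕ) :
    rd 1 (cubic adj d e w q) ≤ q.1 + 4 * q.2.1 + 4 * q.2.2 := by
  have key : ∀ (g : RACG adj) (s t : V) (n : ℕ), rd g (g * line adj s t n) ≤ n := by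
    intro g s t n
    have := rd_line_le (adj := adj) (s := s) (t := t) 0 n
    rw [← rd_mul_left g, line_zero, mul_one, zero_sub, abs_neg, Nat.abs_cast] at this
    exact_mod_cast this
  unfold cubic
  have h1 := key 1 d e q.1
  have h2 := key (line adj d e q.1) (w 1) (w 0) (4 * q.2.1)
  have h3 := key (line adj d e q.1 * line adj (w 1) (w 0) (4 * q.2.1 : ℕ)) (w 0) (w 2) (4 * q.2.2)
  rw [one_mul] at h1
  rw [mul_assoc] at h3
  have t1 := rd_triangle 1 (line adj d e q.1) (line adj d e q.1 *
    (line adj (w 1) (w 0) (4 * q.2.1 : ℕ) * line adj (w 0) (w 2) (4 * q.2.2 : ℕ)))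
  have t2 := rd_triangle (line adj d e q.1)
    (line adj d e q.1 * line adj (w 1) (w 0) (4 * q.2.1 : ℕ)) (line adj d e q.1 *
    (line adj (w 1) (w 0) (4 * q.2.1 : ℕ) * line adj (w 0) (w 2) (4 * q.2.2 : ℕ)))
  omega

theorem JoinThree.not_planar [Finite V] (H : JoinThree adj d e w) {F : RACG adj → ℤ × ℤ} {K R : ℕ}
    (hK : 1 ≤ K) (h₁ : ∀ p p', |(F p).1 - (F p').1| ≤ (K * rd p p' : ℕ))
    (h₂ : ∀ p p', |(F p).2 - (F p').2| ≤ (K * rd p p' : ℕ))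
    (hR : ∀ p p', F p = F p' → rd p p' ≤ R) : False := by
  have hball := finite_wordDist_ball (Set.finite_range (gen adj)) closure_gen R
  set N := hball.toFinset.card with hN
  set m := 361 * K ^ 2 * N + 1 with hm
  set S := Finset.range m ×ˢ Finset.range m ×ˢ Finset.range m with hS
  set z := F 1 with hz
  set M : ℤ := 9 * K * m with hM
  set T := Finset.Icc (z.1 - M) (z.1 + M) ×ˢ Finset.Icc (z.2 - M) (z.2 + M) with hT
  have hmaps : ∀ q ∈ S, F (cubic adj d e w q) ∈ T := by
    intro q hq
    simp only [hS, Finset.mem_product, Finset.mem_range] at hq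
    have h := rd_one_cubic_le (adj := adj) (d := d) (e := e) (w := w) q
    have h' : K * rd 1 (cubic adj d e w q) ≤ K * (9 * m) := Nat.mul_le_mul_left K (by omega)
    have h'' : ((K * rd 1 (cubic adj d e w q) : ℕ) : ℤ) ≤ M := by
      rw [hM]; calc _ ≤ ((K * (9 * m) : ℕ) : ℤ) := by exact_mod_cast h'
        _ = _ := by push_cast; ring
    have e1 := (h₁ 1 (cubic adj d e w q)).trans h''
    have e2 := (h₂ 1 (cubic adj d e w q)).trans h''
    rw [← hz, abs_le] at e1 e2
    simp only [hT, Finset.mem_product, Finset.mem_Icc]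
    omega
  have hfib : ∀ t ∈ T, (S.filter fun q => F (cubic adj d e w q) = t).card ≤ N := by
    intro t _
    rcases (S.filter fun q => F (cubic adj d e w q) = t).eq_empty_or_nonempty with h | ⟨q₀, hq₀⟩
    · rw [h]; simp
    rw [Finset.mem_filter] at hq₀
    refine Finset.card_le_card_of_injOn (fun q => (cubic adj d e w q₀)⁻¹ * cubic adj d e w q)
      (fun q hq => ?_) fun q _ q' _ h => H.cubic_injective (mul_left_cancel h)
    rw [Finset.mem_coe, Finset.mem_filter] at hq
    rw [Finset.mem_coe, Set.Finite.mem_toFinset, Set.mem_ofPred_eq, wordDist_one_inv_mul]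
    exact hR _ _ (hq₀.2.trans hq.2.symm)
  have hcard := Finset.card_le_mul_card_image_of_maps_to hmaps N hfib
  have hSc : S.card = m * (m * m) := by simp [hS]
  have h_int : ∀ u : ℤ, (Finset.Icc (u - M) (u + M)).card = 18 * K * m + 1 := by
    intro u
    rw [Int.card_Icc, hM]
    have : u + 9 * K * m + 1 - (u - 9 * K * m) = ((18 * K * m + 1 : ℕ) : ℤ) := by push_cast; ring
    rw [this, Int.toNat_natCast]
  rw [hSc, hT, Finset.card_product, h_int, h_int] at hcard
  have hm1 : 1 ≤ m := by omega
  have hKm : 18 * K * m + 1 ≤ 19 * (K * m) := by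
    have := Nat.mul_le_mul hK hm1
    rw [mul_assoc]
    omega
  have h3 : m * (m * m) ≤ N * (19 * (K * m) * (19 * (K * m))) :=
    hcard.trans (Nat.mul_le_mul_left N (Nat.mul_le_mul hKm hKm))
  have h4 : N * (19 * (K * m) * (19 * (K * m))) = (361 * K ^ 2 * N) * (m * m) := by ring
  rw [h4] at h3
  have := Nat.le_of_mul_le_mul_right h3 (Nat.mul_pos hm1 hm1)
  omega

end Growth

section Embeddings

variable {V V' : Type} [Finite V] [Finite V'] {adj : V → V → Prop} {adj' : V' → V' → Prop}

theorem exists_qiEmb {f : RACG adj → RACG adj'} {g : RACG adj' → RACG adj} (hf : Ctl f)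
    (hg : Ctl g) (h : Close (g ∘ f)) : ∃ K, QIEmb K fun x => (f x⁻¹)⁻¹ := by
  obtain ⟨K₁, h₁⟩ := hf.exists_lipschitz (Set.finite_range (gen adj)) closure_gen
    (closure_gen (adj := adj'))
  obtain ⟨K₂, h₂⟩ := hg.exists_lipschitz (Set.finite_range (gen adj')) closure_gen
    (closure_gen (adj := adj))
  obtain ⟨R, hR⟩ := h.exists_bound (S := Set.range (gen adj))
  refine ⟨K₁ + K₂ + 2 * R + 1, by omega, fun p p' => ?_, fun p p' => ?_⟩
  · exact (h₁ p p').trans (Nat.mul_le_mul_right _ (by omega))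
  · have e1 : rd _ _ ≤ R := hR p
    have e2 : rd _ _ ≤ R := hR p'
    have e3 : rd _ _ ≤ K₂ * rd _ _ := h₂ (f p⁻¹)⁻¹ (f p'⁻¹)⁻¹
    rw [inv_inv, inv_inv] at e3
    dsimp only [Function.comp_apply] at e1 e2
    have t1 := rd_triangle p (g (f p⁻¹))⁻¹ p'
    have t2 := rd_triangle (g (f p⁻¹))⁻¹ (g (f p'⁻¹))⁻¹ p'
    rw [rd_comm] at e1
    have e4 := Nat.mul_le_mul_right (rd (f p⁻¹)⁻¹ (f p'⁻¹)⁻¹)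
      (show K₂ ≤ K₁ + K₂ + 2 * R + 1 by omega)
    omega

variable {a x y b c c' : V'} {d e : V} {w : Fin 3 → V}

theorem JoinThree.not_coarseEquiv (HX : JoinThree adj d e w) (H : HypPath adj' a x y b) :
    ¬ CoarseEquiv (RACG adj) (RACG adj') := by
  rintro ⟨f, g, hf, hg, hgf, hfg⟩
  obtain ⟨K, hK⟩ := exists_qiEmb hf hg hgf
  obtain ⟨R, hR⟩ := hfg.exists_bound (S := Set.range (gen adj'))
  refine hK.not_coarsely_surjective HX H R fun q => ⟨(g q⁻¹)⁻¹, ?_⟩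
  rw [inv_inv]
  exact hR q

theorem JoinThree.not_coarseRetract (HX : JoinThree adj d e w) (H : HypPath adj' a x y b)
    (hcc : Indep adj' c c') (ha : adj' a c ∧ adj' a c') (hb : adj' b c ∧ adj' b c')
    (hc : adj' c a ∧ adj' c b) (hc' : adj' c' a ∧ adj' c' b)
    (hV : ∀ v, v = x ∨ v = y ∨ v = a ∨ v = b ∨ v = c ∨ v = c')
    (hne : a ≠ c ∧ a ≠ c' ∧ b ≠ c ∧ b ≠ c') : ¬ CoarseRetract (RACG adj) (RACG adj') := by
  rintro ⟨f, g, hf, hg, hgf⟩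
  obtain ⟨K, hK⟩ := exists_qiEmb hf hg hgf
  obtain ⟨R, hR⟩ := hK.bounded_fibres HX H hcc ha hb hc hc' hV hne
  refine HX.not_planar (F := fun p => (pos H.ab (f p⁻¹)⁻¹, pos hcc (f p⁻¹)⁻¹)) (R := R)
    hK.one_le (fun p p' => ?_) (fun p p' => ?_) fun p p' h => ?_
  · exact (abs_pos_sub_le H.ab _ _).trans (by exact_mod_cast hK.upper p p')
  · exact (abs_pos_sub_le hcc _ _).trans (by exact_mod_cast hK.upper p p')
  · rw [Prod.mk.injEq] at h
    exact hR p p' h.1 h.2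

end Embeddings

section Theta

variable {k : ℕ} {n : Fin k → ℕ}

theorem thetaIndep_essential : Indep (ThetaAdj n) (Sum.inl true) (Sum.inl false) :=
  ⟨by simp, by simp [ThetaAdj], by simp [ThetaAdj]⟩

theorem thetaIndep_interior {i i' : Fin k} (h : i ≠ i') (j : Fin (n i)) (j' : Fin (n i')) :
    Indep (ThetaAdj n) (Sum.inr ⟨i, j⟩) (Sum.inr ⟨i', j'⟩) := by
  refine ⟨fun h' => h ?_, fun h' => h (Fin.ext h'.1), fun h' => h (Fin.ext h'.1.symm)⟩
  exact congrArg Sigma.fst (Sum.inr_injective h')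

theorem thetaAdj_linear {i : Fin k} (h : n i = 1) (j : Fin (n i)) (s : Bool) :
    ThetaAdj n (Sum.inl s) (Sum.inr ⟨i, j⟩) ∧ ThetaAdj n (Sum.inr ⟨i, j⟩) (Sum.inl s) := by
  have hj := j.is_lt
  have : (j : ℕ) = 0 := by omega
  cases s <;> simp [ThetaAdj, h, this]

theorem theta_hypPath {i : Fin k} (h : n i = 2) :
    HypPath (ThetaAdj n) (Sum.inl true) (Sum.inr ⟨i, ⟨0, by omega⟩⟩) (Sum.inr ⟨i, ⟨1, by omega⟩⟩)
      (Sum.inl false) where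
  nx := by
    rintro (s | ⟨i', j⟩) hu
    · cases s <;> simp [ThetaAdj, h] at hu ⊢
    · obtain rfl : i' = i := by
        rcases hu with hu | hu
        exacts [Fin.ext hu.1, Fin.ext hu.1.symm]
      right
      have hj := j.is_lt
      simp only [ThetaAdj] at hu
      simp only [Sum.inr.injEq, Sigma.mk.injEq, heq_eq_eq, true_and, Fin.ext_iff]
      omega
  ny := by
    rintro (s | ⟨i', j⟩) hu
    · cases s <;> simp [ThetaAdj, h] at hu ⊢
    · obtain rfl : i' = i := by
        rcases hu with hu | hu
        exacts [Fin.ext hu.1, Fin.ext hu.1.symm]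
      left
      have hj := j.is_lt
      simp only [ThetaAdj] at hu
      simp only [Sum.inr.injEq, Sigma.mk.injEq, heq_eq_eq, true_and, Fin.ext_iff]
      omega
  ab := thetaIndep_essential
  ax := by simp
  ay := by simp
  xy := by simp
  xb := by simp
  yb := by simp

theorem theta_joinThree :
    JoinThree (ThetaAdj fun _ : Fin 3 => 1) (Sum.inl true) (Sum.inl false)
      fun i => Sum.inr ⟨i, 0⟩ where
  ab := thetaIndep_essential
  cc i j h := thetaIndep_interior h _ _
  ca := by simp
  cb := by simp
  comm := by
    rintro (s | ⟨i, j⟩) h₁ h₂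
    · cases s <;> simp at h₁ h₂
    · exact ⟨(thetaAdj_linear (n := fun _ => 1) rfl j _).2,
        (thetaAdj_linear (n := fun _ => 1) rfl j _).2⟩

/-- The interior lengths `1, …, 1, 2` with `m` ones. -/
def onesTwo (m : ℕ) (i : Fin (m + 1)) : ℕ := (i : ℕ) / m + 1

theorem onesTwo_of_lt {m : ℕ} {i : Fin (m + 1)} (h : (i : ℕ) < m) : onesTwo m i = 1 := by
  rw [onesTwo, Nat.div_eq_of_lt h]

theorem onesTwo_last {m : ℕ} (hm : 0 < m) : onesTwo m (Fin.last m) = 2 := by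
  rw [onesTwo, Fin.val_last, Nat.div_self hm]

theorem onesTwo_pos {m : ℕ} (i : Fin (m + 1)) : 1 ≤ onesTwo m i := Nat.succ_pos _

theorem linearDegree_onesTwo {m : ℕ} (hm : 0 < m) : linearDegree (onesTwo m) = m := by
  have : (Finset.univ.filter fun i => onesTwo m i = 1) = Finset.univ.erase (Fin.last m) := by
    ext i
    simp only [Finset.mem_filter, Finset.mem_univ, true_and, Finset.mem_erase, and_true]
    constructor
    · rintro h rfl
      rw [onesTwo_last hm] at h
      omega
    · intro h
      exact onesTwo_of_lt (Fin.val_lt_last h)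
  rw [linearDegree, this, Finset.card_erase_of_mem (Finset.mem_univ _)]
  simp

theorem not_coarseEquiv_theta_three :
    ¬ CoarseEquiv (ThetaRACG fun _ : Fin 3 => 1) (ThetaRACG (onesTwo 3)) :=
  theta_joinThree.not_coarseEquiv (theta_hypPath (onesTwo_last (by omega)))

theorem not_coarseRetract_theta_two :
    ¬ CoarseRetract (ThetaRACG fun _ : Fin 3 => 1) (ThetaRACG (onesTwo 2)) := by
  have h0 : onesTwo 2 0 = 1 := onesTwo_of_lt (by simp)
  have h1 : onesTwo 2 1 = 1 := onesTwo_of_lt (by simp)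
  have h2 : onesTwo 2 2 = 2 := onesTwo_last (by omega)
  refine theta_joinThree.not_coarseRetract (theta_hypPath h2)
    (thetaIndep_interior (show (0 : Fin 3) ≠ 1 by decide) ⟨0, by omega⟩ ⟨0, by omega⟩)
    ⟨(thetaAdj_linear h0 _ _).1, (thetaAdj_linear h1 _ _).1⟩
    ⟨(thetaAdj_linear h0 _ _).1, (thetaAdj_linear h1 _ _).1⟩
    ⟨(thetaAdj_linear h0 _ _).2, (thetaAdj_linear h0 _ _).2⟩
    ⟨(thetaAdj_linear h1 _ _).2, (thetaAdj_linear h1 _ _).2⟩ ?_ (by simp)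
  rintro (s | ⟨i, j, hj⟩)
  · cases s <;> simp
  · have hi : i = 0 ∨ i = 1 ∨ i = 2 := by fin_cases i <;> simp
    rcases hi with rfl | rfl | rfl
    · obtain rfl : j = 0 := by omega
      simp
    · obtain rfl : j = 0 := by omega
      simp
    · obtain rfl | rfl : j = 0 ∨ j = 1 := by omega
      · simp
      · simp

theorem coarseRetract_theta_three :
    CoarseRetract (ThetaRACG fun _ : Fin 3 => 1) (ThetaRACG (onesTwo 3)) := by
  have hlt (i : Fin 3) : onesTwo 3 i.castSucc = 1 := onesTwo_of_lt (by simp)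
  refine coarseRetract_of_homs
    (racgLift (fun v => gen (ThetaAdj (onesTwo 3)) (v.map id fun v =>
      ⟨v.1.castSucc, ⟨0, onesTwo_pos _⟩⟩)) (fun v => gen_mul_self _) ?_)
    (racgLift (Sum.elim (fun s => gen (ThetaAdj fun _ : Fin 3 => 1) (Sum.inl s)) fun v =>
      if h : (v.1 : ℕ) < 3 then gen (ThetaAdj fun _ : Fin 3 => 1) (Sum.inr ⟨⟨v.1, h⟩, 0⟩) else 1)
      ?_ ?_) ?_
  · rintro (s | ⟨i, j⟩) (s' | ⟨i', j'⟩) h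
    · exact h.elim
    · exact gen_comm (thetaAdj_linear (hlt i') _ s).1
    · exact gen_comm (thetaAdj_linear (hlt i) _ s').2
    · obtain rfl : i = i' := Fin.ext h.1
      rfl
  · rintro (s | ⟨i, j⟩)
    · exact gen_mul_self _
    · simp only [Sum.elim_inr]
      split_ifs
      exacts [gen_mul_self _, one_mul 1]
  · rintro (s | ⟨i, j⟩) (s' | ⟨i', j'⟩) h
    · exact h.elim
    · simp only [Sum.elim_inr, Sum.elim_inl]
      split_ifs
      exacts [gen_comm (thetaAdj_linear (n := fun _ => 1) rfl _ s).1, by rw [one_mul, mul_one]]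
    · simp only [Sum.elim_inr, Sum.elim_inl]
      split_ifs
      exacts [gen_comm (thetaAdj_linear (n := fun _ => 1) rfl _ s').2, by rw [one_mul, mul_one]]
    · obtain rfl : i = i' := Fin.ext h.1
      rfl
  · intro g
    rw [← MonoidHom.comp_apply]
    nth_rewrite 2 [← MonoidHom.id_apply _ g]
    congr 1
    refine racg_hom_ext ?_
    rintro (s | ⟨i, j⟩)
    · simp [racgLift_gen]
    · obtain rfl : j = 0 := Subsingleton.elim _ _
      simp [racgLift_gen]

theorem not_coarseEquiv_theta_two_three :
    ¬ CoarseEquiv (ThetaRACG (onesTwo 3)) (ThetaRACG (onesTwo 2)) := fun h =>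
  not_coarseRetract_theta_two (coarseRetract_theta_three.trans h.retract)

/-- A generalized Θ-graph of linear degree at least two is coarsely equivalent to one of three
model graphs. -/
theorem exists_theta_model (hk : 3 ≤ k) (hn : ∀ i, 1 ≤ n i) (hl : 2 ≤ linearDegree n) :
    (linearDegree n = 2 ∧ 1 ≤ k - linearDegree n ∧
      CoarseEquiv (ThetaRACG n) (ThetaRACG (onesTwo 2))) ∨
    (3 ≤ linearDegree n ∧ 1 ≤ k - linearDegree n ∧
      CoarseEquiv (ThetaRACG n) (ThetaRACG (onesTwo 3))) ∨
    (3 ≤ linearDegree n ∧ k - linearDegree n = 0 ∧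
      CoarseEquiv (ThetaRACG n) (ThetaRACG fun _ : Fin 3 => 1)) := by
  have h2 := linearDegree_onesTwo (m := 2) (by omega)
  have h3 := linearDegree_onesTwo (m := 3) (by omega)
  have h1 : linearDegree (fun _ : Fin 3 => 1) = 3 := by simp [linearDegree]
  rcases hl.eq_or_lt with h | h
  · exact Or.inl ⟨h.symm, by omega, coarseEquiv_theta hn onesTwo_pos (by omega)⟩
  rcases Nat.eq_zero_or_pos (k - linearDegree n) with h0 | h0
  · exact Or.inr (Or.inr ⟨h, h0, coarseEquiv_theta hn (fun _ => le_rfl) (by omega)⟩)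
  · exact Or.inr (Or.inl ⟨h, h0, coarseEquiv_theta hn onesTwo_pos (by omega)⟩)

theorem coarseEquiv_theta_iff {k' : ℕ} {n' : Fin k' → ℕ} (hk : 3 ≤ k) (hk' : 3 ≤ k')
    (hn : ∀ i, 1 ≤ n i) (hn' : ∀ i, 1 ≤ n' i) (hl : 2 ≤ linearDegree n)
    (hl' : 2 ≤ linearDegree n') :
    CoarseEquiv (ThetaRACG n) (ThetaRACG n') ↔
      (linearDegree n = 2 ∧ linearDegree n' = 2 ∧
        1 ≤ k - linearDegree n ∧ 1 ≤ k' - linearDegree n') ∨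
      (3 ≤ linearDegree n ∧ 3 ≤ linearDegree n' ∧
        1 ≤ k - linearDegree n ∧ 1 ≤ k' - linearDegree n') ∨
      (3 ≤ linearDegree n ∧ 3 ≤ linearDegree n' ∧
        k - linearDegree n = 0 ∧ k' - linearDegree n' = 0) := by
  refine ⟨fun H => ?_, coarseEquiv_theta hn hn'⟩
  rcases exists_theta_model hk hn hl with ⟨h, hh, E⟩ | ⟨h, hh, E⟩ | ⟨h, hh, E⟩ <;>
    rcases exists_theta_model hk' hn' hl' with ⟨h', hh', E'⟩ | ⟨h', hh', E'⟩ | ⟨h', hh', E'⟩ <;>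
    have F := (E.symm.trans H).trans E'
  · exact Or.inl ⟨h, h', hh, hh'⟩
  · exact (not_coarseEquiv_theta_two_three F.symm).elim
  · exact (not_coarseRetract_theta_two F.symm.retract).elim
  · exact (not_coarseEquiv_theta_two_three F).elim
  · exact Or.inr (Or.inl ⟨h, h', hh, hh'⟩)
  · exact (not_coarseEquiv_theta_three F.symm).elim
  · exact (not_coarseRetract_theta_two F.retract).elim
  · exact (not_coarseEquiv_theta_three F).elim
  · exact Or.inr (Or.inr ⟨h, h', hh, hh'⟩)

end Theta

end ThetaQI

/-- **Theorem 1.6 / A.8.** Let `Θ` and `Θ'` be generalized Θ-graphs with linear degrees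
`ℓ, ℓ' ≥ 2` and hyperbolic degrees `h = k − ℓ`, `h' = k' − ℓ'`. The (non-hyperbolic)
right-angled Coxeter groups `W_Θ` and `W_{Θ'}` are quasi-isometric if and only if
(1) `ℓ = ℓ' = 2` and `h, h' ≥ 1`; or (2) `ℓ, ℓ' ≥ 3` and `h, h' ≥ 1`; or
(3) `ℓ, ℓ' ≥ 3` and `h = h' = 0`. -/
theorem thetaRACG_quasiIsometric_iff
    (k k' : ℕ) (hk : 3 ≤ k) (hk' : 3 ≤ k')
    (n : Fin k → ℕ) (n' : Fin k' → ℕ) (hn : ∀ i, 1 ≤ n i) (hn' : ∀ i, 1 ≤ n' i)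
    (hl : 2 ≤ linearDegree n) (hl' : 2 ≤ linearDegree n') :
    QuasiIsometricGroups (ThetaRACG n) (ThetaRACG n') ↔
      (linearDegree n = 2 ∧ linearDegree n' = 2 ∧
        1 ≤ k - linearDegree n ∧ 1 ≤ k' - linearDegree n') ∨
      (3 ≤ linearDegree n ∧ 3 ≤ linearDegree n' ∧
        1 ≤ k - linearDegree n ∧ 1 ≤ k' - linearDegree n') ∨
      (3 ≤ linearDegree n ∧ 3 ≤ linearDegree n' ∧
        k - linearDegree n = 0 ∧ k' - linearDegree n' = 0) := by
  exact ⟨fun h => (ThetaQI.coarseEquiv_theta_iff hk hk' hn hn' hl hl').1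
      (ThetaQI.coarseEquiv_of_quasiIsometricGroups h),
    fun h => ThetaQI.quasiIsometric_of_coarseEquiv_theta (ThetaQI.coarseEquiv_theta hn hn' h)⟩
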